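/- arXiv:0909.2841 — 2 statements merged into one kernel-verified Lean document; each statement's English description precedes it below -/
import Mathlib

section
/- For every natural number n there exists k > 1 (depending only on n) with the following property: let K be any finitely generated coherent locally indicable group of cohomological dimension at most 2, and let G be obtained from K by an iterated sequence of n non-proper HNN extensions, i.e. G_0 = K and G_{i+1} = G_i ⋊_{α_{i+1}} ℤ with G = G_n, where every automorphism α_i has no periodic conjugacy classes. Then every finitely generated subgroup S of G satisfies ω(S) ≥ k, or S is isomorphic to ℤᵐ for some m ≤ 2 or to the Klein bottle group. -/
open Filter

/-- The set of elements of `G` expressible as a word of length at most `n`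
in elements of `S` and their inverses. -/
def wordBall {G : Type*} [Group G] (S : Finset G) (n : ℕ) : Set G :=
  { g | ∃ l : List G, l.length ≤ n ∧ (∀ x ∈ l, x ∈ S ∨ x⁻¹ ∈ S) ∧ l.prod = g }

/-- `ω(G,S)`: the exponential growth rate of `G` with respect to the finite set `S`,
i.e. the limit (= limsup, since the limit exists by submultiplicativity) of `γ_S(n)^(1/n)`. -/
noncomputable def growthRate {G : Type*} [Group G] (S : Finset G) : ℝ :=
  Filter.limsup (fun n : ℕ => ((wordBall S n).ncard : ℝ) ^ (1 / (n : ℝ))) Filter.atTop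

/-- `ω(G)`: the growth constant of `G`, the infimum of `ω(G,S)` over all finite
generating sets `S` of `G`. -/
noncomputable def growthOmega (G : Type*) [Group G] : ℝ :=
  sInf { r : ℝ | ∃ S : Finset G, Subgroup.closure (S : Set G) = ⊤ ∧ growthRate S = r }
/-- The single relator `t a t⁻¹ a` of the Klein bottle group `⟨a, t | t a t⁻¹ = a⁻¹⟩`,
with generator `0` playing the role of `a` and generator `1` the role of `t`. -/
def kleinBottleRels : Set (FreeGroup (Fin 2)) :=
  {FreeGroup.of 1 * FreeGroup.of 0 * (FreeGroup.of 1)⁻¹ * FreeGroup.of 0}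

/-- The Klein bottle group `⟨a, t | t a t⁻¹ = a⁻¹⟩`. -/
abbrev KleinBottleGroup : Type := PresentedGroup kleinBottleRels
/-- The action of `Multiplicative ℤ` on `K` whose generator acts by the automorphism `α`. -/
def zAction {K : Type*} [Group K] (α : MulAut K) : Multiplicative ℤ →* MulAut K where
  toFun n := α ^ (Multiplicative.toAdd n)
  map_one' := by simp
  map_mul' m n := by simp [zpow_add]

/-- The semidirect product `K ⋊_α ℤ`, i.e. the non-proper HNN extension of `K` by `α`. -/
abbrev zSemidirect (K : Type*) [Group K] (α : MulAut K) :=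
  SemidirectProduct K (Multiplicative ℤ) (zAction α)
/-- The automorphism `α` of `K` has a periodic conjugacy class: some nontrivial `k ∈ K`
is conjugate to `αⁿ(k)` for a nonzero integer `n`. -/
def HasPeriodicConjugacyClass {K : Type*} [Group K] (α : MulAut K) : Prop :=
  ∃ (k : K) (n : ℤ) (c : K), k ≠ 1 ∧ n ≠ 0 ∧ (α ^ n) k = c * k * c⁻¹
/-- A group is locally indicable if every nontrivial finitely generated subgroup
admits a surjective homomorphism onto `ℤ`. -/
def LocallyIndicable (K : Type*) [Group K] : Prop :=
  ∀ H : Subgroup K, H.FG → H ≠ ⊥ → ∃ f : ↥H →* Multiplicative ℤ, Function.Surjective f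
/-- A group is finitely presented if it is isomorphic to a presented group on finitely
many generators with finitely many relators. -/
def IsFinitelyPresented (G : Type*) [Group G] : Prop :=
  ∃ (n : ℕ) (rels : Finset (FreeGroup (Fin n))),
    Nonempty (G ≃* PresentedGroup (rels : Set (FreeGroup (Fin n))))

/-- A group is coherent if every finitely generated subgroup is finitely presented. -/
def IsCoherent (G : Type*) [Group G] : Prop :=
  ∀ H : Subgroup G, H.FG → IsFinitelyPresented ↥H

/-- `K` has cohomological dimension at most 2: the group cohomology `Hⁱ(K; M)` vanishes
for all `i ≥ 3` and all `ℤK`-modules `M`. -/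
def CohDimLE2 (K : Type) [Group K] : Prop :=
  ∀ (M : Rep ℤ K) (i : ℕ), 3 ≤ i → Subsingleton (groupCohomology M i)

/-- `IsIteratedHNN K n G gi`: the group `G` is obtained from `K` by an iterated sequence
of `n` non-proper HNN extensions `G_{i+1} = G_i ⋊_{α_{i+1}} ℤ`, where every automorphism
used has no periodic conjugacy classes. -/
def IsIteratedHNN (K : Type) [Group K] : ℕ → ∀ (G : Type), Group G → Prop
  | 0, G, gi => letI := gi; Nonempty (K ≃* G)
  | n + 1, G, gi =>
      ∃ (H : Type) (hi : Group H), IsIteratedHNN K n H hi ∧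
        (letI := gi; letI := hi;
         ∃ α : MulAut H, ¬ HasPeriodicConjugacyClass α ∧ Nonempty (G ≃* zSemidirect H α))


/-- Elementary form of vanishing of `H³`. -/
def Van3 (G : Type) [Group G] : Prop :=
  ∀ (M : Type) [AddCommGroup M] (ρ : G →* AddMonoid.End M) (τ : G → G → G → M),
    (∀ a b c d, ρ a (τ b c d) + τ a (b * c) d + τ a b c = τ (a * b) c d + τ a b (c * d)) →
    ∃ σ : G → G → M, ∀ a b c, τ a b c = ρ a (σ b c) - σ (a * b) c + σ a (b * c) - σ a b

/-- Elementary form of vanishing of `H²`. -/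
def Van2 (G : Type) [Group G] : Prop :=
  ∀ (M : Type) [AddCommGroup M] (ρ : G →* AddMonoid.End M) (σ : G → G → M),
    (∀ a b c, ρ a (σ b c) + σ a (b * c) = σ (a * b) c + σ a b) →
    ∃ h : G → M, ∀ a b, σ a b = ρ a (h b) - h (a * b) + h a

/-- the ℤ-representation attached to an action by additive endomorphisms -/
def repOfEnd {G M : Type} [Group G] [AddCommGroup M] (ρ : G →* AddMonoid.End M) :
    Representation ℤ G M where
  toFun g := (ρ g).toIntLinearMap
  map_one' := by rw [map_one]; rfl
  map_mul' a b := by rw [map_mul]; rfl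

theorem van3_of_cohDim {G : Type} [Group G] (h : CohDimLE2 G) : Van3 G := by
  intro M _ ρ τ hτ
  let A : Rep ℤ G := Rep.of (repOfEnd ρ)
  have hs : Subsingleton (groupCohomology A 3) := h A 3 le_rfl
  let f : (Fin 3 → G) → A := fun g => τ (g 0) (g 1) (g 2)
  have hf : inhomogeneousCochains.d A 3 f = 0 := by
    funext g
    rw [inhomogeneousCochains.d_hom_apply]
    have := hτ (g 0) (g 1) (g 2) (g 3)
    have e0 : Fin.contractNth (0 : Fin 4) (· * ·) g = ![g 0 * g 1, g 2, g 3] := by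
      funext i; fin_cases i <;> simp [Fin.contractNth]
    have e1 : Fin.contractNth (1 : Fin 4) (· * ·) g = ![g 0, g 1 * g 2, g 3] := by
      funext i; fin_cases i <;> simp [Fin.contractNth]
    have e2 : Fin.contractNth (2 : Fin 4) (· * ·) g = ![g 0, g 1, g 2 * g 3] := by
      funext i; fin_cases i <;> simp [Fin.contractNth]
    have e3 : Fin.contractNth (3 : Fin 4) (· * ·) g = ![g 0, g 1, g 2] := by
      funext i; fin_cases i <;> simp [Fin.contractNth]
    have h0 : A.ρ (g 0) (f fun i => g i.succ) = ρ (g 0) (τ (g 1) (g 2) (g 3)) := rfl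
    rw [Fin.sum_univ_four, e0, e1, e2, e3, h0]
    have f0 : ∀ x y z : G, f ![x, y, z] = τ x y z := fun _ _ _ => rfl
    simp only [f0]
    have hM : ((-1 : ℤ) ^ ((((0 : Fin 4) : ℕ)) + 1)) = -1 ∧ ((-1 : ℤ) ^ ((((1 : Fin 4) : ℕ)) + 1)) = 1
      ∧ ((-1 : ℤ) ^ ((((2 : Fin 4) : ℕ)) + 1)) = -1 ∧ ((-1 : ℤ) ^ ((((3 : Fin 4) : ℕ)) + 1)) = 1 := by
      norm_num
    rw [hM.1, hM.2.1, hM.2.2.1, hM.2.2.2]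
    simp only [one_smul, neg_smul]
    change _ = (0 : M)
    rw [← sub_eq_zero] at this
    rw [← this]
    change _ + (_ + _ + _ + _) = _
    abel
  have hex : ((groupCohomology.inhomogeneousCochains A).sc' 2 3 4).Exact := by
    rw [← HomologicalComplex.exactAt_iff' _ 2 3 4 (by simp) (by simp),
      HomologicalComplex.exactAt_iff_isZero_homology]
    exact ModuleCat.isZero_of_subsingleton (groupCohomology A 3)
  rw [CategoryTheory.ShortComplex.moduleCat_exact_iff] at hex
  obtain ⟨s, hs⟩ := hex f (by
    change ((groupCohomology.inhomogeneousCochains A).d 3 4) f = 0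
    rw [groupCohomology.inhomogeneousCochains.d_def]; exact hf)
  change ((groupCohomology.inhomogeneousCochains A).d 2 3) s = f at hs
  rw [groupCohomology.inhomogeneousCochains.d_def] at hs
  obtain ⟨s', hs'⟩ : ∃ s' : (Fin 2 → G) → A, s' = s := ⟨s, rfl⟩
  refine ⟨fun a b => (s' : (Fin 2 → G) → M) ![a, b], fun a b c => ?_⟩
  have := congrFun hs ![a, b, c]
  rw [← hs'] at this
  replace this := (inhomogeneousCochains.d_hom_apply A 2 s' _).symm.trans this
  have f0 : ∀ x y z : G, f ![x, y, z] = τ x y z := fun _ _ _ => rfl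
  rw [f0, Fin.sum_univ_three] at this
  have e0 : Fin.contractNth (0 : Fin 3) (· * ·) ![a, b, c] = ![a * b, c] := by
    funext i; fin_cases i <;> simp [Fin.contractNth]
  have e1 : Fin.contractNth (1 : Fin 3) (· * ·) ![a, b, c] = ![a, b * c] := by
    funext i; fin_cases i <;> simp [Fin.contractNth]
  have e2 : Fin.contractNth (2 : Fin 3) (· * ·) ![a, b, c] = ![a, b] := by
    funext i; fin_cases i <;> simp [Fin.contractNth]
  have hM : ((-1 : ℤ) ^ ((((0 : Fin 3) : ℕ)) + 1)) = -1 ∧ ((-1 : ℤ) ^ ((((1 : Fin 3) : ℕ)) + 1)) = 1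
      ∧ ((-1 : ℤ) ^ ((((2 : Fin 3) : ℕ)) + 1)) = -1 := by
    norm_num
  have h0 : A.ρ (![a, b, c] 0) (s' fun i => ![a, b, c] i.succ) = ρ a ((s' : (Fin 2 → G) → M) ![b, c]) := by
    have : (fun i : Fin 2 => ![a, b, c] i.succ) = ![b, c] := by
      funext i; fin_cases i <;> rfl
    rw [this]; rfl
  rw [e0, e1, e2, hM.1, hM.2.1, hM.2.2, h0] at this
  simp only [one_smul, neg_smul] at this
  rw [← this]
  change _ + (_ + _ + _) = _
  abel


theorem endMul {M : Type} [AddCommGroup M] (a b : AddMonoid.End M) (x : M) : (a * b) x = a (b x) := rfl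

/-- Coinduced module: equivariant functions. -/
def coQ {G M : Type} [Group G] [AddCommGroup M] {H : Subgroup G} (ρ : H →* AddMonoid.End M) :
    AddSubgroup (G → M) where
  carrier := {f | ∀ (c : H) (g : G), f (c * g) = ρ c (f g)}
  zero_mem' := by intro c g; simp
  add_mem' := by
    intro a b ha hb c g
    simp only [Pi.add_apply, map_add]
    rw [ha, hb]
  neg_mem' := by
    intro a ha c g
    simp only [Pi.neg_apply, map_neg]
    rw [ha]

/-- The translation action on the coinduced module. -/
def coAct {G M : Type} [Group G] [AddCommGroup M] {H : Subgroup G} (ρ : H →* AddMonoid.End M) :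
    G →* AddMonoid.End (coQ ρ) where
  toFun s :=
    { toFun := fun f => ⟨fun g => f.1 (g * s), fun c g => by
        show f.1 (c * g * s) = ρ c (f.1 (g * s))
        rw [mul_assoc]; exact f.2 c (g * s)⟩
      map_zero' := rfl
      map_add' := fun _ _ => rfl }
  map_one' := by
    ext f g
    show f.1 (g * 1) = f.1 g
    rw [mul_one]
  map_mul' a b := by
    ext f g
    show f.1 (g * (a * b)) = f.1 (g * a * b)
    rw [mul_assoc]

theorem coAct_apply {G M : Type} [Group G] [AddCommGroup M] {H : Subgroup G}
    (ρ : H →* AddMonoid.End M) (s : G) (f : coQ ρ) (g : G) : (coAct ρ s f).1 g = f.1 (g * s) := rfl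

theorem exists_equivariant {G : Type} [Group G] (H : Subgroup G) :
    ∃ r : G → H, r 1 = 1 ∧ ∀ (h : H) (g : G), r (h * g) = h * r g := by
  classical
  let q : G → Quotient (QuotientGroup.rightRel H) := fun g => Quotient.mk'' g
  have hq : ∀ (h : H) (g : G), q (h * g) = q g := by
    intro h g
    apply Quotient.sound'
    rw [QuotientGroup.rightRel_apply]
    simp
  have hm : ∀ g : G, g * (q g).out⁻¹ ∈ H := by
    intro g
    have : q ((q g).out) = q g := Quotient.out_eq' _
    have := Quotient.exact' this
    rwa [QuotientGroup.rightRel_apply] at this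
  let r0 : G → H := fun g => ⟨g * (q g).out⁻¹, hm g⟩
  have h0 : ∀ (h : H) (g : G), r0 (h * g) = h * r0 g := by
    intro h g
    apply Subtype.ext
    simp only [r0, hq, Subgroup.coe_mul, mul_assoc]
  refine ⟨fun g => r0 g * (r0 1)⁻¹, by simp, fun h g => by simp only [h0, mul_assoc]⟩

theorem shapiro2 {G M : Type} [Group G] [AddCommGroup M] {H : Subgroup G}
    (ρ : H →* AddMonoid.End M) (σ : H → H → M)
    (hσ : ∀ a b c, ρ a (σ b c) + σ a (b * c) = σ (a * b) c + σ a b) :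
    ∃ s : G → G → coQ ρ,
      (∀ a b c, coAct ρ a (s b c) + s a (b * c) = s (a * b) c + s a b) ∧
      ∀ c d : H, (s c d).1 1 = σ c d := by
  obtain ⟨r, r1, hr⟩ := exists_equivariant H
  refine ⟨fun a b => ⟨fun g => ρ (r g) (σ ((r g)⁻¹ * r (g * a)) ((r (g * a))⁻¹ * r (g * a * b))), ?_⟩,
    ?_, ?_⟩
  · intro c g
    simp only [mul_assoc, hr, map_mul, endMul, mul_inv_rev, inv_mul_cancel_left]
  · intro a b c
    apply Subtype.ext
    funext g
    simp only [AddSubgroup.coe_add, Pi.add_apply, coAct_apply]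
    have := congrArg (ρ (r g)) (hσ ((r g)⁻¹ * r (g * a)) ((r (g * a))⁻¹ * r (g * a * b))
      ((r (g * a * b))⁻¹ * r (g * a * b * c)))
    simp only [map_add, ← endMul, ← map_mul, mul_inv_cancel_left, mul_assoc]
      at this ⊢
    exact this
  · intro c d
    have h1 : r (c : G) = c := by simpa [r1] using hr c 1
    have h2 : r ((c : G) * d) = c * d := by
      have := hr (c * d) 1
      simpa [r1] using this
    simp [r1, h1, h2]

theorem shapiro3 {G M : Type} [Group G] [AddCommGroup M] {H : Subgroup G}
    (ρ : H →* AddMonoid.End M) (τ : H → H → H → M)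
    (hτ : ∀ a b c d, ρ a (τ b c d) + τ a (b * c) d + τ a b c = τ (a * b) c d + τ a b (c * d)) :
    ∃ s : G → G → G → coQ ρ,
      (∀ a b c d, coAct ρ a (s b c d) + s a (b * c) d + s a b c = s (a * b) c d + s a b (c * d)) ∧
      ∀ c d e : H, (s c d e).1 1 = τ c d e := by
  obtain ⟨r, r1, hr⟩ := exists_equivariant H
  refine ⟨fun a b c => ⟨fun g => ρ (r g) (τ ((r g)⁻¹ * r (g * a)) ((r (g * a))⁻¹ * r (g * a * b))
    ((r (g * a * b))⁻¹ * r (g * a * b * c))), ?_⟩, ?_, ?_⟩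
  · intro c g
    simp only [mul_assoc, hr, map_mul, endMul, mul_inv_rev, inv_mul_cancel_left]
  · intro a b c d
    apply Subtype.ext
    funext g
    simp only [AddSubgroup.coe_add, Pi.add_apply, coAct_apply]
    have := congrArg (ρ (r g)) (hτ ((r g)⁻¹ * r (g * a)) ((r (g * a))⁻¹ * r (g * a * b))
      ((r (g * a * b))⁻¹ * r (g * a * b * c)) ((r (g * a * b * c))⁻¹ * r (g * a * b * c * d)))
    simp only [map_add, ← endMul, ← map_mul, mul_inv_cancel_left, mul_assoc]
      at this ⊢
    exact this
  · intro c d e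
    have h1 : r (c : G) = c := by simpa [r1] using hr c 1
    have h2 : r ((c : G) * d) = c * d := by
      have := hr (c * d) 1
      simpa [r1] using this
    have h3 : r ((c : G) * d * e) = c * d * e := by
      have := hr (c * d * e) 1
      simpa [r1] using this
    have e : (c * d)⁻¹ * (c * d * e) = e := by group
    simp only [one_mul, r1, h1, h2, h3, inv_one, map_one, inv_mul_cancel_left, e]
    rfl

theorem van3_sub {G : Type} [Group G] (h : Van3 G) (H : Subgroup G) : Van3 H := by
  intro M _ ρ τ hτ
  obtain ⟨s, hs, hs1⟩ := shapiro3 ρ τ hτ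
  obtain ⟨θ, hθ⟩ := h _ (coAct ρ) s hs
  refine ⟨fun a b => (θ a b).1 1, fun a b c => ?_⟩
  rw [← hs1, hθ]
  have : (θ (b : G) c).1 (1 * (a : G)) = ρ a ((θ (b : G) c).1 1) := by
    rw [← (θ (b : G) c).2 a 1]; simp
  simp only [AddSubgroup.coe_add, AddSubgroup.coe_sub, Pi.add_apply, Pi.sub_apply, coAct_apply,
    this, Subgroup.coe_mul]

theorem van2_sub {G : Type} [Group G] (h : Van2 G) (H : Subgroup G) : Van2 H := by
  intro M _ ρ τ hτ
  obtain ⟨s, hs, hs1⟩ := shapiro2 ρ τ hτ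
  obtain ⟨θ, hθ⟩ := h _ (coAct ρ) s hs
  refine ⟨fun a => (θ a).1 1, fun a b => ?_⟩
  rw [← hs1, hθ]
  have : (θ (b : G)).1 (1 * (a : G)) = ρ a ((θ (b : G)).1 1) := by
    rw [← (θ (b : G)).2 a 1]; simp
  simp only [AddSubgroup.coe_add, AddSubgroup.coe_sub, Pi.add_apply, Pi.sub_apply, coAct_apply,
    this, Subgroup.coe_mul]

/-- Conjugation acts trivially on cohomology (degree two). -/
theorem inner2 {G M : Type} [Group G] [AddCommGroup M] (ρ : G →* AddMonoid.End M) (Y : G → G → M)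
    (hY : ∀ a b c, ρ a (Y b c) + Y a (b * c) = Y (a * b) c + Y a b) (g : G) :
    ∃ h : G → M, ∀ a b, ρ g (Y (g⁻¹ * a * g) (g⁻¹ * b * g)) =
      Y a b + (ρ a (h b) - h (a * b) + h a) := by
  refine ⟨fun a => Y g (g⁻¹ * a * g) - Y a g, fun a b => ?_⟩
  have h1 := hY g (g⁻¹ * a * g) (g⁻¹ * b * g)
  have h2 := hY a g (g⁻¹ * b * g)
  have h3 := hY a b g
  have e1 : g⁻¹ * a * g * (g⁻¹ * b * g) = g⁻¹ * (a * b) * g := by group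
  have e2 : g * (g⁻¹ * a * g) = a * g := by group
  have e3 : g * (g⁻¹ * b * g) = b * g := by group
  rw [e1, e2] at h1
  rw [e3] at h2
  simp only [map_sub]
  rw [← eq_sub_iff_add_eq] at h1
  rw [h1]
  have h2' : Y (a * g) (g⁻¹ * b * g) = ρ a (Y g (g⁻¹ * b * g)) + Y a (b * g) - Y a g := by
    rw [h2]; abel
  have h3' : Y a (b * g) = Y (a * b) g + Y a b - ρ a (Y b g) := by rw [← h3]; abel
  rw [h2', h3']
  abel


/-- The extension group of a 2-cocycle. -/
@[ext]
structure ExtG {C M : Type} [Group C] [AddCommGroup M] (_ρ : C →* AddMonoid.End M) (_y : C → C → M)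
    (_hy : ∀ a b c, _ρ a (_y b c) + _y a (b * c) = _y (a * b) c + _y a b) : Type where
  fst : M
  snd : C

theorem ext_one {C M : Type} [Group C] [AddCommGroup M] (ρ : C →* AddMonoid.End M) (y : C → C → M)
    (hy : ∀ a b c, ρ a (y b c) + y a (b * c) = y (a * b) c + y a b) (c : C) : y 1 c = y 1 1 := by
  have := hy 1 1 c
  rw [map_one, one_mul, one_mul] at this
  exact add_left_cancel this

instance ExtG.instGroup {C M : Type} [Group C] [AddCommGroup M] (ρ : C →* AddMonoid.End M)
    (y : C → C → M) (hy : ∀ a b c, ρ a (y b c) + y a (b * c) = y (a * b) c + y a b) :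
    Group (ExtG ρ y hy) :=
  letI : Mul (ExtG ρ y hy) := ⟨fun p q => ⟨p.fst + ρ p.snd q.fst + y p.snd q.snd, p.snd * q.snd⟩⟩
  letI : One (ExtG ρ y hy) := ⟨⟨-y 1 1, 1⟩⟩
  letI : Inv (ExtG ρ y hy) := ⟨fun p => ⟨-ρ p.snd⁻¹ p.fst - y p.snd⁻¹ p.snd - y 1 1, p.snd⁻¹⟩⟩
  Group.ofLeftAxioms
    (by
      rintro ⟨m, a⟩ ⟨m', b⟩ ⟨m'', c⟩
      apply ExtG.ext
      · show m + ρ a m' + y a b + ρ (a * b) m'' + y (a * b) c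
          = m + ρ a (m' + ρ b m'' + y b c) + y a (b * c)
        simp only [map_add, map_mul, endMul]
        have := hy a b c
        rw [← eq_sub_iff_add_eq] at this
        rw [this]; abel
      · exact mul_assoc a b c)
    (by
      rintro ⟨m, a⟩
      apply ExtG.ext
      · show -y 1 1 + ρ 1 m + y 1 a = m
        rw [ext_one ρ y hy a, map_one]
        show -y 1 1 + m + y 1 1 = m
        abel
      · exact one_mul a)
    (by
      rintro ⟨m, a⟩
      apply ExtG.ext
      · show -ρ a⁻¹ m - y a⁻¹ a - y 1 1 + ρ a⁻¹ m + y a⁻¹ a = -y 1 1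
        abel
      · exact inv_mul_cancel a)

/-- projection of the extension -/
def ExtG.proj {C M : Type} [Group C] [AddCommGroup M] (ρ : C →* AddMonoid.End M)
    (y : C → C → M) (hy : ∀ a b c, ρ a (y b c) + y a (b * c) = y (a * b) c + y a b) :
    ExtG ρ y hy →* C where
  toFun p := p.snd
  map_one' := rfl
  map_mul' _ _ := rfl

theorem fp_eventually {C M ι : Type} [Group C] [AddCommGroup M] (hC : IsFinitelyPresented C)
    (l : Filter ι) (ρ : ι → (C →* AddMonoid.End M)) (y : ι → C → C → M)
    (hy : ∀ j a b c, ρ j a (y j b c) + y j a (b * c) = y j (a * b) c + y j a b)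
    (h0 : ∀ c c', ∀ᶠ j in l, y j c c' = 0) :
    ∀ᶠ j in l, ∃ h : C → M, ∀ a b, y j a b = ρ j a (h b) - h (a * b) + h a := by
  obtain ⟨n, rels, ⟨e⟩⟩ := hC
  let p : FreeGroup (Fin n) →* C := e.symm.toMonoidHom.comp (PresentedGroup.mk _)
  let φ : ∀ j, FreeGroup (Fin n) →* ExtG (ρ j) (y j) (hy j) := fun j =>
    FreeGroup.lift (fun x => (⟨0, p (FreeGroup.of x)⟩ : ExtG (ρ j) (y j) (hy j)))
  have hsnd : ∀ j w, (φ j w).snd = p w := by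
    intro j w
    have : (ExtG.proj (ρ j) (y j) (hy j)).comp (φ j) = p := by
      apply FreeGroup.ext_hom
      intro x
      simp only [MonoidHom.comp_apply, φ, FreeGroup.lift_apply_of]
      rfl
    exact DFunLike.congr_fun this w
  have key : ∀ w, ∀ᶠ j in l, (φ j w).fst = 0 := by
    intro w
    induction w using FreeGroup.induction_on with
    | C1 =>
      filter_upwards [h0 1 1] with j hj
      rw [map_one]
      show -y j 1 1 = 0
      rw [hj, neg_zero]
    | of x =>
      filter_upwards with j
      simp only [φ, FreeGroup.lift_apply_of]
    | inv_of x ih =>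
      filter_upwards [ih, h0 (p (FreeGroup.of x))⁻¹ (p (FreeGroup.of x)), h0 1 1] with j h1 h2 h3
      have h4 := hsnd j (FreeGroup.of x)
      change (φ j (FreeGroup.of x)⁻¹).fst = 0
      rw [map_inv]
      show -ρ j (φ j (FreeGroup.of x)).snd⁻¹ (φ j (FreeGroup.of x)).fst
        - y j (φ j (FreeGroup.of x)).snd⁻¹ (φ j (FreeGroup.of x)).snd - y j 1 1 = 0
      rw [h4, h2, h3, h1, map_zero]; simp
    | mul a b iha ihb =>
      filter_upwards [iha, ihb, h0 (p a) (p b)] with j h1 h2 h3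
      rw [map_mul]
      show (φ j a).fst + ρ j (φ j a).snd (φ j b).fst + y j (φ j a).snd (φ j b).snd = 0
      rw [h1, h2, hsnd, hsnd, h3, map_zero]; simp
  have hrel : ∀ᶠ j in l, ∀ r ∈ rels, (φ j r).fst = 0 := by
    rw [Filter.eventually_all_finset]
    exact fun r _ => key r
  filter_upwards [hrel, h0 1 1] with j hj hj1
  have hr1 : ∀ r ∈ (rels : Set (FreeGroup (Fin n))), φ j r = 1 := by
    intro r hr
    apply ExtG.ext
    · rw [hj r hr]
      show 0 = -y j 1 1
      rw [hj1, neg_zero]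
    · rw [hsnd]
      show e.symm (PresentedGroup.mk _ r) = 1
      rw [PresentedGroup.one_of_mem hr, map_one]
  let s0 : PresentedGroup (rels : Set (FreeGroup (Fin n))) →* ExtG (ρ j) (y j) (hy j) :=
    PresentedGroup.toGroup (f := fun x => (⟨0, p (FreeGroup.of x)⟩ : ExtG (ρ j) (y j) (hy j))) hr1
  have hs0 : (ExtG.proj (ρ j) (y j) (hy j)).comp s0 = e.symm.toMonoidHom := by
    apply PresentedGroup.ext
    intro x
    simp only [MonoidHom.comp_apply, s0]
    rw [PresentedGroup.toGroup.of]
    rfl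
  have hs : ∀ c, (s0 (e c)).snd = c := by
    intro c
    have := DFunLike.congr_fun hs0 (e c)
    exact this.trans (e.symm_apply_apply c)
  refine ⟨fun c => -(s0 (e c)).fst, fun a b => ?_⟩
  have h1 : (s0 (e (a * b))).fst =
      (s0 (e a)).fst + ρ j (s0 (e a)).snd (s0 (e b)).fst + y j (s0 (e a)).snd (s0 (e b)).snd := by
    rw [map_mul, map_mul]; rfl
  rw [hs, hs] at h1
  beta_reduce
  rw [h1, map_neg]; abel


/-- restriction of an action to a stable subgroup -/
def resAct {D Q : Type} [Group D] [AddCommGroup Q] (A : D →* AddMonoid.End Q) (P : AddSubgroup Q)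
    (hP : ∀ s, ∀ f ∈ P, A s f ∈ P) : D →* AddMonoid.End P where
  toFun s :=
    { toFun := fun f => ⟨A s f.1, hP s f.1 f.2⟩
      map_zero' := Subtype.ext (map_zero (A s))
      map_add' := fun a b => Subtype.ext (map_add (A s) a.1 b.1) }
  map_one' := by
    ext f
    show A 1 f.1 = f.1
    rw [map_one]; rfl
  map_mul' a b := by
    ext f
    show A (a * b) f.1 = A a (A b f.1)
    rw [map_mul]; rfl

theorem resAct_coe {D Q : Type} [Group D] [AddCommGroup Q] (A : D →* AddMonoid.End Q)
    (P : AddSubgroup Q) (hP : ∀ s, ∀ f ∈ P, A s f ∈ P) (s : D) (f : P) :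
    ((resAct A P hP s f : P) : Q) = A s f := rfl

theorem van3_corr {D Q : Type} [Group D] [AddCommGroup Q] (hD : Van3 D)
    (A : D →* AddMonoid.End Q) (P : AddSubgroup Q)
    (hP : ∀ s, ∀ f ∈ P, A s f ∈ P) (Y : D → D → Q)
    (hY : ∀ a b c, A a (Y b c) - Y (a * b) c + Y a (b * c) - Y a b ∈ P) :
    ∃ Z : D → D → Q, (∀ a b, Y a b - Z a b ∈ P) ∧
      ∀ a b c, A a (Z b c) + Z a (b * c) = Z (a * b) c + Z a b := by
  obtain ⟨m, hm⟩ := hD P (resAct A P hP) (fun a b c => ⟨_, hY a b c⟩) (by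
    intro a b c d
    apply Subtype.ext
    simp only [AddSubgroup.coe_add, resAct_coe, map_sub, map_add, map_mul, endMul, mul_assoc]
    abel)
  refine ⟨fun a b => Y a b - m a b, fun a b => ?_, fun a b c => ?_⟩
  · simp
  · have := congrArg Subtype.val (hm a b c)
    simp only [AddSubgroup.coe_add, AddSubgroup.coe_sub, resAct_coe] at this
    simp only [map_sub]
    rw [← sub_eq_zero] at this ⊢
    rw [← this]; abel

theorem van2_corr {D Q : Type} [Group D] [AddCommGroup Q] (hD : Van2 D)
    (A : D →* AddMonoid.End Q) (P : AddSubgroup Q)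
    (hP : ∀ s, ∀ f ∈ P, A s f ∈ P) (Y : D → Q)
    (hY : ∀ a b, A a (Y b) - Y (a * b) + Y a ∈ P) :
    ∃ Z : D → Q, (∀ a, Y a - Z a ∈ P) ∧
      ∀ a b, A a (Z b) + Z a = Z (a * b) := by
  obtain ⟨m, hm⟩ := hD P (resAct A P hP) (fun a b => ⟨_, hY a b⟩) (by
    intro a b c
    apply Subtype.ext
    simp only [AddSubgroup.coe_add, resAct_coe, map_sub, map_add, map_mul, endMul, mul_assoc]
    abel)
  refine ⟨fun a => Y a - m a, fun a => ?_, fun a b => ?_⟩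
  · simp
  · have := congrArg Subtype.val (hm a b)
    simp only [AddSubgroup.coe_add, AddSubgroup.coe_sub, resAct_coe] at this
    simp only [map_sub]
    rw [← sub_eq_zero] at this ⊢
    rw [← this]; abel

theorem tail_cobound {D M : Type} [Group D] [AddCommGroup M] (C : Subgroup D) [C.Normal]
    (hC : IsFinitelyPresented C) (t : D) (ρ : C →* AddMonoid.End M) (Z : D → D → coQ ρ)
    (hZ : ∀ a b c, coAct ρ a (Z b c) + Z a (b * c) = Z (a * b) c + Z a b)
    (l : Filter ℤ) [l.NeBot] (hl : ∀ s s', ∀ᶠ j in l, (Z s s').1 (t ^ j) = 0) :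
    ∃ h : C → M, ∀ a b : C, (Z a b).1 1 = ρ a (h b) - h (a * b) + h a := by
  have hconj : ∀ (j : ℤ) (a : C), t ^ j * (a : D) = ((MulAut.conjNormal (t ^ j) a : C) : D) * t ^ j := by
    intro j a
    rw [MulAut.conjNormal_apply]; group
  have := fp_eventually hC l
    (fun j => ρ.comp (MulAut.conjNormal (t ^ j) : MulAut C).toMonoidHom)
    (fun j a b => (Z a b).1 (t ^ j)) (by
      intro j a b c
      have := congrArg (fun f => f.1 (t ^ j)) (hZ a b c)
      simp only [AddSubgroup.coe_add, Pi.add_apply, coAct_apply] at this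
      rw [hconj, (Z b c).2] at this
      exact this) (fun c c' => hl c c')
  obtain ⟨j, h, hh⟩ := this.exists
  obtain ⟨H, hH⟩ := inner2 (coAct ρ) Z hZ (t ^ j)
  let k : C → C := fun a => MulAut.conjNormal ((t ^ j)⁻¹) a
  have hk : ∀ a : C, ((k a : C) : D) = (t ^ j)⁻¹ * a * t ^ j := by
    intro a; simp only [k, MulAut.conjNormal_apply]; group
  have hkm : ∀ a b : C, k a * k b = k (a * b) := fun a b => (map_mul _ a b).symm
  have hkk : ∀ a : C, MulAut.conjNormal (t ^ j) (k a) = a := by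
    intro a
    simp only [k, map_inv, MulAut.apply_inv_self]
  refine ⟨fun a => h (k a) - (H a).1 1, fun a b => ?_⟩
  have h1 := congrArg (fun f => f.1 1) (hH a b)
  simp only [AddSubgroup.coe_add, AddSubgroup.coe_sub, Pi.add_apply, Pi.sub_apply, coAct_apply, one_mul] at h1
  have h2 : (H (b : D)).1 (a : D) = ρ a ((H (b : D)).1 1) := by
    rw [← (H (b : D)).2 a 1]; simp
  rw [← hk, ← hk, hh, h2, hkm] at h1
  have h3 : (ρ.comp (MulAut.conjNormal (t ^ j) : MulAut C).toMonoidHom) (k a) = ρ a := by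
    show ρ (MulAut.conjNormal (t ^ j) (k a)) = ρ a
    rw [hkk]
  rw [h3, ← sub_eq_iff_eq_add] at h1
  rw [← h1, map_sub]
  simp only [Subgroup.coe_mul]
  abel

theorem van2_ker {D : Type} [Group D] (π : D →* Multiplicative ℤ) (t : D)
    (ht : π t = Multiplicative.ofAdd 1) (hC : IsFinitelyPresented π.ker) (hD : Van3 D) :
    Van2 π.ker := by
  classical
  intro M _ ρ σ hσ
  obtain ⟨S, hS, hS1⟩ := shapiro2 (G := D) ρ σ hσ
  let p : D → ℤ := fun g => (π g).toAdd
  have pm : ∀ a b, p (a * b) = p a + p b := fun a b => by simp [p]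
  have pc : ∀ c : π.ker, p c = 0 := fun c => by
    have : π c = 1 := c.2
    simp [p, this]
  have pt : ∀ j : ℤ, p (t ^ j) = j := fun j => by simp [p, ht]
  let P : AddSubgroup (coQ ρ) :=
    { carrier := {f | ∃ N : ℤ, ∀ g, N < |p g| → f.1 g = 0}
      zero_mem' := ⟨0, fun g _ => rfl⟩
      add_mem' := by
        rintro a b ⟨N, hN⟩ ⟨N', hN'⟩
        refine ⟨max N N', fun g hg => ?_⟩
        show a.1 g + b.1 g = 0
        rw [hN g (lt_of_le_of_lt (le_max_left _ _) hg), hN' g (lt_of_le_of_lt (le_max_right _ _) hg),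
          add_zero]
      neg_mem' := by
        rintro a ⟨N, hN⟩
        refine ⟨N, fun g hg => ?_⟩
        show -a.1 g = 0
        rw [hN g hg, neg_zero] }
  have hP : ∀ s, ∀ f ∈ P, coAct ρ s f ∈ P := by
    rintro s f ⟨N, hN⟩
    refine ⟨N + |p s|, fun g hg => ?_⟩
    rw [coAct_apply]
    apply hN
    rw [pm]
    have := abs_sub_abs_le_abs_sub (p g) (-p s)
    rw [abs_neg, sub_neg_eq_add] at this
    linarith
  let Y : D → D → coQ ρ := fun a b => ⟨fun g => if 0 ≤ p g then (S a b).1 g else 0, by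
    intro c g
    simp only [pm, pc, zero_add]
    split_ifs
    · exact (S a b).2 c g
    · simp⟩
  have Yv : ∀ a b g, (Y a b).1 g = if 0 ≤ p g then (S a b).1 g else 0 := fun _ _ _ => rfl
  obtain ⟨Z, hZP, hZ⟩ := van3_corr hD (coAct ρ) P hP Y (by
    intro a b c
    refine ⟨|p a|, fun g hg => ?_⟩
    simp only [AddSubgroup.coe_add, AddSubgroup.coe_sub, Pi.add_apply, Pi.sub_apply, coAct_apply, Yv]
    have h1 := congrArg (fun f => f.1 g) (hS a b c)
    simp only [AddSubgroup.coe_add, Pi.add_apply, coAct_apply] at h1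
    have h2 : 0 ≤ p (g * a) ↔ 0 ≤ p g := by
      rw [pm]
      constructor
      · intro h; by_contra h'
        push Not at h'
        rw [abs_of_neg h'] at hg
        have := le_abs_self (p a)
        linarith
      · intro h
        rw [abs_of_nonneg h] at hg
        have := neg_abs_le (p a)
        linarith
    simp only [h2]
    split_ifs
    · rw [← sub_eq_zero] at h1
      rw [← h1]; abel
    · simp)
  have hZS : ∀ a b c, coAct ρ a (Z b c - S b c) + (Z a (b * c) - S a (b * c))
      = (Z (a * b) c - S (a * b) c) + (Z a b - S a b) := by
    intro a b c
    have h1 := hZ a b c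
    have h2 := hS a b c
    rw [← sub_eq_zero] at h1 h2 ⊢
    rw [map_sub]
    calc _ = (coAct ρ a (Z b c) + Z a (b * c) - (Z (a * b) c + Z a b)) -
        (coAct ρ a (S b c) + S a (b * c) - (S (a * b) c + S a b)) := by abel
      _ = 0 := by rw [h1, h2, sub_zero]
  obtain ⟨h1, hh1⟩ := tail_cobound π.ker hC t ρ Z hZ Filter.atBot (by
    intro a b
    obtain ⟨N, hN⟩ := hZP a b
    filter_upwards [Filter.eventually_lt_atBot (-|N|)] with j hj
    have := hN (t ^ j) (by
      rw [pt, abs_of_neg (by linarith [abs_nonneg N])]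
      linarith [le_abs_self N])
    simp only [AddSubgroup.coe_sub, Pi.sub_apply, Yv, pt] at this
    rw [if_neg (by linarith [abs_nonneg N])] at this
    simpa using this)
  obtain ⟨h2, hh2⟩ := tail_cobound π.ker hC t ρ (fun a b => Z a b - S a b) hZS Filter.atTop (by
    intro a b
    obtain ⟨N, hN⟩ := hZP a b
    filter_upwards [Filter.eventually_gt_atTop (|N|)] with j hj
    have := hN (t ^ j) (by
      rw [pt, abs_of_pos (by linarith [abs_nonneg N])]
      linarith [le_abs_self N])
    simp only [AddSubgroup.coe_sub, Pi.sub_apply, Yv, pt] at this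
    rw [if_pos (by linarith [abs_nonneg N])] at this
    simp only [AddSubgroup.coe_sub, Pi.sub_apply]
    rw [← neg_sub, this, neg_zero])
  refine ⟨fun a => h1 a - h2 a, fun a b => ?_⟩
  have e1 := hh1 a b
  have e2 := hh2 a b
  simp only [AddSubgroup.coe_sub, Pi.sub_apply] at e2
  rw [← hS1]
  have e3 : (S (a : D) b).1 1 = (Z (a : D) b).1 1 - ((Z (a : D) b).1 1 - (S (a : D) b).1 1) := by abel
  rw [e3, e2, e1]
  simp only [map_sub]
  abel


/-- shift action of `D` on integer sequences -/
def shiftAct {D : Type} [Group D] (π : D →* Multiplicative ℤ) : D →* AddMonoid.End (ℤ → ℤ) where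
  toFun s :=
    { toFun := fun f j => f (j + (π s).toAdd)
      map_zero' := rfl
      map_add' := fun _ _ => rfl }
  map_one' := by
    ext f j
    show f (j + (π 1).toAdd) = f j
    simp
  map_mul' a b := by
    ext f j
    show f (j + (π (a * b)).toAdd) = f (j + (π a).toAdd + (π b).toAdd)
    simp [add_assoc]

theorem shiftAct_apply {D : Type} [Group D] (π : D →* Multiplicative ℤ) (s : D) (f : ℤ → ℤ) (j : ℤ) :
    shiftAct π s f j = f (j + (π s).toAdd) := rfl

theorem h1_ker {D : Type} [Group D] (π : D →* Multiplicative ℤ) (t : D)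
    (ht : π t = Multiplicative.ofAdd 1) (hC : Group.FG π.ker) (hD : Van2 D)
    (σ : π.ker →* Multiplicative ℤ) : σ = 1 := by
  classical
  let p : D → ℤ := fun g => (π g).toAdd
  have pm : ∀ a b, p (a * b) = p a + p b := fun a b => by simp [p]
  have pc : ∀ c : π.ker, p c = 0 := fun c => by
    have : π c = 1 := c.2
    simp [p, this]
  have pt : ∀ j : ℤ, p (t ^ j) = j := fun j => by simp [p, ht]
  have pmem : ∀ g, p g = 0 → g ∈ π.ker := by
    intro g hg
    rw [MonoidHom.mem_ker]
    exact Multiplicative.toAdd.injective hg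
  have sa : ∀ s f j, shiftAct π s f j = f (j + p s) := fun _ _ _ => rfl
  let w : D → ℤ → π.ker := fun s j => ⟨t ^ j * s * t ^ (-(j + p s)), pmem _ (by
    rw [pm, pm, pt, pt]; ring)⟩
  have wm : ∀ a b j, w (a * b) j = w a j * w b (j + p a) := by
    intro a b j
    apply Subtype.ext
    simp only [w, Subgroup.coe_mul, pm]
    group
  let S : D → ℤ → ℤ := fun s j => (σ (w s j)).toAdd
  have Sm : ∀ a b j, S (a * b) j = S a j + S b (j + p a) := by
    intro a b j; simp only [S, wm, map_mul, toAdd_mul]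
  let P : AddSubgroup (ℤ → ℤ) :=
    { carrier := {f | ∃ N : ℤ, ∀ g, N < |g| → f g = 0}
      zero_mem' := ⟨0, fun g _ => rfl⟩
      add_mem' := by
        rintro a b ⟨N, hN⟩ ⟨N', hN'⟩
        refine ⟨max N N', fun g hg => ?_⟩
        show a g + b g = 0
        rw [hN g (lt_of_le_of_lt (le_max_left _ _) hg), hN' g (lt_of_le_of_lt (le_max_right _ _) hg),
          add_zero]
      neg_mem' := by
        rintro a ⟨N, hN⟩
        refine ⟨N, fun g hg => ?_⟩
        show -a g = 0
        rw [hN g hg, neg_zero] }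
  let Y : D → ℤ → ℤ := fun s j => if 0 ≤ j then S s j else 0
  obtain ⟨Z, hZP, hZ⟩ := van2_corr hD (shiftAct π) P (by
      rintro s f ⟨N, hN⟩
      refine ⟨N + |p s|, fun g hg => ?_⟩
      rw [sa]
      apply hN
      have := abs_sub_abs_le_abs_sub g (-p s)
      rw [abs_neg, sub_neg_eq_add] at this
      linarith) Y (by
    intro a b
    refine ⟨|p a|, fun g hg => ?_⟩
    simp only [Pi.add_apply, Pi.sub_apply, sa, Y]
    have h2 : 0 ≤ g + p a ↔ 0 ≤ g := by
      constructor
      · intro h; by_contra h'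
        push Not at h'
        rw [abs_of_neg h'] at hg
        have := le_abs_self (p a)
        linarith
      · intro h
        rw [abs_of_nonneg h] at hg
        have := neg_abs_le (p a)
        linarith
    simp only [h2, Sm]
    split_ifs <;> ring)
  have hZ' : ∀ a b j, Z (a * b) j = Z b (j + p a) + Z a j := by
    intro a b j
    rw [← hZ]; rfl
  have hlow : ∀ a, ∀ᶠ j in Filter.atBot, Z a j = 0 := by
    intro a
    obtain ⟨N, hN⟩ := hZP a
    filter_upwards [Filter.eventually_lt_atBot (-|N|)] with j hj
    have := hN j (by
      rw [abs_of_neg (by linarith [abs_nonneg N])]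
      linarith [le_abs_self N])
    simp only [Pi.sub_apply, Y] at this
    rw [if_neg (by linarith [abs_nonneg N])] at this
    simpa using this
  have hhigh : ∀ a, ∀ᶠ j in Filter.atTop, Z a j = S a j := by
    intro a
    obtain ⟨N, hN⟩ := hZP a
    filter_upwards [Filter.eventually_gt_atTop (|N|)] with j hj
    have := hN j (by
      rw [abs_of_pos (by linarith [abs_nonneg N])]
      linarith [le_abs_self N])
    simp only [Pi.sub_apply, Y] at this
    rw [if_pos (by linarith [abs_nonneg N])] at this
    linarith
  have Z1 : ∀ j, Z 1 j = 0 := by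
    intro j
    have := hZ' 1 1 j
    have p1 : p 1 = 0 := pc 1
    rw [one_mul, p1, add_zero] at this
    linarith
  obtain ⟨T, hT⟩ := Group.fg_def.1 hC
  have gen : ∀ (F : π.ker →* Multiplicative ℤ), (∀ x ∈ T, F x = 1) → F = 1 := by
    intro F hF
    apply MonoidHom.eq_of_eqOn_dense hT
    intro x hx
    exact hF x hx
  have zh : ∀ j, ∃ F : π.ker →* Multiplicative ℤ, ∀ c, (F c).toAdd = Z c j := by
    intro j
    refine ⟨{ toFun := fun c => Multiplicative.ofAdd (Z c j), map_one' := ?_, map_mul' := ?_ }, ?_⟩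
    · show Multiplicative.ofAdd (Z 1 j) = 1
      rw [Z1]; rfl
    · intro a b
      show Multiplicative.ofAdd (Z (a * b) j) = _
      rw [hZ', pc, add_zero, add_comm, ofAdd_add]
    · intro c; rfl
  have conjm : ∀ (c : π.ker) (j : ℤ), t ^ j * c * t ^ (-j) ∈ π.ker := by
    intro c j
    apply pmem
    rw [pm, pm, pt, pt, pc]; ring
  have step : ∀ (c : π.ker) j, Z c (j + 1) = Z (t ^ (1 : ℤ) * c * t ^ (-(1 : ℤ))) j := by
    intro c j
    have h1 := hZ' (t ^ (1 : ℤ) * c) (t ^ (-(1 : ℤ))) j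
    have h2 := hZ' (t ^ (1 : ℤ)) c j
    have h3 := hZ' (t ^ (1 : ℤ)) (t ^ (-(1 : ℤ))) j
    rw [← zpow_add, add_neg_cancel, zpow_zero, Z1, pt] at h3
    rw [pm, pt, pc, add_zero] at h1
    rw [pt] at h2
    linarith
  have start : ∃ j0, ∀ j ≤ j0, ∀ c : π.ker, Z c j = 0 := by
    have : ∀ᶠ j in Filter.atBot, ∀ x ∈ T, Z (x : D) j = 0 := by
      rw [Filter.eventually_all_finset]
      exact fun x _ => hlow x
    obtain ⟨j0, hj0⟩ := Filter.eventually_atBot.1 this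
    refine ⟨j0, fun j hj c => ?_⟩
    obtain ⟨F, hF⟩ := zh j
    have := gen F (fun x hx => by
      apply Multiplicative.toAdd.injective
      rw [hF, hj0 j hj x hx]; rfl)
    rw [← hF, this]; rfl
  obtain ⟨j0, hj0⟩ := start
  have allz : ∀ n : ℕ, ∀ c : π.ker, Z c (j0 + n) = 0 := by
    intro n
    induction n with
    | zero => intro c; simpa using hj0 j0 le_rfl c
    | succ n ih =>
      intro c
      push_cast
      rw [← add_assoc, step]
      exact ih ⟨_, conjm c 1⟩
  have allz' : ∀ j, ∀ c : π.ker, Z c j = 0 := by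
    intro j c
    rcases le_total j j0 with h | h
    · exact hj0 j h c
    · obtain ⟨n, rfl⟩ := Int.le.dest h
      exact allz n c
  have : ∀ᶠ j in Filter.atTop, ∀ x ∈ T, S (x : D) j = 0 := by
    rw [Filter.eventually_all_finset]
    intro x _
    filter_upwards [hhigh x] with j hj
    rw [← hj, allz']
  obtain ⟨j, hj⟩ := this.exists
  have hF := gen (σ.comp (MulAut.conjNormal (t ^ j) : MulAut π.ker).toMonoidHom) (by
    intro x hx
    apply Multiplicative.toAdd.injective
    have := hj x hx
    rw [← show S (x : D) j = (1 : Multiplicative ℤ).toAdd from this]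
    show (σ _).toAdd = (σ _).toAdd
    congr 2
    apply Subtype.ext
    show t ^ j * x * (t ^ j)⁻¹ = t ^ j * x * t ^ (-(j + p x))
    rw [pc, add_zero, zpow_neg])
  ext c
  have := DFunLike.congr_fun hF ((MulAut.conjNormal (t ^ j) : MulAut π.ker).symm c)
  simpa using this


theorem Van2.equiv {G H : Type} [Group G] [Group H] (e : G ≃* H) (h : Van2 G) : Van2 H := by
  intro M _ ρ σ hσ
  obtain ⟨k, hk⟩ := h M (ρ.comp e.toMonoidHom) (fun a b => σ (e a) (e b)) (by
    intro a b c
    have := hσ (e a) (e b) (e c)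
    rw [← map_mul, ← map_mul] at this
    exact this)
  refine ⟨fun a => k (e.symm a), fun a b => ?_⟩
  have := hk (e.symm a) (e.symm b)
  rw [← map_mul] at this
  simpa using this

theorem IsFinitelyPresented.equiv {G H : Type} [Group G] [Group H] (e : G ≃* H)
    (h : IsFinitelyPresented G) : IsFinitelyPresented H := by
  obtain ⟨n, r, ⟨f⟩⟩ := h
  exact ⟨n, r, ⟨e.symm.trans f⟩⟩

theorem normalises_zpow {G : Type} [Group G] {C : Subgroup G} {t : G}
    (hn : ∀ c, c ∈ C ↔ t * c * t⁻¹ ∈ C) (n : ℤ) (c : G) : c ∈ C ↔ t ^ n * c * (t ^ n)⁻¹ ∈ C := by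
  induction n using Int.induction_on generalizing c with
  | zero => simp
  | succ n ih =>
    rw [ih c, hn]
    have : t * (t ^ (n : ℤ) * c * (t ^ (n : ℤ))⁻¹) * t⁻¹
      = t ^ ((n : ℤ) + 1) * c * (t ^ ((n : ℤ) + 1))⁻¹ := by group
    rw [this]
  | pred n ih =>
    rw [ih c, hn (t ^ (-(n : ℤ) - 1) * c * (t ^ (-(n : ℤ) - 1))⁻¹)]
    have : t * (t ^ (-(n : ℤ) - 1) * c * (t ^ (-(n : ℤ) - 1))⁻¹) * t⁻¹
      = t ^ (-(n : ℤ)) * c * (t ^ (-(n : ℤ)))⁻¹ := by group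
    rw [this]

theorem exists_pi {G : Type} [Group G] (C : Subgroup G) (t : G)
    (hn : ∀ c, c ∈ C ↔ t * c * t⁻¹ ∈ C) (ht : ∀ n : ℤ, n ≠ 0 → t ^ n ∉ C) :
    ∃ (D : Subgroup G) (π : D →* Multiplicative ℤ) (t' : D), C ≤ D ∧ (t' : G) = t ∧
      π t' = Multiplicative.ofAdd 1 ∧ (∀ g : D, π g = 1 ↔ (g : G) ∈ C) ∧
      (∀ E : Subgroup G, C ≤ E → t ∈ E → D ≤ E) ∧ ∀ g ∈ D, ∃ c ∈ C, ∃ n : ℤ, g = c * t ^ n := by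
  classical
  have hu : ∀ (c c' : G) (n m : ℤ), c ∈ C → c' ∈ C → c * t ^ n = c' * t ^ m → n = m := by
    intro c c' n m hc hc' h
    by_contra hnm
    apply ht (n - m) (sub_ne_zero.2 hnm)
    have : t ^ (n - m) = c⁻¹ * c' := by
      rw [zpow_sub, eq_inv_mul_iff_mul_eq, ← mul_assoc, h]; group
    rw [this]
    exact C.mul_mem (C.inv_mem hc) hc'
  have hmul : ∀ (c c' : G) (n m : ℤ), c * t ^ n * (c' * t ^ m)
      = c * (t ^ n * c' * (t ^ n)⁻¹) * t ^ (n + m) := by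
    intro c c' n m; group
  let D : Subgroup G :=
    { carrier := {g | ∃ c ∈ C, ∃ n : ℤ, g = c * t ^ n}
      one_mem' := ⟨1, C.one_mem, 0, by simp⟩
      mul_mem' := by
        rintro _ _ ⟨c, hc, n, rfl⟩ ⟨c', hc', m, rfl⟩
        exact ⟨_, C.mul_mem hc ((normalises_zpow hn n c').1 hc'), n + m, hmul c c' n m⟩
      inv_mem' := by
        rintro _ ⟨c, hc, n, rfl⟩
        refine ⟨_, (normalises_zpow hn (-n) c⁻¹).1 (C.inv_mem hc), -n, by group⟩ }
  have hD : ∀ g : D, ∃ c ∈ C, ∃ n : ℤ, (g : G) = c * t ^ n := fun g => g.2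
  choose c hc n hgn using hD
  let π : D →* Multiplicative ℤ := MonoidHom.mk' (fun g => Multiplicative.ofAdd (n g)) (by
    intro a b
    rw [← ofAdd_add]
    congr 1
    apply hu (c (a * b)) (c a * (t ^ n a * c b * (t ^ n a)⁻¹)) _ _ (hc _)
      (C.mul_mem (hc a) ((normalises_zpow hn _ _).1 (hc b)))
    rw [← hgn, ← hmul, ← hgn, ← hgn]; rfl)
  have ht' : t ∈ D := ⟨1, C.one_mem, 1, by simp⟩
  refine ⟨D, π, ⟨t, ht'⟩, fun x hx => ⟨x, hx, 0, by simp⟩, rfl, ?_, ?_, ?_, fun g hg => hg⟩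
  · show Multiplicative.ofAdd (n ⟨t, ht'⟩) = _
    congr 1
    apply hu _ 1 _ _ (hc ⟨t, ht'⟩) C.one_mem
    rw [← hgn]; simp
  · intro g
    show Multiplicative.ofAdd (n g) = 1 ↔ _
    rw [ofAdd_eq_one]
    constructor
    · intro h
      rw [hgn g, h]; simpa using hc g
    · intro h
      apply hu _ g _ _ (hc g) h
      rw [← hgn]; simp
  · rintro E hE htE _ ⟨c, hc, n, rfl⟩
    exact E.mul_mem (hE hc) (E.zpow_mem htE n)

/-- the kernel is the given subgroup -/
def kerEquiv {G : Type} [Group G] {C D : Subgroup G} (hCD : C ≤ D) (π : D →* Multiplicative ℤ)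
    (h : ∀ g : D, π g = 1 ↔ (g : G) ∈ C) : π.ker ≃* C where
  toFun x := ⟨x.1.1, (h x.1).1 x.2⟩
  invFun x := ⟨⟨x.1, hCD x.2⟩, (h _).2 x.2⟩
  left_inv _ := rfl
  right_inv _ := rfl
  map_mul' _ _ := rfl

/-- a weak form of one-dimensionality -/
def Cd1 {K : Type} [Group K] (C : Subgroup K) : Prop :=
  ∀ y ∈ C, ∀ B ≤ C, B.FG → (∀ c, c ∈ B ↔ y * c * y⁻¹ ∈ B) → (∀ n : ℤ, n ≠ 0 → y ^ n ∉ B) → B = ⊥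

theorem cd1_of {K : Type} [Group K] (hK : IsCoherent K) (hL : LocallyIndicable K) (h3 : Van3 K)
    (C : Subgroup K) (hC : C.FG) (t : K)
    (hn : ∀ c, c ∈ C ↔ t * c * t⁻¹ ∈ C) (ht : ∀ n : ℤ, n ≠ 0 → t ^ n ∉ C) : Cd1 C := by
  have hV : Van2 C := by
    obtain ⟨D, π, t', hCD, -, htt, hker, -, -⟩ := exists_pi C t hn ht
    have e := kerEquiv hCD π hker
    exact Van2.equiv e (van2_ker π t' htt ((hK C hC).equiv e.symm) (van3_sub h3 D))
  intro y hy B hB hBf hyn hyB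
  by_contra hne
  obtain ⟨f, hf⟩ := hL B hBf hne
  obtain ⟨D, π, t', hCD, -, htt, hker, hDE, -⟩ := exists_pi B y hyn hyB
  have e := kerEquiv hCD π hker
  have hDC : D ≤ C := hDE C hB hy
  have hVD : Van2 D := Van2.equiv (Subgroup.subgroupOfEquivOfLe hDC) (van2_sub hV (D.subgroupOf C))
  have hfg : Group.FG π.ker := by
    have : Group.FG B := (Group.fg_iff_subgroup_fg B).2 hBf
    exact Group.fg_of_surjective (f := e.symm.toMonoidHom) e.symm.surjective
  have h1 := h1_ker π t' htt hfg hVD (f.comp e.toMonoidHom)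
  obtain ⟨b, hb⟩ := hf (Multiplicative.ofAdd 1)
  have := DFunLike.congr_fun h1 (e.symm b)
  simp only [MonoidHom.comp_apply, MulEquiv.toMonoidHom_eq_coe, MonoidHom.coe_coe, MulEquiv.apply_symm_apply, hb] at this
  rw [MonoidHom.one_apply] at this
  exact absurd this (by decide)


/-- product of a binary word -/
def bprod {G : Type} [Group G] (u v : G) (l : List Bool) : G := (l.map (fun b => cond b u v)).prod

/-- `u, v` freely generate a free semigroup -/
def FreeSemi {G : Type} [Group G] (u v : G) : Prop := Function.Injective (bprod u v)

theorem bprod_nil {G : Type} [Group G] (u v : G) : bprod u v [] = 1 := rfl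

theorem bprod_cons {G : Type} [Group G] (u v : G) (b : Bool) (l : List Bool) :
    bprod u v (b :: l) = cond b u v * bprod u v l := by simp [bprod]

theorem bprod_append {G : Type} [Group G] (u v : G) (l l' : List Bool) :
    bprod u v (l ++ l') = bprod u v l * bprod u v l' := by simp [bprod]

/-- conjugates -/
def cj {G : Type} [Group G] (t x : G) (i : ℕ) : G := t ^ i * x * (t ^ i)⁻¹

theorem cj_zero {G : Type} [Group G] (t x : G) : cj t x 0 = x := by simp [cj]

theorem cj_succ {G : Type} [Group G] (t x : G) (i : ℕ) : cj t x (i + 1) = t * cj t x i * t⁻¹ := by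
  simp only [cj]; group

theorem bprod_factor {G : Type} [Group G] (t x : G) (l : List Bool) :
    bprod (x * t) t l * (t ^ l.length)⁻¹ ∈ Subgroup.closure (cj t x '' Set.Iio l.length) := by
  induction l using List.reverseRecOn with
  | nil => simp [bprod_nil]
  | append_singleton l b ih =>
    have hle : Subgroup.closure (cj t x '' Set.Iio l.length) ≤
        Subgroup.closure (cj t x '' Set.Iio (l ++ [b]).length) := by
      apply Subgroup.closure_mono
      apply Set.image_mono
      apply Set.Iio_subset_Iio
      simp
    have e : bprod (x * t) t (l ++ [b]) * (t ^ (l ++ [b]).length)⁻¹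
      = (bprod (x * t) t l * (t ^ l.length)⁻¹) * cj t (cond b x 1) l.length := by
      rw [bprod_append, bprod_cons, bprod_nil, List.length_append, List.length_singleton]
      simp only [cj]
      cases b <;> simp only [cond_true, cond_false] <;> group
    rw [e]
    refine Subgroup.mul_mem _ (hle ih) ?_
    cases b
    · simp [cj]
    · exact Subgroup.subset_closure ⟨l.length, by simp, rfl⟩

theorem conj_closure {G : Type} [Group G] (t : G) (X : Set G) (B : Subgroup G)
    (h : ∀ x ∈ X, t * x * t⁻¹ ∈ B) (c : G) (hc : c ∈ Subgroup.closure X) : t * c * t⁻¹ ∈ B := by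
  have : Subgroup.closure X ≤ B.comap (MulAut.conj t).toMonoidHom := by
    rw [Subgroup.closure_le]
    intro x hx
    exact h x hx
  exact this hc

theorem milnor {G : Type} [Group G] (N : Subgroup G) (t x : G)
    (hn : ∀ c, c ∈ N ↔ t * c * t⁻¹ ∈ N) (ht : ∀ n : ℤ, n ≠ 0 → t ^ n ∉ N) (hx : x ∈ N)
    (hf : ¬ FreeSemi (x * t) t) :
    ∃ B ≤ N, B.FG ∧ x ∈ B ∧ (∀ c, c ∈ B ↔ t * c * t⁻¹ ∈ B) ∧
      ∃ m : ℕ, B = Subgroup.closure (cj t x '' Set.Iio m) := by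
  classical
  have hcN : ∀ i, cj t x i ∈ N := by
    intro i
    induction i with
    | zero => rwa [cj_zero]
    | succ i ih => rw [cj_succ]; exact (hn _).1 ih
  have hBN : ∀ m, Subgroup.closure (cj t x '' Set.Iio m) ≤ N := by
    intro m
    rw [Subgroup.closure_le]
    rintro _ ⟨i, -, rfl⟩
    exact hcN i
  have hlen : ∀ l l' : List Bool, bprod (x * t) t l = bprod (x * t) t l' → l.length = l'.length := by
    intro l l' h
    by_contra hne
    apply ht ((l'.length : ℤ) - l.length) (by omega)
    have h1 := hBN _ (bprod_factor t x l)
    have h2 := hBN _ (bprod_factor t x l')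
    have : t ^ ((l'.length : ℤ) - l.length) = (bprod (x * t) t l' * (t ^ l'.length)⁻¹)⁻¹ *
        (bprod (x * t) t l * (t ^ l.length)⁻¹) := by
      rw [h, zpow_sub, zpow_natCast, zpow_natCast]; group
    rw [this]
    exact N.mul_mem (N.inv_mem h2) h1
  have hex : ∃ n, ∃ l l' : List Bool, l.length = n ∧ l'.length = n ∧ l ≠ l' ∧
      bprod (x * t) t l = bprod (x * t) t l' := by
    simp only [FreeSemi, Function.Injective] at hf
    push Not at hf
    obtain ⟨l, l', h1, h2⟩ := hf
    exact ⟨l.length, l, l', rfl, (hlen _ _ h1).symm, h2, h1⟩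
  obtain ⟨l, l', hl, hl', hne, heq⟩ := Nat.find_spec hex
  have hmin := fun m hm => Nat.find_min hex (m := m) hm
  generalize Nat.find hex = n at *
  have hn0 : n ≠ 0 := by
    rintro rfl
    rw [List.length_eq_zero_iff] at hl hl'
    exact hne (hl.trans hl'.symm)
  obtain ⟨k, rfl⟩ := Nat.exists_eq_succ_of_ne_zero hn0
  -- first letters
  have hX : ∀ l1 l2 : List Bool, l1.length = k → l2.length = k →
      bprod (x * t) t l2 * (bprod (x * t) t l1)⁻¹ ∈ Subgroup.closure (cj t x '' Set.Iio k) := by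
    intro l1 l2 h1 h2
    have e1 := bprod_factor t x l1
    have e2 := bprod_factor t x l2
    rw [h1] at e1
    rw [h2] at e2
    have := Subgroup.mul_mem _ e2 (Subgroup.inv_mem _ e1)
    convert this using 1
    group
  have h0 : ∃ b ∈ Subgroup.closure (cj t x '' Set.Iio k), x = t * b * t⁻¹ := by
    match l, l', hl, hl' with
    | a :: l1, a' :: l2, hl, hl' =>
      simp only [List.length_cons, Nat.succ_eq_add_one, add_left_inj] at hl hl'
      rw [bprod_cons, bprod_cons] at heq
      have haa : a ≠ a' := by
        rintro rfl
        exact hmin k (Nat.lt_succ_self k) ⟨l1, l2, hl, hl', fun h => hne (by rw [h]),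
          mul_left_cancel heq⟩
      have aux : ∀ l1 l2 : List Bool, l1.length = k → l2.length = k →
          x * t * bprod (x * t) t l1 = t * bprod (x * t) t l2 →
          ∃ b ∈ Subgroup.closure (cj t x '' Set.Iio k), x = t * b * t⁻¹ := by
        intro l1 l2 h1 h2 h
        refine ⟨_, hX l1 l2 h1 h2, ?_⟩
        rw [← mul_assoc, ← h]; group
      cases a <;> cases a'
      · exact absurd rfl haa
      · exact aux l2 l1 hl' hl heq.symm
      · exact aux l1 l2 hl hl' heq
      · exact absurd rfl haa
  have h1 : cj t x k ∈ Subgroup.closure (cj t x '' Set.Iio k) := by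
    obtain rfl | ⟨l1, a, rfl⟩ := List.eq_nil_or_concat' l
    · simp at hl
    obtain rfl | ⟨l2, a', rfl⟩ := List.eq_nil_or_concat' l'
    · simp at hl'
    simp only [List.length_append, List.length_singleton, Nat.succ_eq_add_one, add_left_inj] at hl hl'
    rw [bprod_append, bprod_append, bprod_cons, bprod_cons, bprod_nil, mul_one, mul_one] at heq
    have haa : a ≠ a' := by
      rintro rfl
      exact hmin k (Nat.lt_succ_self k) ⟨l1, l2, hl, hl', fun h => hne (by rw [h]),
        mul_right_cancel heq⟩
    have aux : ∀ l1 l2 : List Bool, l1.length = k → l2.length = k →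
        bprod (x * t) t l1 * (x * t) = bprod (x * t) t l2 * t →
        cj t x k ∈ Subgroup.closure (cj t x '' Set.Iio k) := by
      intro l1 l2 h1 h2 h
      have e1 := bprod_factor t x l1
      have e2 := bprod_factor t x l2
      rw [h1] at e1
      rw [h2] at e2
      have := Subgroup.mul_mem _ (Subgroup.inv_mem _ e1) e2
      convert this using 1
      simp only [cj]
      have h' : bprod (x * t) t l2 = bprod (x * t) t l1 * x := by
        rw [← mul_assoc] at h
        exact (mul_right_cancel h).symm
      rw [h']; group
    cases a <;> cases a'
    · exact absurd rfl haa
    · exact aux l2 l1 hl' hl heq.symm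
    · exact aux l1 l2 hl hl' heq
    · exact absurd rfl haa
  have hc1 : ∀ c ∈ Subgroup.closure (cj t x '' Set.Iio k),
      t * c * t⁻¹ ∈ Subgroup.closure (cj t x '' Set.Iio k) := by
    apply conj_closure
    rintro _ ⟨i, hi, rfl⟩
    rw [← cj_succ]
    rcases Nat.lt_or_ge (i + 1) k with h | h
    · exact Subgroup.subset_closure ⟨i + 1, h, rfl⟩
    · have : i + 1 = k := le_antisymm hi h
      rw [this]; exact h1
  have hc2 : ∀ c ∈ Subgroup.closure (cj t x '' Set.Iio k),
      t⁻¹ * c * t⁻¹⁻¹ ∈ Subgroup.closure (cj t x '' Set.Iio k) := by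
    apply conj_closure
    rintro _ ⟨i, hi, rfl⟩
    cases i with
    | zero =>
      obtain ⟨b, hb, hxb⟩ := h0
      have : t⁻¹ * cj t x 0 * t⁻¹⁻¹ = b := by rw [cj_zero, hxb]; group
      rw [this]; exact hb
    | succ i =>
      have : t⁻¹ * cj t x (i + 1) * t⁻¹⁻¹ = cj t x i := by rw [cj_succ]; group
      rw [this]
      exact Subgroup.subset_closure ⟨i, Nat.lt_of_succ_lt hi, rfl⟩
  refine ⟨Subgroup.closure (cj t x '' Set.Iio k), hBN k, ?_, ?_, ?_, k, rfl⟩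
  · exact (Subgroup.fg_iff _).2 ⟨_, rfl, (Set.finite_Iio k).image _⟩
  · obtain ⟨b, hb, hxb⟩ := h0
    have := hc1 b hb
    rwa [← hxb] at this
  · intro c
    refine ⟨hc1 c, fun h => ?_⟩
    have := hc2 _ h
    convert this using 1
    group


theorem sub_fg_map {G H : Type} [Group G] [Group H] (f : G →* H) {E : Subgroup G} (hE : E.FG) :
    (E.map f).FG := by
  obtain ⟨X, hX, hf⟩ := (Subgroup.fg_iff _).1 hE
  exact (Subgroup.fg_iff _).2 ⟨f '' X, by rw [← MonoidHom.map_closure, hX], hf.image _⟩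

theorem li_torsionFree {G : Type} [Group G] (hL : LocallyIndicable G) (z : G) (n : ℤ)
    (h : z ^ n = 1) (hn : n ≠ 0) : z = 1 := by
  by_contra hz
  obtain ⟨f, hf⟩ := hL (Subgroup.zpowers z) ⟨{z}, by simp [Subgroup.zpowers_eq_closure]⟩
    (by rwa [Ne, Subgroup.zpowers_eq_bot])
  obtain ⟨⟨_, k, rfl⟩, hy⟩ := hf (Multiplicative.ofAdd 1)
  have h1 : (⟨z ^ k, k, rfl⟩ : Subgroup.zpowers z) ^ n = 1 := by
    apply Subtype.ext
    show (z ^ k) ^ n = 1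
    rw [← zpow_mul, mul_comm, zpow_mul, h, one_zpow]
  have h2 := congrArg f h1
  rw [map_zpow, map_one] at h2
  change f ⟨z ^ k, k, rfl⟩ = _ at hy
  rw [hy, ← ofAdd_zsmul, ofAdd_eq_one] at h2
  simp at h2
  exact hn h2

theorem li_sub {G : Type} [Group G] (hL : LocallyIndicable G) (H : Subgroup G) :
    LocallyIndicable H := by
  intro E hE hne
  have e := Subgroup.equivMapOfInjective E H.subtype H.subtype_injective
  obtain ⟨f, hf⟩ := hL (E.map H.subtype) (sub_fg_map _ hE) (by
    rwa [Ne, Subgroup.map_eq_bot_iff_of_injective _ H.subtype_injective])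
  exact ⟨f.comp e.toMonoidHom, hf.comp e.surjective⟩

theorem li_equiv {G H : Type} [Group G] [Group H] (e : G ≃* H) (hL : LocallyIndicable G) :
    LocallyIndicable H := by
  intro E hE hne
  have hi : Function.Injective e.symm.toMonoidHom := e.symm.injective
  have e' := Subgroup.equivMapOfInjective E e.symm.toMonoidHom hi
  obtain ⟨f, hf⟩ := hL (E.map e.symm.toMonoidHom) (sub_fg_map _ hE) (by
    rwa [Ne, Subgroup.map_eq_bot_iff_of_injective _ hi])
  exact ⟨f.comp e'.toMonoidHom, hf.comp e'.surjective⟩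

theorem indN {G : Type} [Group G] (hL : LocallyIndicable G) (A : Set G) (hA : A.Finite)
    (hne : Subgroup.closure A ≠ ⊥) :
    ∃ N ≤ Subgroup.closure A,
      (∀ g ∈ Subgroup.closure A, ∀ c, c ∈ N ↔ g * c * g⁻¹ ∈ N) ∧
      (∀ g ∈ Subgroup.closure A, ∀ h ∈ Subgroup.closure A, g * h * g⁻¹ * h⁻¹ ∈ N) ∧
      (∀ g ∈ Subgroup.closure A, g ∉ N → ∀ n : ℤ, n ≠ 0 → g ^ n ∉ N) ∧
      (∃ a ∈ A, a ∉ N) ∧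
      ∃ s ∈ Subgroup.closure A, s ∉ N ∧ ∀ g ∈ Subgroup.closure A, ∃ i : ℤ, g * s ^ (-i) ∈ N := by
  obtain ⟨f, hf⟩ := hL _ ((Subgroup.fg_iff _).2 ⟨A, rfl, hA⟩) hne
  have hmem : ∀ g, g ∈ f.ker.map (Subgroup.closure A).subtype ↔
      ∃ h : g ∈ Subgroup.closure A, f ⟨g, h⟩ = 1 := by
    intro g
    constructor
    · rintro ⟨x, hx, rfl⟩
      exact ⟨x.2, hx⟩
    · rintro ⟨h, hx⟩
      exact ⟨⟨g, h⟩, hx, rfl⟩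
  have hs : ∀ (g : G) (h : g ∈ Subgroup.closure A), g ∉ f.ker.map (Subgroup.closure A).subtype →
      f ⟨g, h⟩ ≠ 1 := fun g h hg h1 => hg ((hmem g).2 ⟨h, h1⟩)
  refine ⟨f.ker.map (Subgroup.closure A).subtype, ?_, ?_, ?_, ?_, ?_, ?_⟩
  · intro g hg
    exact ((hmem g).1 hg).1
  · intro g hg c
    rw [hmem, hmem]
    constructor
    · rintro ⟨hc, h⟩
      refine ⟨mul_mem (mul_mem hg hc) (inv_mem hg), ?_⟩
      have : (⟨g * c * g⁻¹, mul_mem (mul_mem hg hc) (inv_mem hg)⟩ : Subgroup.closure A)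
        = ⟨g, hg⟩ * ⟨c, hc⟩ * ⟨g, hg⟩⁻¹ := rfl
      rw [this, map_mul, map_mul, map_inv, h]; simp
    · rintro ⟨hc, h⟩
      have hc' : c ∈ Subgroup.closure A := by
        have := mul_mem (mul_mem (inv_mem hg) hc) hg
        convert this using 1; group
      refine ⟨hc', ?_⟩
      have : (⟨c, hc'⟩ : Subgroup.closure A)
        = ⟨g, hg⟩⁻¹ * ⟨g * c * g⁻¹, hc⟩ * ⟨g, hg⟩ := by
        apply Subtype.ext
        show c = g⁻¹ * (g * c * g⁻¹) * g
        group
      rw [this, map_mul, map_mul, map_inv, h]; simp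
  · intro g hg h hh
    rw [hmem]
    refine ⟨mul_mem (mul_mem (mul_mem hg hh) (inv_mem hg)) (inv_mem hh), ?_⟩
    show f (⟨g, hg⟩ * ⟨h, hh⟩ * ⟨g, hg⟩⁻¹ * ⟨h, hh⟩⁻¹) = 1
    simp only [map_mul, map_inv]
    rw [mul_comm (f ⟨g, hg⟩)]; simp
  · intro g hg hgN n hn hgn
    obtain ⟨h1, h2⟩ := (hmem _).1 hgn
    apply hs g hg hgN
    change f (⟨g, hg⟩ ^ n) = 1 at h2
    rw [map_zpow] at h2
    apply Multiplicative.toAdd.injective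
    have := congrArg Multiplicative.toAdd h2
    simpa [hn] using this
  · by_contra hcon
    push Not at hcon
    have : Subgroup.closure A ≤ f.ker.map (Subgroup.closure A).subtype := by
      rw [Subgroup.closure_le]; exact hcon
    obtain ⟨y, hy⟩ := hf (Multiplicative.ofAdd 1)
    obtain ⟨h1, h2⟩ := (hmem _).1 (this y.2)
    change f y = 1 at h2
    rw [hy] at h2
    exact absurd h2 (by decide)
  · obtain ⟨y, hy⟩ := hf (Multiplicative.ofAdd 1)
    refine ⟨y, y.2, ?_, ?_⟩
    · intro h
      obtain ⟨h1, h2⟩ := (hmem _).1 h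
      change f y = 1 at h2
      rw [hy] at h2
      exact absurd h2 (by decide)
    · intro g hg
      refine ⟨(f ⟨g, hg⟩).toAdd, (hmem _).2 ⟨mul_mem hg (zpow_mem y.2 _), ?_⟩⟩
      show f (⟨g, hg⟩ * y ^ (-(f ⟨g, hg⟩).toAdd)) = 1
      rw [map_mul, map_zpow, hy]
      apply Multiplicative.toAdd.injective
      simp

theorem cyc {K : Type} [Group K] (hL : LocallyIndicable K) (C : Subgroup K) (hC : C.FG)
    (h1 : Cd1 C) (z : K) (hz : z ∈ C) (hz1 : z ≠ 1) (hcen : ∀ c ∈ C, c * z = z * c) :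
    ∃ w ∈ C, C = Subgroup.zpowers w := by
  have hpow : ∀ y ∈ C, ∃ n : ℤ, n ≠ 0 ∧ ∃ q : ℤ, y ^ n = z ^ q := by
    intro y hy
    by_contra hcon
    push Not at hcon
    have hyz : ∀ i : ℤ, y * z ^ i * y⁻¹ = z ^ i := by
      intro i
      have : Commute y (z ^ i) := Commute.zpow_right (hcen y hy) i
      rw [this.eq]; group
    have := h1 y hy (Subgroup.zpowers z) (by rwa [Subgroup.zpowers_le])
      ⟨{z}, by simp [Subgroup.zpowers_eq_closure]⟩ (by
        intro c
        constructor
        · rintro ⟨i, rfl⟩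
          exact ⟨i, (hyz i).symm⟩
        · rintro ⟨i, hi⟩
          refine ⟨i, ?_⟩
          change z ^ i = _ at hi
          rw [← hyz i] at hi
          have := mul_right_cancel hi
          exact mul_left_cancel this) (by
        rintro n hn ⟨q, hq⟩
        exact hcon n hn q hq.symm)
    rw [Subgroup.zpowers_eq_bot] at this
    exact hz1 this
  obtain ⟨g, hg⟩ := hL C hC (by
    rintro rfl
    exact hz1 (Subgroup.mem_bot.1 hz))
  have hgz : (g ⟨z, hz⟩).toAdd ≠ 0 := by
    intro h0
    obtain ⟨y, hy⟩ := hg (Multiplicative.ofAdd 1)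
    obtain ⟨n, hn, q, hq⟩ := hpow y y.2
    have h2 : y ^ n = (⟨z, hz⟩ : C) ^ q := Subtype.ext hq
    have h3 := congrArg (fun u => (g u).toAdd) h2
    simp [hy, h0] at h3
    exact hn h3
  have hinj : ∀ y : C, g y = 1 → y = 1 := by
    intro y hy
    obtain ⟨n, hn, q, hq⟩ := hpow y y.2
    have h2 : y ^ n = (⟨z, hz⟩ : C) ^ q := Subtype.ext hq
    have h3 := congrArg (fun u => (g u).toAdd) h2
    simp only [map_zpow, hy, toAdd_zpow, toAdd_one, mul_zero, smul_eq_mul] at h3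
    have hq0 : q = 0 := by
      rcases mul_eq_zero.1 h3.symm with h | h
      · exact h
      · exact absurd h hgz
    rw [hq0, zpow_zero] at hq
    exact Subtype.ext (li_torsionFree hL _ n hq hn)
  obtain ⟨w, hw⟩ := hg (Multiplicative.ofAdd 1)
  refine ⟨w, w.2, le_antisymm ?_ (by rw [Subgroup.zpowers_le]; exact w.2)⟩
  intro y hy
  refine ⟨(g ⟨y, hy⟩).toAdd, ?_⟩
  have := hinj (⟨y, hy⟩ * (w ^ (g ⟨y, hy⟩).toAdd)⁻¹) (by
    rw [map_mul, map_inv, map_zpow, hw]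
    apply Multiplicative.toAdd.injective
    simp)
  have h2 := mul_inv_eq_one.1 this
  exact (congrArg Subtype.val h2).symm


theorem wb_mono {G : Type} [Group G] {A : Finset G} {m n : ℕ} (h : m ≤ n) {g : G}
    (hg : g ∈ wordBall A m) : g ∈ wordBall A n := by
  obtain ⟨l, h1, h2, h3⟩ := hg
  exact ⟨l, h1.trans h, h2, h3⟩

theorem wb_mul {G : Type} [Group G] {A : Finset G} {m n : ℕ} {g h : G}
    (hg : g ∈ wordBall A m) (hh : h ∈ wordBall A n) : g * h ∈ wordBall A (m + n) := by
  obtain ⟨l, h1, h2, rfl⟩ := hg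
  obtain ⟨l', h1', h2', rfl⟩ := hh
  refine ⟨l ++ l', by simp; omega, ?_, by simp⟩
  intro x hx
  rcases List.mem_append.1 hx with h | h
  · exact h2 x h
  · exact h2' x h

theorem wb_inv {G : Type} [Group G] {A : Finset G} {m : ℕ} {g : G}
    (hg : g ∈ wordBall A m) : g⁻¹ ∈ wordBall A m := by
  obtain ⟨l, h1, h2, rfl⟩ := hg
  refine ⟨(l.map (·⁻¹)).reverse, by simpa using h1, ?_, by rw [List.prod_inv_reverse]⟩
  intro x hx
  simp only [List.mem_reverse, List.mem_map] at hx
  obtain ⟨y, hy, rfl⟩ := hx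
  rw [inv_inv]
  exact (h2 y hy).symm

theorem wb_gen {G : Type} [Group G] {A : Finset G} {g : G} (hg : g ∈ A) : g ∈ wordBall A 1 :=
  ⟨[g], by simp, by simp [hg], by simp⟩

theorem wb_comm {G : Type} [Group G] {A : Finset G} {m n : ℕ} {g h : G}
    (hg : g ∈ wordBall A m) (hh : h ∈ wordBall A n) :
    g * h * g⁻¹ * h⁻¹ ∈ wordBall A (m + n + m + n) :=
  wb_mul (wb_mul (wb_mul hg hh) (wb_inv hg)) (wb_inv hh)

theorem cj_rel {G : Type} [Group G] (t x : G) (n q : ℤ) (h : (cj t x 1) ^ n = x ^ q) (i : ℕ) :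
    (cj t x i) ^ (n ^ i) = x ^ (q ^ i) := by
  have hstep : ∀ i, (cj t x (i + 1)) ^ n = (cj t x i) ^ q := by
    intro i
    have e1 : cj t x (i + 1) = t ^ i * cj t x 1 * (t ^ i)⁻¹ := by simp only [cj]; group
    rw [e1, conj_zpow, h]
    simp only [cj]
    rw [conj_zpow]
  induction i with
  | zero => simp [cj_zero]
  | succ i ih =>
    rw [pow_succ', zpow_mul, hstep, ← zpow_mul, mul_comm, zpow_mul, ih, ← zpow_mul, pow_succ]

theorem zpowers_conj {G : Type} [Group G] (hL : LocallyIndicable G) (t w : G) (hw : w ≠ 1)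
    (h : ∀ c, c ∈ Subgroup.zpowers w ↔ t * c * t⁻¹ ∈ Subgroup.zpowers w) :
    t * w * t⁻¹ = w ∨ t * w * t⁻¹ = w⁻¹ := by
  obtain ⟨a, ha⟩ := (h w).1 (Subgroup.mem_zpowers w)
  obtain ⟨b, hb⟩ := (h (t⁻¹ * w * t)).2 (by
    have : t * (t⁻¹ * w * t) * t⁻¹ = w := by group
    rw [this]; exact Subgroup.mem_zpowers w)
  change w ^ a = _ at ha
  change w ^ b = _ at hb
  have h1 : w ^ (a * b) = w := by
    rw [zpow_mul, ha, conj_zpow, hb]; group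
  have h2 : a * b = 1 := by
    by_contra hne
    apply hw
    apply li_torsionFree hL w (a * b - 1) _ (sub_ne_zero.2 hne)
    rw [zpow_sub_one, h1, mul_inv_cancel]
  rcases Int.eq_one_or_neg_one_of_mul_eq_one h2 with rfl | rfl
  · left; rw [← ha]; simp
  · right; rw [← ha]; simp

theorem lemL3 {K : Type} [Group K] (hK : IsCoherent K) (hL : LocallyIndicable K) (h3 : Van3 K)
    (N : Subgroup K) (t x : K)
    (hn : ∀ c, c ∈ N ↔ t * c * t⁻¹ ∈ N) (ht : ∀ n : ℤ, n ≠ 0 → t ^ n ∉ N) (hx : x ∈ N)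
    (hf : ¬ FreeSemi (x * t) t)
    (hf2 : ∀ y, y = x ∨ y = t * x * t⁻¹ →
      ¬ FreeSemi ((x * (t * x * t⁻¹) * x⁻¹ * (t * x * t⁻¹)⁻¹) * y) y) :
    t * x * t⁻¹ = x ∨ t * x * t⁻¹ = x⁻¹ := by
  by_cases hx1 : x = 1
  · left; rw [hx1]; group
  obtain ⟨C, hCN, hCf, hxC, hCt, m, hCm⟩ := milnor N t x hn ht hx hf
  have hcd : Cd1 C := cd1_of hK hL h3 C hCf t hCt (fun n hn hm => ht n hn (hCN hm))
  set x1 := t * x * t⁻¹ with hx1def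
  have hx1C : x1 ∈ C := (hCt x).1 hxC
  have hx1ne : x1 ≠ 1 := by
    intro h
    apply hx1
    have : x = t⁻¹ * x1 * t := by rw [hx1def]; group
    rw [this, h]; group
  have hcomm : x * x1 * x⁻¹ * x1⁻¹ = 1 := by
    have hxA : x ∈ Subgroup.closure ({x, x1} : Set K) := Subgroup.subset_closure (by simp)
    have hx1A : x1 ∈ Subgroup.closure ({x, x1} : Set K) := Subgroup.subset_closure (by simp)
    have hAC : Subgroup.closure ({x, x1} : Set K) ≤ C := by
      rw [Subgroup.closure_le]
      rintro y (rfl | rfl)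
      · exact hxC
      · exact hx1C
    obtain ⟨M, hMA, hMn, hMc, hMp, ⟨y, hyA, hyM⟩, -⟩ := indN hL {x, x1} (by simp) (by
      intro h
      rw [h] at hxA
      exact hx1 (Subgroup.mem_bot.1 hxA))
    have hyA' : y ∈ Subgroup.closure ({x, x1} : Set K) := Subgroup.subset_closure hyA
    obtain ⟨B, hBM, hBf, hwB, hBy, -⟩ := milnor M y _ (hMn y hyA') (hMp y hyA' hyM)
      (hMc x hxA x1 hx1A) (hf2 y hyA)
    have := hcd y (hAC hyA') B (hBM.trans (hMA.trans hAC)) hBf hBy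
      (fun n hn hm => hMp y hyA' hyM n hn (hBM hm))
    rw [this] at hwB
    exact Subgroup.mem_bot.1 hwB
  have hcom : x1 * x = x * x1 := by
    rw [mul_inv_eq_one, mul_inv_eq_iff_eq_mul] at hcomm
    exact hcomm.symm
  -- powers
  have hpow : ∃ n : ℤ, n ≠ 0 ∧ ∃ q : ℤ, x1 ^ n = x ^ q := by
    by_contra hcon
    push Not at hcon
    have hyz : ∀ i : ℤ, x1 * x ^ i * x1⁻¹ = x ^ i := by
      intro i
      have : Commute x1 (x ^ i) := Commute.zpow_right hcom i
      rw [this.eq]; group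
    have := hcd x1 hx1C (Subgroup.zpowers x) (by rwa [Subgroup.zpowers_le])
      ⟨{x}, by simp [Subgroup.zpowers_eq_closure]⟩ (by
        intro c
        constructor
        · rintro ⟨i, rfl⟩
          exact ⟨i, (hyz i).symm⟩
        · rintro ⟨i, hi⟩
          refine ⟨i, ?_⟩
          change x ^ i = _ at hi
          rw [← hyz i] at hi
          have := mul_right_cancel hi
          exact mul_left_cancel this) (by
        rintro n hn ⟨q, hq⟩
        exact hcon n hn q hq.symm)
    rw [Subgroup.zpowers_eq_bot] at this
    exact hx1 this
  obtain ⟨n, hn0, q, hq⟩ := hpow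
  have hq0 : q ≠ 0 := by
    rintro rfl
    rw [zpow_zero] at hq
    exact hx1ne (li_torsionFree hL _ n hq hn0)
  have hc1 : cj t x 1 = x1 := by simp [cj, hx1def]
  have hrel := cj_rel t x n q (by rw [hc1]; exact hq)
  obtain ⟨w, hwC, hCw⟩ := cyc hL C hCf hcd (x ^ (q ^ m)) (C.zpow_mem hxC _)
    (fun h => hx1 (li_torsionFree hL _ _ h (pow_ne_zero _ hq0))) (by
      have hle : C ≤ Subgroup.centralizer {x ^ (q ^ m)} := by
        conv_lhs => rw [hCm]
        rw [Subgroup.closure_le]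
        rintro _ ⟨i, hi, rfl⟩
        rw [SetLike.mem_coe, Subgroup.mem_centralizer_singleton_iff]
        have hi' : i < m := hi
        have : x ^ (q ^ m) = (cj t x i) ^ (n ^ i * q ^ (m - i)) := by
          rw [zpow_mul, hrel, ← zpow_mul, ← pow_add, Nat.add_sub_cancel' hi'.le]
        rw [this]
        exact (Commute.self_zpow _ _).eq
      intro c hc
      exact Subgroup.mem_centralizer_singleton_iff.1 (hle hc))
  have hw1 : w ≠ 1 := by
    rintro rfl
    rw [Subgroup.zpowers_one_eq_bot] at hCw
    rw [hCw] at hxC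
    exact hx1 (Subgroup.mem_bot.1 hxC)
  have hCt' := hCt
  rw [hCw] at hCt' hxC
  obtain ⟨k, rfl⟩ := hxC
  show t * w ^ k * t⁻¹ = w ^ k ∨ t * w ^ k * t⁻¹ = (w ^ k)⁻¹
  rw [← conj_zpow]
  rcases zpowers_conj hL t w hw1 hCt' with h | h <;> rw [h]
  · left; rfl
  · right; rw [inv_zpow]


/-- the exceptional subgroups -/
def SmallG {G : Type} [Group G] (S : Subgroup G) : Prop :=
  S = ⊥ ∨ (∃ t, S = Subgroup.zpowers t ∧ ∀ n : ℤ, t ^ n = 1 → n = 0) ∨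
  ∃ a t, S = Subgroup.closure {a, t} ∧ (t * a * t⁻¹ = a ∨ t * a * t⁻¹ = a⁻¹) ∧
    ∀ i j : ℤ, a ^ i * t ^ j = 1 → i = 0 ∧ j = 0

/-- uniform dichotomy with constant `L` -/
def QProp (L : ℕ) (G : Type) [Group G] : Prop :=
  ∀ A : Finset G, SmallG (Subgroup.closure (A : Set G)) ∨
    ∃ u ∈ wordBall A L, ∃ v ∈ wordBall A L, FreeSemi u v

theorem pm_mul {G : Type} [Group G] {c g h : G} (hg : g * c * g⁻¹ = c ∨ g * c * g⁻¹ = c⁻¹)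
    (hh : h * c * h⁻¹ = c ∨ h * c * h⁻¹ = c⁻¹) :
    g * h * c * (g * h)⁻¹ = c ∨ g * h * c * (g * h)⁻¹ = c⁻¹ := by
  have e : g * h * c * (g * h)⁻¹ = g * (h * c * h⁻¹) * g⁻¹ := by group
  rw [e]
  rcases hh with h | h <;> rw [h]
  · exact hg
  · rw [← conj_inv]
    rcases hg with h | h <;> rw [h]
    · right; rfl
    · left; rw [inv_inv]

theorem pm_inv {G : Type} [Group G] {c g : G} (hg : g * c * g⁻¹ = c ∨ g * c * g⁻¹ = c⁻¹) :
    g⁻¹ * c * g⁻¹⁻¹ = c ∨ g⁻¹ * c * g⁻¹⁻¹ = c⁻¹ := by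
  rcases hg with h | h
  · left; nth_rewrite 1 [← h]; group
  · right
    have : c⁻¹ = g⁻¹ * (g * c * g⁻¹)⁻¹ * g := by group
    rw [this, h]; group

theorem pm_closure {G : Type} [Group G] {c : G} {A : Set G}
    (hA : ∀ a ∈ A, a * c * a⁻¹ = c ∨ a * c * a⁻¹ = c⁻¹) :
    ∀ g ∈ Subgroup.closure A, g * c * g⁻¹ = c ∨ g * c * g⁻¹ = c⁻¹ := by
  intro g hg
  induction hg using Subgroup.closure_induction with
  | mem x hx => exact hA x hx
  | one => left; group
  | mul x y _ _ hx hy => exact pm_mul hx hy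
  | inv x _ hx => exact pm_inv hx

theorem pm_mem {G : Type} [Group G] {c g : G} {E : Subgroup G} (hc : c ∈ E)
    (hg : g * c * g⁻¹ = c ∨ g * c * g⁻¹ = c⁻¹) : g * c * g⁻¹ ∈ E := by
  rcases hg with h | h <;> rw [h]
  · exact hc
  · exact E.inv_mem hc

theorem comm_closure {G : Type} [Group G] {A : Set G} {E : Subgroup G}
    (hE : ∀ g ∈ Subgroup.closure A, ∀ c ∈ E, g * c * g⁻¹ ∈ E)
    (hc : ∀ a ∈ A, ∀ b ∈ A, a * b * a⁻¹ * b⁻¹ ∈ E) :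
    ∀ g ∈ Subgroup.closure A, ∀ h ∈ Subgroup.closure A, g * h * g⁻¹ * h⁻¹ ∈ E := by
  have h1 : ∀ b ∈ Subgroup.closure A, (∀ a ∈ A, a * b * a⁻¹ * b⁻¹ ∈ E) →
      ∀ g ∈ Subgroup.closure A, g * b * g⁻¹ * b⁻¹ ∈ E := by
    intro b hb hab g hg
    induction hg using Subgroup.closure_induction with
    | mem x hx => exact hab x hx
    | one => convert E.one_mem using 1; group
    | mul x y hx' hy' hx hy =>
      have := E.mul_mem (hE x hx' _ hy) hx
      convert this using 1; group
    | inv x hx' hx =>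
      have := E.inv_mem (hE x⁻¹ (inv_mem hx') _ hx)
      convert this using 1; group
  intro g hg h hh
  apply h1 h hh _ g hg
  intro a ha
  have := h1 a (Subgroup.subset_closure ha) (fun b hb => hc b hb a ha) h hh
  have := E.inv_mem this
  convert this using 1; group

theorem base_case {K : Type} [Group K] (hK : IsCoherent K) (hL : LocallyIndicable K)
    (h3 : Van3 K) : QProp 40 K := by
  classical
  intro A
  by_contra hcon
  rw [not_or] at hcon
  obtain ⟨hns, hnf⟩ := hcon
  have hfree : ∀ u ∈ wordBall A 40, ∀ v ∈ wordBall A 40, ¬ FreeSemi u v := by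
    intro u hu v hv h
    exact hnf ⟨u, hu, v, hv, h⟩
  apply hns
  by_cases hbot : Subgroup.closure (A : Set K) = ⊥
  · exact Or.inl hbot
  obtain ⟨N, hNS, hNn, hNc, hNp, ⟨t, htA, htN⟩, s, hsS, hsN, hs⟩ :=
    indN hL (A : Set K) A.finite_toSet hbot
  set S := Subgroup.closure (A : Set K) with hS
  have hAS : ∀ a ∈ A, a ∈ S := fun a ha => Subgroup.subset_closure ha
  -- commutators of generators
  have key : ∀ g, g ∈ wordBall A 2 → g ∈ S → g ∉ N → ∀ x ∈ wordBall A 4, x ∈ N →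
      g * x * g⁻¹ = x ∨ g * x * g⁻¹ = x⁻¹ := by
    intro g hg hgS hgN x hx hxN
    have hx1 : g * x * g⁻¹ ∈ wordBall A 8 := wb_mul (wb_mul hg hx) (wb_inv hg)
    have hw := wb_comm hx hx1
    apply lemL3 hK hL h3 N g x (hNn g hgS) (hNp g hgS hgN) hxN
    · exact hfree _ (wb_mono (by norm_num) (wb_mul hx hg)) _ (wb_mono (by norm_num) hg)
    · rintro y (rfl | rfl)
      · exact hfree _ (wb_mono (by norm_num) (wb_mul hw hx)) _ (wb_mono (by norm_num) hx)
      · exact hfree _ (wb_mono (by norm_num) (wb_mul hw hx1)) _ (wb_mono (by norm_num) hx1)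
  have hcA : ∀ x ∈ wordBall A 4, x ∈ N → ∀ g ∈ S, g * x * g⁻¹ = x ∨ g * x * g⁻¹ = x⁻¹ := by
    intro x hx hxN
    apply pm_closure
    intro a ha
    by_cases haN : a ∈ N
    · have h1 := key (a * t) (wb_mul (wb_gen ha) (wb_gen htA)) (mul_mem (hAS a ha) (hAS t htA))
        (fun h => htN (by
          have := N.mul_mem (N.inv_mem haN) h
          rwa [inv_mul_cancel_left] at this)) x hx hxN
      have h2 := pm_inv (key t (wb_mono (by norm_num) (wb_gen htA)) (hAS t htA) htN x hx hxN)
      have := pm_mul h1 h2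
      rwa [mul_inv_cancel_right] at this
    · exact key a (wb_mono (by norm_num) (wb_gen ha)) (hAS a ha) haN x hx hxN
  let X : Set K := (fun p : K × K => p.1 * p.2 * p.1⁻¹ * p.2⁻¹) '' ((A : Set K) ×ˢ (A : Set K))
  have hXf : X.Finite := (A.finite_toSet.prod A.finite_toSet).image _
  have hXN : ∀ x ∈ X, x ∈ N := by
    rintro _ ⟨⟨a, b⟩, ⟨ha, hb⟩, rfl⟩
    exact hNc a (hAS a ha) b (hAS b hb)
  have hX4 : ∀ x ∈ X, x ∈ wordBall A 4 := by
    rintro _ ⟨⟨a, b⟩, ⟨ha, hb⟩, rfl⟩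
    exact wb_comm (wb_gen ha) (wb_gen hb)
  have hcomm : ∀ g ∈ S, ∀ h ∈ S, g * h * g⁻¹ * h⁻¹ ∈ Subgroup.closure X := by
    apply comm_closure
    · intro g hg
      apply conj_closure
      intro x hx
      exact pm_mem (Subgroup.subset_closure hx) (hcA x (hX4 x hx) (hXN x hx) g hg)
    · intro a ha b hb
      exact Subgroup.subset_closure ⟨(a, b), ⟨ha, hb⟩, rfl⟩
  -- N is finitely generated
  choose! i hi using hs
  let Y : Set K := X ∪ (fun a => a * s ^ (-i a)) '' (A : Set K)
  have hYf : Y.Finite := hXf.union (A.finite_toSet.image _)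
  have hYN : Subgroup.closure Y ≤ N := by
    rw [Subgroup.closure_le]
    rintro y (hy | ⟨a, ha, rfl⟩)
    · exact hXN y hy
    · exact hi a (hAS a ha)
  have hXY : Subgroup.closure X ≤ Subgroup.closure Y := Subgroup.closure_mono Set.subset_union_left
  have hNY : N = Subgroup.closure Y := by
    apply le_antisymm _ hYN
    have hnorm : ∀ c, c ∈ Subgroup.closure Y ↔ s * c * s⁻¹ ∈ Subgroup.closure Y := by
      intro c
      constructor
      · intro hc
        have h1 := hXY (hcomm s hsS c (hNS (hYN hc)))
        have := Subgroup.mul_mem _ h1 hc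
        rwa [inv_mul_cancel_right] at this
      · intro hc
        have h1 := hXY (hcomm s⁻¹ (inv_mem hsS) _ (hNS (hYN hc)))
        have := Subgroup.mul_mem _ h1 hc
        rw [inv_mul_cancel_right] at this
        convert this using 1; group
    obtain ⟨D, -, t', hYD, ht', -, -, -, hD⟩ := exists_pi (Subgroup.closure Y) s hnorm
      (fun n hn h => hNp s hsS hsN n hn (hYN h))
    have hsD : s ∈ D := by rw [← ht']; exact t'.2
    have hSD : S ≤ D := by
      rw [hS, Subgroup.closure_le]
      intro a ha
      have h1 : a * s ^ (-i a) ∈ D := hYD (Subgroup.subset_closure (Or.inr ⟨a, ha, rfl⟩))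
      have := D.mul_mem h1 (D.zpow_mem hsD (i a))
      rwa [mul_assoc, ← zpow_add, neg_add_cancel, zpow_zero, mul_one] at this
    intro g hg
    obtain ⟨c, hc, n, rfl⟩ := hD g (hSD (hNS hg))
    have hn : n = 0 := by
      by_contra hn
      apply hNp s hsS hsN n hn
      have := N.mul_mem (N.inv_mem (hYN hc)) hg
      rwa [inv_mul_cancel_left] at this
    rw [hn, zpow_zero, mul_one]
    exact hc
  have hNf : N.FG := (Subgroup.fg_iff _).2 ⟨Y, hNY.symm, hYf⟩
  have hcd : Cd1 N := cd1_of hK hL h3 N hNf s (hNn s hsS) (hNp s hsS hsN)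
  have hsinf : ∀ n : ℤ, s ^ n = 1 → n = 0 := by
    intro n hn
    by_contra h0
    exact hNp s hsS hsN n h0 (by rw [hn]; exact N.one_mem)
  by_cases hN1 : N = ⊥
  · right; left
    refine ⟨s, le_antisymm ?_ (by rw [Subgroup.zpowers_le]; exact hsS), hsinf⟩
    intro g hg
    have := hi g hg
    rw [hN1, Subgroup.mem_bot, zpow_neg, mul_inv_eq_one] at this
    exact ⟨i g, this.symm⟩
  have hz : ∃ z ∈ N, z ≠ 1 ∧ ∀ g ∈ S, g * z * g⁻¹ = z ∨ g * z * g⁻¹ = z⁻¹ := by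
    by_cases hX1 : ∃ x ∈ X, x ≠ 1
    · obtain ⟨x, hx, hx1⟩ := hX1
      exact ⟨x, hXN x hx, hx1, hcA x (hX4 x hx) (hXN x hx)⟩
    · push Not at hX1
      obtain ⟨⟨z, hz⟩, hz1⟩ := Subgroup.ne_bot_iff_exists_ne_one.1 hN1
      refine ⟨z, hz, fun h => hz1 (Subtype.ext h), fun g hg => ?_⟩
      left
      have hb : Subgroup.closure X ≤ ⊥ := by
        rw [Subgroup.closure_le]
        intro x hx
        exact Subgroup.mem_bot.2 (hX1 x hx)
      have := Subgroup.mem_bot.1 (hb (hcomm g hg z (hNS hz)))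
      exact mul_inv_eq_one.1 this
  obtain ⟨z, hzN, hz1, hzS⟩ := hz
  have hcen : ∀ c ∈ N, c * z = z * c := by
    intro g hg
    rcases hzS g (hNS hg) with h | h
    · rw [mul_inv_eq_iff_eq_mul] at h; exact h
    · exfalso
      have hzp : ∀ i : ℤ, g * z ^ i * g⁻¹ = z ^ (-i) := by
        intro i
        rw [← conj_zpow, h, inv_zpow, zpow_neg]
      have hne : ¬ ∀ n : ℤ, n ≠ 0 → g ^ n ∉ Subgroup.zpowers z := by
        intro hall
        have := hcd g hg (Subgroup.zpowers z) (by rwa [Subgroup.zpowers_le])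
          ⟨{z}, by simp [Subgroup.zpowers_eq_closure]⟩ (by
            intro c
            constructor
            · rintro ⟨i, rfl⟩
              exact ⟨-i, (hzp i).symm⟩
            · rintro ⟨i, hi⟩
              refine ⟨-i, ?_⟩
              change z ^ i = _ at hi
              have e := hzp (-i)
              rw [neg_neg, hi] at e
              have := mul_right_cancel e
              exact mul_left_cancel this) hall
        rw [Subgroup.zpowers_eq_bot] at this
        exact hz1 this
      push Not at hne
      obtain ⟨n, hn, q, hq⟩ := hne
      change z ^ q = g ^ n at hq
      have e1 := hzp q
      rw [hq, (Commute.self_zpow g n).eq, mul_inv_cancel_right, ← hq] at e1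
      have e2 : z ^ (q + q) = 1 := by
        nth_rewrite 1 [zpow_add, e1]; rw [← zpow_add, neg_add_cancel, zpow_zero]
      have hq0 : q = 0 := by
        by_contra hq0
        exact hz1 (li_torsionFree hL z (q + q) e2 (by omega))
      rw [hq0, zpow_zero] at hq
      have hg1 := li_torsionFree hL g n hq.symm hn
      rw [hg1, one_mul, inv_one, mul_one] at h
      have e3 : z ^ (2 : ℤ) = 1 := by
        rw [zpow_two]; nth_rewrite 1 [h]; rw [inv_mul_cancel]
      exact hz1 (li_torsionFree hL z 2 e3 (by norm_num))
  obtain ⟨w, hwN, hNw⟩ := cyc hL N hNf hcd z hzN hz1 hcen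
  have hw1 : w ≠ 1 := by
    rintro rfl
    rw [Subgroup.zpowers_one_eq_bot] at hNw
    exact hN1 hNw
  right; right
  refine ⟨w, s, ?_, ?_, ?_⟩
  · apply le_antisymm
    · intro g hg
      have h1 := hi g hg
      rw [hNw] at h1
      obtain ⟨k, hk⟩ := h1
      have : g = w ^ k * s ^ i g := by
        change w ^ k = _ at hk
        rw [hk, mul_assoc, ← zpow_add, neg_add_cancel, zpow_zero, mul_one]
      rw [this]
      exact mul_mem (zpow_mem (Subgroup.subset_closure (by simp)) _)
        (zpow_mem (Subgroup.subset_closure (by simp)) _)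
    · rw [Subgroup.closure_le]
      rintro y (rfl | rfl)
      · exact hNS hwN
      · exact hsS
  · have := hNn s hsS
    rw [hNw] at this
    exact zpowers_conj hL s w hw1 this
  · intro a b hab
    have hb : b = 0 := by
      by_contra hb
      apply hNp s hsS hsN b hb
      have : s ^ b = (w ^ a)⁻¹ := (inv_eq_of_mul_eq_one_right hab).symm
      rw [this]
      exact N.inv_mem (N.zpow_mem hwN a)
    rw [hb, zpow_zero, mul_one] at hab
    refine ⟨?_, hb⟩
    by_contra ha
    exact hw1 (li_torsionFree hL w a hab ha)


theorem seq_abs_le (p q : ℤ) (w : ℤ → ℤ) (hw : ∃ i, w i ≠ 0) (hp : p ≠ 0)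
    (h : ∀ i, p * w (i + 1) = q * w i) : |p| ≤ |q| := by
  by_contra hlt
  push Not at hlt
  have key : ∀ n : ℕ, ∀ i, (w i).natAbs ≤ n → w i = 0 := by
    intro n
    induction n with
    | zero => intro i hi; omega
    | succ n ih =>
      intro i hi
      by_contra h0
      have h1 : |p| * |w (i + 1)| = |q| * |w i| := by rw [← abs_mul, ← abs_mul, h]
      have h2 : 0 < |w i| := abs_pos.2 h0
      have h3 : |w (i + 1)| < |w i| := by
        by_contra hge
        push Not at hge
        have : |q| * |w i| < |p| * |w i| := mul_lt_mul_of_pos_right hlt h2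
        have : |p| * |w i| ≤ |p| * |w (i + 1)| := mul_le_mul_of_nonneg_left hge (abs_nonneg p)
        linarith
      have h4 := ih (i + 1) (by rw [Int.abs_eq_natAbs, Int.abs_eq_natAbs] at h3; omega)
      rw [h4, abs_zero, mul_zero] at h1
      have h5 : q = 0 := by
        rcases mul_eq_zero.1 h1.symm with h | h
        · exact abs_eq_zero.1 h
        · exact absurd (abs_eq_zero.1 h) h0
      -- then w is zero everywhere
      have h6 := h (i - 1)
      rw [h5, zero_mul, sub_add_cancel] at h6
      rcases mul_eq_zero.1 h6 with h | h
      · exact hp h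
      · exact h0 h
  obtain ⟨i, hi⟩ := hw
  exact hi (key _ i le_rfl)

theorem seq_abs_eq (p q : ℤ) (w : ℤ → ℤ) (hw : ∃ i, w i ≠ 0) (hp : p ≠ 0) (hq : q ≠ 0)
    (h : ∀ i, p * w (i + 1) = q * w i) : |p| = |q| := by
  apply le_antisymm (seq_abs_le p q w hw hp h)
  apply seq_abs_le q p (fun i => w (-i)) _ hq
  · intro i
    have := h (-(i + 1))
    have e : -(i + 1) + 1 = -i := by ring
    rw [e] at this
    exact this.symm
  · obtain ⟨i, hi⟩ := hw
    exact ⟨-i, by simpa using hi⟩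

theorem seq_unit (a b c : ℤ) (u : ℤ → ℤ) (hu : ∃ i, u i ≠ 0) (ha : a ≠ 0) (hc : c ≠ 0)
    (hg : ∀ d : ℤ, d ∣ a → d ∣ b → d ∣ c → IsUnit d)
    (h : ∀ i, c * u (i + 2) + b * u (i + 1) + a * u i = 0)
    (h1 : a + b + c ≠ 0) (h2 : a - b + c ≠ 0) : (c = 1 ∨ c = -1) ∧ (a = 1 ∨ a = -1) := by
  have hW : ∀ i, c * (u (i + 1) * u (i + 1 + 2) - u (i + 1 + 1) ^ 2)
      = a * (u i * u (i + 2) - u (i + 1) ^ 2) := by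
    intro i
    have e1 := h i
    have e2 := h (i + 1)
    have e3 : i + 1 + 1 = i + 2 := by ring
    rw [e3] at e2 ⊢
    linear_combination u (i + 1) * e2 - u (i + 2) * e1
  have hac : |c| = |a| := by
    by_cases hW0 : ∃ i, u i * u (i + 2) - u (i + 1) ^ 2 ≠ 0
    · exact seq_abs_eq c a (fun i => u i * u (i + 2) - u (i + 1) ^ 2) hW0 hc ha hW
    · exfalso
      push Not at hW0
      have up : ∀ i, u i ≠ 0 → u (i + 1) ≠ 0 := by
        intro i hi h0
        have e1 := h i
        have e2 := hW0 i
        rw [h0] at e1 e2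
        have e3 : u (i + 2) = 0 := by
          have : u i * u (i + 2) = 0 := by linarith
          rcases mul_eq_zero.1 this with h | h
          · exact absurd h hi
          · exact h
        rw [e3] at e1
        have : a * u i = 0 := by linarith
        rcases mul_eq_zero.1 this with h | h
        · exact ha h
        · exact hi h
      have down : ∀ i, u (i + 1) ≠ 0 → u i ≠ 0 := by
        intro i hi h0
        have e2 := hW0 i
        rw [h0] at e2
        have : u (i + 1) ^ 2 = 0 := by linarith
        exact hi (pow_eq_zero_iff (two_ne_zero) |>.1 this)
      obtain ⟨i0, hi0⟩ := hu
      have hall : ∀ i, u i ≠ 0 := by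
        intro i
        induction i using Int.inductionOn' (b := i0) with
        | zero => exact hi0
        | succ k _ ih => exact up k ih
        | pred k _ ih => exact down (k - 1) (by rwa [sub_add_cancel])
      have hr : ∀ i, u i0 * u (i + 1) = u (i0 + 1) * u i := by
        intro i
        induction i using Int.inductionOn' (b := i0) with
        | zero => ring
        | succ k _ ih =>
          have e := hW0 k
          have e3 : k + 1 + 1 = k + 2 := by ring
          rw [e3]
          apply mul_left_cancel₀ (hall k)
          linear_combination u i0 * e + u (k + 1) * ih
        | pred k _ ih =>
          have e := hW0 (k - 1)
          have e3 : k - 1 + 2 = k + 1 := by ring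
          rw [e3, sub_add_cancel] at e
          rw [sub_add_cancel]
          apply mul_left_cancel₀ (hall (k + 1))
          have e4 : u (k + 1) * u (k - 1) = u k ^ 2 := by linarith
          linear_combination (u k) * ih - u (i0 + 1) * e4
      have habs := seq_abs_eq (u i0) (u (i0 + 1)) u ⟨i0, hi0⟩ hi0 (hall _) hr
      have e1 := h i0
      have e2 := hW0 i0
      rcases abs_eq_abs.1 habs with h' | h'
      · have e3 : u (i0 + 2) = u i0 := by
          apply mul_left_cancel₀ hi0
          rw [← h'] at e2; linarith
        rw [e3, ← h'] at e1
        have : (a + b + c) * u i0 = 0 := by linarith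
        rcases mul_eq_zero.1 this with h | h
        · exact h1 h
        · exact hi0 h
      · have h'' : u (i0 + 1) = - u i0 := by linarith
        have e3 : u (i0 + 2) = u i0 := by
          apply mul_left_cancel₀ hi0
          rw [h''] at e2; linarith
        rw [e3, h''] at e1
        have : (a - b + c) * u i0 = 0 := by linarith
        rcases mul_eq_zero.1 this with h | h
        · exact h2 h
        · exact hi0 h
  have hca : c ∣ a := by rw [← abs_dvd_abs, hac]
  have hcb : IsCoprime c b := by
    rw [Int.isCoprime_iff_gcd_eq_one]
    have := hg (Int.gcd c b) ((Int.gcd_dvd_left _ _).trans hca) (Int.gcd_dvd_right _ _)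
      (Int.gcd_dvd_left _ _)
    rw [Int.isUnit_iff] at this
    omega
  have hdiv : ∀ k : ℕ, ∀ i, c ^ k ∣ u i := by
    intro k
    induction k with
    | zero => intro i; simp
    | succ k ih =>
      choose v hv using ih
      have hv' : ∀ i, c * v (i + 2) + b * v (i + 1) + a * v i = 0 := by
        intro i
        have := h i
        rw [hv, hv, hv] at this
        apply mul_left_cancel₀ (pow_ne_zero k hc)
        linear_combination this
      intro i
      have h3 : c ∣ v i := by
        have := hv' (i - 1)
        rw [sub_add_cancel] at this
        have h4 : c ∣ b * v i := by
          obtain ⟨a', ha'⟩ := hca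
          refine ⟨-v (i - 1 + 2) - a' * v (i - 1), ?_⟩
          rw [ha'] at this
          linear_combination this
        exact hcb.dvd_of_dvd_mul_left h4
      rw [hv i, pow_succ]
      exact mul_dvd_mul_left _ h3
  have hc1 : |c| = 1 := by
    by_contra hne
    have h2c : 2 ≤ c.natAbs := by
      have : c.natAbs ≠ 0 := by omega
      have : c.natAbs ≠ 1 := by rw [Int.abs_eq_natAbs] at hne; omega
      omega
    obtain ⟨i, hi⟩ := hu
    have h5 := hdiv (u i).natAbs i
    have h6 := Int.natAbs_dvd_natAbs.2 h5
    rw [Int.natAbs_pow] at h6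
    have h7 := Nat.le_of_dvd (by omega) h6
    have h8 := Nat.lt_pow_self (n := (u i).natAbs) h2c
    omega
  rw [hc1] at hac
  rw [Int.abs_eq_natAbs] at hc1 hac
  exact ⟨by omega, by omega⟩

/-- the recursive sequence of second coordinates -/
theorem beta_growth (T τ : ℤ) (hT : 3 ≤ T) (hτ : τ ≠ 0) (β : ℕ → ℤ) (h0 : β 0 = 0) (h1 : β 1 = τ)
    (hr : ∀ n, β (n + 2) = T * β (n + 1) - β n) (n : ℕ) :
    ∑ i ∈ Finset.range (n + 1), |β i| < |β (n + 1)| := by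
  have h2 : ∀ n, 2 * |β n| ≤ |β (n + 1)| := by
    intro n
    induction n with
    | zero => simp [h0]
    | succ n ih =>
      rw [hr]
      have e1 := abs_sub_abs_le_abs_sub (T * β (n + 1)) (β n)
      rw [abs_mul, abs_of_pos (show (0 : ℤ) < T by linarith)] at e1
      have := mul_le_mul_of_nonneg_right hT (abs_nonneg (β (n + 1)))
      have := abs_nonneg (β n)
      linarith
  induction n with
  | zero => simpa [h0, h1] using hτ
  | succ n ih =>
    rw [Finset.sum_range_succ]
    have := h2 (n + 1)
    linarith


def dig (β : ℕ → ℤ) : List Bool → ℤ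
  | [] => 0
  | b :: l => dig β l + (if b then β l.length else 0)

theorem dig_bound (β : ℕ → ℤ) : ∀ l l' : List Bool, l.length = l'.length →
    |dig β l - dig β l'| ≤ ∑ i ∈ Finset.range l.length, |β i| := by
  intro l
  induction l with
  | nil =>
    intro l' h
    cases l' with
    | nil => simp
    | cons b' l' => simp at h
  | cons b l ih =>
    intro l' h
    cases l' with
    | nil => simp at h
    | cons b' l' =>
      have h' : l.length = l'.length := by simpa using h
      have := ih l' h'
      rw [List.length_cons, Finset.sum_range_succ]
      simp only [dig, ← h']
      have e : |(if b then β l.length else 0) - (if b' then β l.length else 0)| ≤ |β l.length| := by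
        cases b <;> cases b' <;> simp
      calc _ = |(dig β l - dig β l') +
            ((if b then β l.length else 0) - (if b' then β l.length else 0))| := by ring_nf
        _ ≤ _ := abs_add_le _ _
        _ ≤ _ := add_le_add this e

theorem dig_inj (α β : ℕ → ℤ) (hα : α 0 = 1)
    (hβ : ∀ n, ∑ i ∈ Finset.range (n + 1), |β i| < |β (n + 1)|) :
    ∀ l l' : List Bool, l.length = l'.length → dig α l = dig α l' → dig β l = dig β l' →
      l = l' := by
  intro l
  induction l with
  | nil =>
    intro l' h
    cases l' with
    | nil => simp
    | cons b' l' => simp at h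
  | cons b l ih =>
    intro l' h ha hb
    cases l' with
    | nil => simp at h
    | cons b' l' =>
      have h' : l.length = l'.length := by simpa using h
      have hbd := dig_bound β l l' h'
      by_cases hbb : b = b'
      · subst hbb
        simp only [dig, ← h', add_left_inj] at ha hb
        rw [ih l' h' ha hb]
      · exfalso
        simp only [dig, ← h'] at ha hb
        have hbd' : |β l.length| ≤ |dig β l - dig β l'| := by
          apply le_of_eq
          cases b <;> cases b' <;> simp at hbb ha hb
          · rw [hb]; simp
          · rw [← hb]; simp
        rcases hl : l.length with _ | n
        · have e1 := List.length_eq_zero_iff.1 hl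
          have e2 := List.length_eq_zero_iff.1 (h'.symm.trans hl)
          subst e1; subst e2
          cases b <;> cases b' <;> simp [dig, hα] at hbb ha
        · rw [hl] at hbd hbd'
          have := hβ n
          linarith

/-- gcd reduction of a relation between commuting elements -/
theorem rel_reduce {G : Type} [Group G] (hL : LocallyIndicable G) {x y z : G}
    (hxy : Commute x y) (hxz : Commute x z) (hyz : Commute y z) (a b c : ℤ)
    (hne : ¬ (a = 0 ∧ b = 0 ∧ c = 0)) (h : x ^ a * y ^ b * z ^ c = 1) :
    ∃ a b c : ℤ, (∀ d : ℤ, d ∣ a → d ∣ b → d ∣ c → IsUnit d) ∧ x ^ a * y ^ b * z ^ c = 1 := by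
  set d := gcd a (gcd b c) with hd
  have hda : d ∣ a := gcd_dvd_left _ _
  have hdb : d ∣ b := (gcd_dvd_right _ _).trans (gcd_dvd_left _ _)
  have hdc : d ∣ c := (gcd_dvd_right _ _).trans (gcd_dvd_right _ _)
  have hd0 : d ≠ 0 := by
    intro h0
    rw [h0] at hda hdb hdc
    exact hne ⟨zero_dvd_iff.1 hda, zero_dvd_iff.1 hdb, zero_dvd_iff.1 hdc⟩
  clear_value d
  obtain ⟨a', rfl⟩ := hda
  obtain ⟨b', rfl⟩ := hdb
  obtain ⟨c', rfl⟩ := hdc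
  refine ⟨a', b', c', ?_, ?_⟩
  · intro e ha hb hc
    have : d * e ∣ d := by
      conv_rhs => rw [hd]
      exact dvd_gcd (mul_dvd_mul_left d ha)
        (dvd_gcd (mul_dvd_mul_left d hb) (mul_dvd_mul_left d hc))
    have h2 : d * e ∣ d * 1 := by rwa [mul_one]
    exact isUnit_of_dvd_one ((mul_dvd_mul_iff_left hd0).1 h2)
  · apply li_torsionFree hL _ d _ hd0
    have c1 : Commute (x ^ a') (y ^ b') := (hxy.zpow_zpow _ _)
    have c2 : Commute (x ^ a' * y ^ b') (z ^ c') :=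
      (hxz.zpow_zpow _ _).mul_left (hyz.zpow_zpow _ _)
    rw [c2.mul_zpow, c1.mul_zpow, ← zpow_mul, ← zpow_mul, ← zpow_mul, mul_comm a', mul_comm b',
      mul_comm c']
    exact h


theorem free_matrix {G : Type} [Group G] (π : G →* Multiplicative ℤ) (y z s : G)
    (hs : π s ≠ 1) (hy : π y = 1) (hz : π z = 1) (hyz : Commute y z)
    (hinj : ∀ i j : ℤ, y ^ i * z ^ j = 1 → i = 0 ∧ j = 0)
    (τ δ : ℤ) (hδ : δ * δ = 1) (hT : 3 ≤ τ * τ - 2 * δ) (hτ : τ ≠ 0)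
    (hsy : ∀ i j : ℤ, s * (y ^ i * z ^ j) * s⁻¹ =
      y ^ (-δ * i - δ * τ * j) * z ^ (τ * i + (τ * τ - δ) * j)) :
    FreeSemi (y * s) s := by
  have hF : ∀ i j k l : ℤ, (y ^ i * z ^ j) * (y ^ k * z ^ l) = y ^ (i + k) * z ^ (j + l) := by
    intro i j k l
    rw [zpow_add, zpow_add, mul_assoc, ← mul_assoc (z ^ j), (hyz.zpow_zpow k j).symm.eq]
    simp only [mul_assoc]
  have hFi : ∀ i j k l : ℤ, y ^ i * z ^ j = y ^ k * z ^ l → i = k ∧ j = l := by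
    intro i j k l h
    have := hF i j (-k) (-l)
    rw [h, hF, add_neg_cancel, add_neg_cancel] at this
    obtain ⟨h1, h2⟩ := hinj _ _ (by rw [← this]; simp)
    omega
  obtain ⟨ab, h0, hsucc⟩ : ∃ ab : ℕ → ℤ × ℤ, ab 0 = (1, 0) ∧ ∀ n, ab (n + 1) =
      (-δ * (ab n).1 - δ * τ * (ab n).2, τ * (ab n).1 + (τ * τ - δ) * (ab n).2) :=
    ⟨fun n => (fun p : ℤ × ℤ => (-δ * p.1 - δ * τ * p.2, τ * p.1 + (τ * τ - δ) * p.2))^[n] (1, 0),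
      rfl, fun n => Function.iterate_succ_apply' _ _ _⟩
  have hcj : ∀ n, cj s y n = y ^ (ab n).1 * z ^ (ab n).2 := by
    intro n
    induction n with
    | zero => simp [cj_zero, h0]
    | succ n ih => rw [cj_succ, ih, hsy, hsucc]
  have hβ := beta_growth (τ * τ - 2 * δ) τ hT hτ (fun n => (ab n).2) (by simp [h0])
    (by simp [hsucc, h0]) (by
      intro n
      simp only [hsucc]
      linear_combination (-(ab n).2) * hδ)
  have key : ∀ l : List Bool, bprod (y * s) s l.reverse =
      y ^ (dig (fun n => (ab n).1) l) * z ^ (dig (fun n => (ab n).2) l) * s ^ l.length := by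
    intro l
    induction l with
    | nil => simp [dig, bprod_nil]
    | cons b l ih =>
      rw [List.reverse_cons, bprod_append, ih, bprod_cons, bprod_nil, mul_one]
      cases b with
      | false => simp [dig, pow_succ, mul_assoc]
      | true =>
        simp only [dig, if_true, cond_true, List.length_cons]
        rw [← hF, ← hcj]
        simp only [cj]
        group
  have hπ : ∀ i j : ℤ, π (y ^ i * z ^ j) = 1 := by
    intro i j; simp [hy, hz]
  intro l l' h
  have e1 := key l.reverse
  have e2 := key l'.reverse
  rw [List.reverse_reverse] at e1 e2
  change bprod _ _ l = bprod _ _ l' at h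
  rw [h, e2] at e1
  have hlen : l'.reverse.length = l.reverse.length := by
    have := congrArg π e1
    rw [map_mul, hπ, map_mul, hπ, one_mul, one_mul, map_pow, map_pow] at this
    have h2 := congrArg Multiplicative.toAdd this
    rw [toAdd_pow, toAdd_pow] at h2
    have h3 : Multiplicative.toAdd (π s) ≠ 0 := fun h => hs (by simpa using h)
    simp only [nsmul_eq_mul] at h2
    exact_mod_cast mul_right_cancel₀ h3 h2
  rw [hlen] at e1
  obtain ⟨ha, hb⟩ := hFi _ _ _ _ (mul_right_cancel e1)
  have := dig_inj _ _ (by simp [h0]) hβ _ _ hlen ha hb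
  exact (List.reverse_injective this).symm

theorem core {G : Type} [Group G] (hL : LocallyIndicable G) (π : G →* Multiplicative ℤ)
    (hc : ∀ g, π g ≠ 1 → ∀ h, π h = 1 → g * h = h * g → h = 1) (t y : G) (ht : π t ≠ 1)
    (hy : π y = 1) (hy1 : y ≠ 1) (c01 : Commute y (cj t y 1)) (c02 : Commute y (cj t y 2))
    (a b c : ℤ) (hne : ¬ (a = 0 ∧ b = 0 ∧ c = 0))
    (hrel : y ^ a * (cj t y 1) ^ b * (cj t y 2) ^ c = 1)
    (hf : ¬ FreeSemi (y * t) t) : FreeSemi (y * t ^ 2) (t ^ 2) := by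
  have htn : ∀ n : ℕ, n ≠ 0 → π (t ^ n) ≠ 1 := by
    intro n hn h
    rw [map_pow] at h
    have h2 := congrArg Multiplicative.toAdd h
    rw [toAdd_pow, toAdd_one, smul_eq_zero] at h2
    rcases h2 with h2 | h2
    · exact hn h2
    · exact ht (by simpa using h2)
  have htz : ∀ n : ℤ, n ≠ 0 → t ^ n ∉ π.ker := by
    intro n hn h
    rw [MonoidHom.mem_ker, map_zpow] at h
    have h2 := congrArg Multiplicative.toAdd h
    rw [toAdd_zpow, toAdd_one, smul_eq_zero] at h2
    rcases h2 with h2 | h2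
    · exact hn h2
    · exact ht (by simpa using h2)
  have hc1 : ∀ w, π w = 1 → t * w * t⁻¹ = w → w = 1 := by
    intro w hw h
    exact hc t ht w hw (mul_inv_eq_iff_eq_mul.1 h)
  have hc2 : ∀ w, π w = 1 → t * w * t⁻¹ = w⁻¹ → w = 1 := by
    intro w hw h
    apply hc (t ^ 2) (htn 2 (by norm_num)) w hw
    rw [← mul_inv_eq_iff_eq_mul]
    have : t ^ 2 * w * (t ^ 2)⁻¹ = t * (t * w * t⁻¹) * t⁻¹ := by rw [pow_two]; group
    rw [this, h, ← conj_inv, h, inv_inv]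
  obtain ⟨C, hCN, hCf, hyC, hCt, m, hCm⟩ := milnor π.ker t y (by
    intro c; rw [MonoidHom.mem_ker, MonoidHom.mem_ker]; simp) htz hy hf
  obtain ⟨f, hfs⟩ := hL C hCf (by
    rintro rfl; exact hy1 (Subgroup.mem_bot.1 hyC))
  have hYC : ∀ i : ℤ, t ^ i * y * (t ^ i)⁻¹ ∈ C := fun i => (normalises_zpow hCt i y).1 hyC
  let u : ℤ → ℤ := fun i => Multiplicative.toAdd (f ⟨_, hYC i⟩)
  have hu : ∃ i, u i ≠ 0 := by
    by_contra hcon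
    push Not at hcon
    have hle : C ≤ f.ker.map C.subtype := by
      conv_lhs => rw [hCm]
      rw [Subgroup.closure_le]
      rintro _ ⟨i, -, rfl⟩
      refine ⟨⟨_, hYC i⟩, ?_, ?_⟩
      · have := hcon i
        exact this
      · simp [cj]
    obtain ⟨g, hg⟩ := hfs (Multiplicative.ofAdd 1)
    obtain ⟨g', hg', e⟩ := hle g.2
    have : g' = g := Subtype.ext e
    subst this
    rw [SetLike.mem_coe, MonoidHom.mem_ker] at hg'
    rw [hg'] at hg
    have := congrArg Multiplicative.toAdd hg
    simp at this
  have hY : ∀ i j : ℤ, t ^ i * (t ^ j * y * (t ^ j)⁻¹) * (t ^ i)⁻¹ =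
      t ^ (i + j) * y * (t ^ (i + j))⁻¹ := by
    intro i j; rw [zpow_add]; group
  have e0 : y = t ^ (0 : ℤ) * y * (t ^ (0 : ℤ))⁻¹ := by simp
  have e1 : cj t y 1 = t ^ (1 : ℤ) * y * (t ^ (1 : ℤ))⁻¹ := by simp [cj]
  have e2 : cj t y 2 = t ^ (2 : ℤ) * y * (t ^ (2 : ℤ))⁻¹ := by simp only [cj]; norm_cast
  have hrelu : ∀ p q r : ℤ, y ^ p * (cj t y 1) ^ q * (cj t y 2) ^ r = 1 →
      ∀ i, p * u i + q * u (i + 1) + r * u (i + 2) = 0 := by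
    intro p q r h i
    have h1 : (t ^ i * y * (t ^ i)⁻¹) ^ p * (t ^ (i + 1) * y * (t ^ (i + 1))⁻¹) ^ q *
        (t ^ (i + 2) * y * (t ^ (i + 2))⁻¹) ^ r = 1 := by
      rw [← hY i 1, ← hY i 2, ← e1, ← e2, conj_zpow, conj_zpow, conj_zpow]
      calc _ = t ^ i * (y ^ p * (cj t y 1) ^ q * (cj t y 2) ^ r) * (t ^ i)⁻¹ := by group
        _ = 1 := by rw [h]; group
    have h2 : (⟨_, hYC i⟩ : C) ^ p * (⟨_, hYC (i + 1)⟩ : C) ^ q * (⟨_, hYC (i + 2)⟩ : C) ^ r = 1 :=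
      Subtype.ext h1
    have h3 := congrArg (fun g => Multiplicative.toAdd (f g)) h2
    simpa [u] using h3
  set z := cj t y 1 with hz
  set z2 := cj t y 2 with hz2
  have hzt : z = t * y * t⁻¹ := by simp [hz, cj]
  have hz2t : z2 = t * z * t⁻¹ := by rw [hz2, cj_succ]
  have hπz : π z = 1 := by rw [hzt]; simp [hy]
  have hz1 : z ≠ 1 := by
    intro h
    rw [h] at hzt
    apply hy1
    have : y = t⁻¹ * (t * y * t⁻¹) * t := by group
    rw [this, ← hzt]; group
  have c12 : Commute z z2 := by
    have : MulAut.conj t y = z := by simp [hzt]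
    have h2 : MulAut.conj t z = z2 := by simp [hz2t]
    rw [← h2]
    conv_lhs => rw [← this]
    exact c01.map (MulAut.conj t)
  have hconj : ∀ i j : ℤ, t * (y ^ i * z ^ j) * t⁻¹ = z ^ i * z2 ^ j := by
    intro i j
    have h1 : z ^ i = t * y ^ i * t⁻¹ := by rw [hzt, conj_zpow]
    have h2 : z2 ^ j = t * z ^ j * t⁻¹ := by rw [hz2t, conj_zpow]
    rw [h1, h2]
    group
  have hπF : ∀ i j : ℤ, π (y ^ i * z ^ j) = 1 := by
    intro i j; simp [hy, hπz]
  have hinj : ∀ p q : ℤ, y ^ p * z ^ q = 1 → p = 0 ∧ q = 0 := by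
    intro p q h
    by_cases hp : p = 0
    · subst hp
      refine ⟨rfl, ?_⟩
      by_contra hq
      rw [zpow_zero, one_mul] at h
      exact hz1 (li_torsionFree hL _ _ h hq)
    by_cases hq : q = 0
    · subst hq
      rw [zpow_zero, mul_one] at h
      exact absurd (li_torsionFree hL _ _ h hp) hy1
    exfalso
    have h1 := hrelu p q 0 (by rw [h]; simp)
    have h2 := seq_abs_eq q (-p) u hu hq (neg_ne_zero.2 hp) (by
      intro i; have := h1 i; linarith)
    have hyp : y ^ p = 1 := by
      rcases abs_eq_abs.1 h2 with h' | h'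
      · apply hc1 _ (by simp [hy])
        rw [← conj_zpow, ← hzt]
        rw [h', zpow_neg] at h
        exact (mul_inv_eq_one.1 h).symm
      · apply hc2 _ (by simp [hy])
        rw [← conj_zpow, ← hzt]
        rw [h', neg_neg] at h
        exact (inv_eq_of_mul_eq_one_right h).symm
    exact hy1 (li_torsionFree hL _ _ hyp hp)
  obtain ⟨a, b, c, hg, hrel⟩ := rel_reduce hL c01 c02 c12 a b c hne hrel
  have hF : ∀ i j k l : ℤ, (y ^ i * z ^ j) * (y ^ k * z ^ l) = y ^ (i + k) * z ^ (j + l) := by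
    intro i j k l
    rw [zpow_add, zpow_add, mul_assoc, ← mul_assoc (z ^ j), (c01.zpow_zpow k j).symm.eq]
    simp only [mul_assoc]
  have hFz : ∀ i j k : ℤ, (y ^ i * z ^ j) ^ k = y ^ (i * k) * z ^ (j * k) := by
    intro i j k
    rw [(c01.zpow_zpow i j).mul_zpow, ← zpow_mul, ← zpow_mul]
  have hc0 : c ≠ 0 := by
    rintro rfl
    rw [zpow_zero, mul_one] at hrel
    obtain ⟨rfl, rfl⟩ := hinj _ _ hrel
    have := hg 0 (dvd_refl _) (dvd_refl _) (dvd_refl _)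
    simp at this
  have ha0 : a ≠ 0 := by
    rintro rfl
    rw [zpow_zero, one_mul, ← hconj] at hrel
    have h1 : y ^ b * z ^ c = 1 := by
      have : y ^ b * z ^ c = t⁻¹ * (t * (y ^ b * z ^ c) * t⁻¹) * t := by group
      rw [this, hrel]; group
    exact hc0 (hinj _ _ h1).2
  have hz2c : z2 ^ c = y ^ (-a) * z ^ (-b) := by
    have h1 : z2 ^ c = (y ^ a * z ^ b)⁻¹ := (inv_eq_of_mul_eq_one_right hrel).symm
    have h2 := hF a b (-a) (-b)
    rw [add_neg_cancel, add_neg_cancel, zpow_zero, zpow_zero, mul_one] at h2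
    rw [h1]
    exact inv_eq_of_mul_eq_one_right h2
  have hs1 : a + b + c ≠ 0 := by
    intro h0
    have h1 : y ^ (-a) * z ^ c = 1 := by
      apply hc1 _ (hπF _ _)
      rw [hconj, hz2c, ← mul_assoc, (c01.zpow_zpow (-a) (-a)).symm.eq, mul_assoc, ← zpow_add]
      congr 2; omega
    exact hc0 (hinj _ _ h1).2
  have hs2 : a - b + c ≠ 0 := by
    intro h0
    have h1 : y ^ a * z ^ c = 1 := by
      apply hc2 _ (hπF _ _)
      rw [hconj, hz2c, ← mul_assoc, (c01.zpow_zpow (-a) a).symm.eq, mul_assoc, ← zpow_add]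
      symm
      apply inv_eq_of_mul_eq_one_right
      rw [hF]
      have : c + (a + -b) = 0 := by omega
      rw [this]; simp
    exact hc0 (hinj _ _ h1).2
  obtain ⟨hcu, hau⟩ := seq_unit a b c u hu ha0 hc0 hg (by
    intro i; have := hrelu a b c hrel i; linarith) hs1 hs2
  obtain ⟨δ, hδ⟩ : ∃ δ, δ = a * c := ⟨_, rfl⟩
  obtain ⟨τ, hτ⟩ : ∃ τ, τ = -b * c := ⟨_, rfl⟩
  have hz2F : z2 = y ^ (-δ) * z ^ τ := by
    have : z2 = (z2 ^ c) ^ c := by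
      rw [← zpow_mul]
      have : c * c = 1 := by rcases hcu with rfl | rfl <;> norm_num
      rw [this, zpow_one]
    rw [this, hz2c, hFz, hδ, hτ]
    congr 2; ring
  have htF : ∀ i j : ℤ, t * (y ^ i * z ^ j) * t⁻¹ = y ^ (-δ * j) * z ^ (i + τ * j) := by
    intro i j
    rw [hconj, hz2F, hFz, ← mul_assoc, (c01.zpow_zpow (-δ * j) i).symm.eq, mul_assoc, ← zpow_add]
  have hδ1 : δ = 1 ∨ δ = -1 := by
    rcases hcu with rfl | rfl <;> rcases hau with rfl | rfl <;> simp [hδ]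
  have hs1' : δ - τ + 1 ≠ 0 := by
    rcases hcu with rfl | rfl <;> omega
  have hs2' : δ + τ + 1 ≠ 0 := by
    rcases hcu with rfl | rfl <;> omega
  have hcjF : ∀ n : ℕ, n ≠ 0 → cj t y n ≠ y := by
    intro n hn h
    apply hy1
    apply hc (t ^ n) (htn n hn) y hy
    exact mul_inv_eq_iff_eq_mul.1 h
  have hyF : y = y ^ (1 : ℤ) * z ^ (0 : ℤ) := by simp
  have hT : 3 ≤ τ * τ - 2 * δ ∧ τ ≠ 0 := by
    rcases hδ1 with rfl | rfl
    · have hτ0 : τ ≠ 0 := by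
        rintro rfl
        apply hcjF 4 (by norm_num)
        conv_lhs => rw [hyF]
        simp only [cj_succ, cj_zero, htF]
        norm_num
      have hτ1 : τ ≠ 1 := by
        rintro rfl
        apply hcjF 6 (by norm_num)
        conv_lhs => rw [hyF]
        simp only [cj_succ, cj_zero, htF]
        norm_num
      have hτ2 : τ ≠ -1 := by
        rintro rfl
        apply hcjF 3 (by norm_num)
        conv_lhs => rw [hyF]
        simp only [cj_succ, cj_zero, htF]
        norm_num
      refine ⟨?_, hτ0⟩
      have : 3 ≤ τ ∨ τ ≤ -3 := by omega
      rcases this with h | h <;> nlinarith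
    · have hτ0 : τ ≠ 0 := by omega
      refine ⟨?_, hτ0⟩
      have : 1 ≤ τ ∨ τ ≤ -1 := by omega
      rcases this with h | h <;> nlinarith
  refine free_matrix π y z (t ^ 2) (htn 2 (by norm_num)) hy hπz c01 hinj τ δ
    (by rcases hδ1 with rfl | rfl <;> norm_num) hT.1 hT.2 ?_
  intro i j
  have : t ^ 2 * (y ^ i * z ^ j) * (t ^ 2)⁻¹ = t * (t * (y ^ i * z ^ j) * t⁻¹) * t⁻¹ := by
    rw [pow_two]; group
  rw [this, htF, htF]
  congr 2 <;> ring


theorem bprod_map {G H : Type} [Group G] [Group H] (f : H →* G) (u v : H) (l : List Bool) :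
    bprod (f u) (f v) l = f (bprod u v l) := by
  induction l with
  | nil => simp [bprod_nil]
  | cons b l ih => rw [bprod_cons, bprod_cons, ih, map_mul]; cases b <;> rfl

theorem freeSemi_map {G H : Type} [Group G] [Group H] (f : H →* G) (hf : Function.Injective f)
    (u v : H) : FreeSemi (f u) (f v) ↔ FreeSemi u v := by
  have : bprod (f u) (f v) = f ∘ bprod u v := funext (bprod_map f u v)
  unfold FreeSemi
  rw [this]
  exact hf.of_comp_iff _

theorem wb_map {G H : Type} [Group G] [Group H] (f : H →* G) {A : Finset G} {B : Finset H}
    (h : ∀ b ∈ B, f b ∈ A) {n : ℕ} {u : H} (hu : u ∈ wordBall B n) : f u ∈ wordBall A n := by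
  obtain ⟨l, h1, h2, rfl⟩ := hu
  refine ⟨l.map f, by simpa using h1, ?_, by rw [map_list_prod]⟩
  intro x hx
  obtain ⟨y, hy, rfl⟩ := List.mem_map.1 hx
  rcases h2 y hy with h' | h'
  · exact Or.inl (h _ h')
  · right; rw [← map_inv]; exact h _ h'

theorem wb_lift {G H : Type} [Group G] [Group H] (f : H →* G) {A : Finset G} {B : Finset H}
    (h : ∀ a ∈ A, ∃ b ∈ B, f b = a) {n : ℕ} {u : G} (hu : u ∈ wordBall A n) :
    ∃ w ∈ wordBall B n, f w = u := by
  obtain ⟨l, h1, h2, rfl⟩ := hu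
  induction l generalizing n with
  | nil => exact ⟨1, ⟨[], by simp, by simp, by simp⟩, by simp⟩
  | cons x l ih =>
    rw [List.length_cons] at h1
    obtain ⟨w, hw, e⟩ := ih (n := l.length) le_rfl (fun y hy => h2 y (List.mem_cons_of_mem _ hy))
    have : ∃ w0 ∈ wordBall B 1, f w0 = x := by
      rcases h2 x List.mem_cons_self with h' | h'
      · obtain ⟨b, hb, e⟩ := h _ h'
        exact ⟨b, wb_gen hb, e⟩
      · obtain ⟨b, hb, e⟩ := h _ h'
        exact ⟨b⁻¹, wb_inv (wb_gen hb), by rw [map_inv, e, inv_inv]⟩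
    obtain ⟨w0, hw0, e0⟩ := this
    exact ⟨w0 * w, wb_mono (by omega) (wb_mul hw0 hw), by rw [map_mul, e0, e, List.prod_cons]⟩

theorem wb_comp {G : Type} [Group G] {A B : Finset G} {k : ℕ} (h : ∀ b ∈ B, b ∈ wordBall A k)
    {n : ℕ} {u : G} (hu : u ∈ wordBall B n) : u ∈ wordBall A (k * n) := by
  obtain ⟨l, h1, h2, rfl⟩ := hu
  apply wb_mono (Nat.mul_le_mul_left k h1)
  clear h1
  induction l with
  | nil => exact ⟨[], by simp, by simp, by simp⟩
  | cons x l ih =>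
    have hx : x ∈ wordBall A k := by
      rcases h2 x List.mem_cons_self with h' | h'
      · exact h _ h'
      · have := wb_inv (h _ h'); rwa [inv_inv] at this
    rw [List.prod_cons, List.length_cons]
    exact wb_mono (by rw [Nat.mul_succ]; omega)
      (wb_mul hx (ih (fun y hy => h2 y (List.mem_cons_of_mem _ hy))))

theorem smallG_map {G H : Type} [Group G] [Group H] (f : H →* G) (hf : Function.Injective f)
    {S : Subgroup H} (hS : SmallG S) : SmallG (S.map f) := by
  rcases hS with rfl | ⟨t, rfl, h⟩ | ⟨a, t, rfl, h, hi⟩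
  · left; simp
  · right; left
    refine ⟨f t, by rw [MonoidHom.map_zpowers], ?_⟩
    intro n hn
    apply h
    apply hf
    rw [map_zpow, hn, map_one]
  · right; right
    refine ⟨f a, f t, ?_, ?_, ?_⟩
    · rw [MonoidHom.map_closure, Set.image_pair]
    · rcases h with h | h
      · left; rw [← map_mul, ← map_inv, ← map_mul, h]
      · right; rw [← map_mul, ← map_inv, ← map_mul, h, map_inv]
    · intro i j hij
      apply hi
      apply hf
      rw [map_mul, map_zpow, map_zpow, hij, map_one]

theorem q_map {G H : Type} [Group G] [Group H] (f : H →* G) (hf : Function.Injective f) {L : ℕ}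
    (hQ : QProp L H) (A : Finset G) (hA : ∀ a ∈ A, a ∈ f.range) :
    SmallG (Subgroup.closure (A : Set G)) ∨
      ∃ u ∈ wordBall A L, ∃ v ∈ wordBall A L, FreeSemi u v := by
  classical
  let B := A.preimage f hf.injOn
  have hB : ∀ b ∈ B, f b ∈ A := fun b hb => Finset.mem_preimage.1 hb
  have hBA : f '' (B : Set H) = A := by
    ext a
    constructor
    · rintro ⟨b, hb, rfl⟩
      exact hB b hb
    · intro ha
      obtain ⟨b, rfl⟩ := hA a ha
      exact ⟨b, Finset.mem_preimage.2 ha, rfl⟩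
  rcases hQ B with h | ⟨u, hu, v, hv, h⟩
  · left
    have := smallG_map f hf h
    rwa [MonoidHom.map_closure, hBA] at this
  · right
    exact ⟨f u, wb_map f hB hu, f v, wb_map f hB hv, (freeSemi_map f hf u v).2 h⟩

theorem pair_pow {G : Type} [Group G] {a t : G} (h : t * a * t⁻¹ = a ∨ t * a * t⁻¹ = a⁻¹) (j : ℤ) :
    (∀ i : ℤ, t ^ j * a ^ i = a ^ i * t ^ j) ∨ (∀ i : ℤ, t ^ j * a ^ i = a ^ (-i) * t ^ j) := by
  have := pm_closure (c := a) (A := {t}) (by simpa using h) (t ^ j)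
    (Subgroup.zpow_mem _ (Subgroup.subset_closure (by simp)) _)
  rcases this with h | h
  · left
    intro i
    rw [← mul_inv_eq_iff_eq_mul, ← conj_zpow, h]
  · right
    intro i
    rw [← mul_inv_eq_iff_eq_mul, ← conj_zpow, h, inv_zpow, zpow_neg]

theorem pair_nf {G : Type} [Group G] {a t : G} (h : t * a * t⁻¹ = a ∨ t * a * t⁻¹ = a⁻¹) :
    ∀ g ∈ Subgroup.closure ({a, t} : Set G), ∃ i j : ℤ, g = a ^ i * t ^ j := by
  intro g hg
  induction hg using Subgroup.closure_induction with
  | mem x hx =>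
    rcases hx with rfl | rfl
    · exact ⟨1, 0, by simp⟩
    · exact ⟨0, 1, by simp⟩
  | one => exact ⟨0, 0, by simp⟩
  | mul x y _ _ hx hy =>
    obtain ⟨i, j, rfl⟩ := hx
    obtain ⟨k, l, rfl⟩ := hy
    rcases pair_pow h j with h | h
    · refine ⟨i + k, j + l, ?_⟩
      rw [mul_assoc, ← mul_assoc (t ^ j), h, zpow_add, zpow_add]; simp only [mul_assoc]
    · refine ⟨i + -k, j + l, ?_⟩
      rw [mul_assoc, ← mul_assoc (t ^ j), h, zpow_add, zpow_add]; simp only [mul_assoc]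
  | inv x _ hx =>
    obtain ⟨i, j, rfl⟩ := hx
    rw [mul_inv_rev, ← zpow_neg, ← zpow_neg]
    rcases pair_pow h (-j) with h | h
    · exact ⟨_, _, h _⟩
    · exact ⟨_, _, h _⟩

theorem small_sq {G : Type} [Group G] {S : Subgroup G} (hS : SmallG S) :
    ∃ p q : G, Commute p q ∧ ∀ g ∈ S, ∃ m n : ℤ, g * g = p ^ m * q ^ n := by
  rcases hS with rfl | ⟨t, rfl, h⟩ | ⟨a, t, rfl, h, hi⟩
  · refine ⟨1, 1, Commute.refl _, ?_⟩
    intro g hg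
    rw [Subgroup.mem_bot.1 hg]
    exact ⟨0, 0, by simp⟩
  · refine ⟨t, t, Commute.refl _, ?_⟩
    rintro _ ⟨k, rfl⟩
    exact ⟨k, k, rfl⟩
  · refine ⟨a, t ^ (2 : ℤ), ?_, ?_⟩
    · have h2 : t ^ (2 : ℤ) = t * t := by rw [zpow_two]
      have : t * t * a * (t * t)⁻¹ = a := by
        have e : t * t * a * (t * t)⁻¹ = t * (t * a * t⁻¹) * t⁻¹ := by group
        rw [e]
        rcases h with h | h
        · rw [h, h]
        · rw [h, ← conj_inv, h, inv_inv]
      rw [h2]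
      exact (mul_inv_eq_iff_eq_mul.1 this).symm
    · intro g hg
      obtain ⟨i, j, rfl⟩ := pair_nf h g hg
      rcases pair_pow h j with h | h
      · refine ⟨i + i, j, ?_⟩
        rw [mul_assoc, ← mul_assoc (t ^ j), h, zpow_add, ← zpow_mul, two_mul, zpow_add]
        simp only [mul_assoc]
      · refine ⟨i + -i, j, ?_⟩
        rw [mul_assoc, ← mul_assoc (t ^ j), h, zpow_add, ← zpow_mul, two_mul, zpow_add]
        simp only [mul_assoc]

theorem int_dep (m n : Fin 3 → ℤ) : ∃ a b c : ℤ, ¬ (a = 0 ∧ b = 0 ∧ c = 0) ∧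
    a * m 0 + b * m 1 + c * m 2 = 0 ∧ a * n 0 + b * n 1 + c * n 2 = 0 := by
  obtain ⟨v, hv, h⟩ := (Matrix.exists_vecMul_eq_zero_iff
    (M := !![m 0, n 0, 0; m 1, n 1, 0; m 2, n 2, 0])).2 (by simp [Matrix.det_fin_three])
  refine ⟨v 0, v 1, v 2, ?_, ?_, ?_⟩
  · rintro ⟨h0, h1, h2⟩
    apply hv
    ext i
    fin_cases i <;> simp [h0, h1, h2]
  · have := congrFun h 0
    simpa [Matrix.vecMul, dotProduct, Fin.sum_univ_three] using this
  · have := congrFun h 1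
    simpa [Matrix.vecMul, dotProduct, Fin.sum_univ_three] using this

theorem q_step {G : Type} [Group G] (hL : LocallyIndicable G) (π : G →* Multiplicative ℤ)
    (hc : ∀ g, π g ≠ 1 → ∀ h, π h = 1 → g * h = h * g → h = 1) {L : ℕ} (hQ : QProp L π.ker) :
    QProp (8 * L + 20) G := by
  classical
  intro A
  by_cases hA : ∀ a ∈ A, π a = 1
  · rcases q_map π.ker.subtype π.ker.subtype_injective hQ A (by
      intro a ha; rw [Subgroup.range_subtype]; exact hA a ha) with h | ⟨u, hu, v, hv, h⟩
    · exact Or.inl h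
    · exact Or.inr ⟨u, wb_mono (by omega) hu, v, wb_mono (by omega) hv, h⟩
  push Not at hA
  obtain ⟨t, htA, ht⟩ := hA
  by_cases hab : ∀ a ∈ A, ∀ b ∈ A, a * b = b * a
  · left
    have hcomm : ∀ g ∈ Subgroup.closure (A : Set G), t * g = g * t := by
      have : Subgroup.closure (A : Set G) ≤ Subgroup.centralizer {t} := by
        rw [Subgroup.closure_le]
        intro a ha
        rw [SetLike.mem_coe, Subgroup.mem_centralizer_singleton_iff]
        exact hab _ ha _ htA
      intro g hg
      exact (Subgroup.mem_centralizer_singleton_iff.1 (this hg)).symm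
    have hinj : Function.Injective (π.comp (Subgroup.closure (A : Set G)).subtype) := by
      rw [injective_iff_map_eq_one]
      intro g hg
      exact Subtype.ext (hc t ht g hg (hcomm g g.2))
    have := isCyclic_of_injective _ hinj
    obtain ⟨s, hs⟩ := this.exists_generator
    have hS : Subgroup.closure (A : Set G) = Subgroup.zpowers (s : G) := by
      apply le_antisymm
      · intro g hg
        obtain ⟨k, hk⟩ := hs ⟨g, hg⟩
        exact ⟨k, congrArg Subtype.val hk⟩
      · rw [Subgroup.zpowers_le]; exact s.2
    right; left
    refine ⟨s, hS, ?_⟩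
    intro n hn
    by_contra hn0
    have h1 := li_torsionFree hL _ _ hn hn0
    have h2 : t ∈ Subgroup.closure (A : Set G) := Subgroup.subset_closure htA
    rw [hS, h1, Subgroup.zpowers_one_eq_bot] at h2
    rw [Subgroup.mem_bot.1 h2, map_one] at ht
    exact ht rfl
  push Not at hab
  obtain ⟨a, ha, b, hb, hab⟩ := hab
  set x := a * b * a⁻¹ * b⁻¹ with hx
  have hxA : x ∈ wordBall A 4 := wb_comm (wb_gen ha) (wb_gen hb)
  have hx1 : x ≠ 1 := by
    intro h
    rw [hx, mul_inv_eq_one, mul_inv_eq_iff_eq_mul] at h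
    exact hab h
  have hπx : π x = 1 := by
    rw [hx, map_mul, map_mul, map_mul, map_inv, map_inv, mul_comm (π a), mul_assoc (π b)]; simp
  have hπcj : ∀ i, π (cj t x i) = 1 := by
    intro i; simp [cj, hπx]
  have htb : t ∈ wordBall A 1 := wb_gen htA
  have hx1b : cj t x 1 ∈ wordBall A 8 := by
    rw [cj_succ, cj_zero]
    exact wb_mono (by omega) (wb_mul (wb_mul htb hxA) (wb_inv htb))
  have hx2b : cj t x 2 ∈ wordBall A 8 := by
    rw [cj_succ, cj_succ, cj_zero]
    exact wb_mono (by omega) (wb_mul (wb_mul htb (wb_mul (wb_mul htb hxA) (wb_inv htb)))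
      (wb_inv htb))
  rcases q_map π.ker.subtype π.ker.subtype_injective hQ {cj t x 0, cj t x 1, cj t x 2} (by
      intro a ha
      rw [Subgroup.range_subtype, MonoidHom.mem_ker]
      simp only [Finset.mem_insert, Finset.mem_singleton] at ha
      rcases ha with rfl | rfl | rfl <;> exact hπcj _) with h | ⟨u, hu, v, hv, h⟩
  swap
  · right
    have hB : ∀ g ∈ ({cj t x 0, cj t x 1, cj t x 2} : Finset G), g ∈ wordBall A 8 := by
      intro a ha
      simp only [Finset.mem_insert, Finset.mem_singleton] at ha
      rcases ha with rfl | rfl | rfl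
      · rw [cj_zero]; exact wb_mono (by omega) hxA
      · exact hx1b
      · exact hx2b
    exact ⟨u, wb_mono (by omega) (wb_comp hB hu), v, wb_mono (by omega) (wb_comp hB hv), h⟩
  right
  obtain ⟨p, q, hpq, hsq⟩ := small_sq h
  have hmem : ∀ i : Fin 3, ∃ m n : ℤ, cj t (x * x) i = p ^ m * q ^ n := by
    intro i
    have e : cj t (x * x) i = cj t x i * cj t x i := by simp only [cj]; group
    rw [e]
    apply hsq
    apply Subgroup.subset_closure
    fin_cases i <;> simp
  choose m n hmn using hmem
  have hcom : ∀ i j : Fin 3, Commute (cj t (x * x) i) (cj t (x * x) j) := by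
    intro i j
    rw [hmn, hmn]
    exact ((Commute.refl p).zpow_zpow _ _ |>.mul_right (hpq.zpow_zpow _ _)).mul_left
      ((hpq.symm.zpow_zpow _ _).mul_right ((Commute.refl q).zpow_zpow _ _))
  obtain ⟨r0, r1, r2, hr, hrm, hrn⟩ := int_dep m n
  have hpz : ∀ i j k : ℤ, (p ^ i * q ^ j) ^ k = p ^ (k * i) * q ^ (k * j) := by
    intro i j k
    rw [(hpq.zpow_zpow i j).mul_zpow, ← zpow_mul, ← zpow_mul, mul_comm i, mul_comm j]
  have hpm : ∀ i j k l : ℤ, (p ^ i * q ^ j) * (p ^ k * q ^ l) = p ^ (i + k) * q ^ (j + l) := by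
    intro i j k l
    rw [zpow_add, zpow_add, mul_assoc, ← mul_assoc (q ^ j), (hpq.zpow_zpow k j).symm.eq]
    simp only [mul_assoc]
  have hrel : (x * x) ^ r0 * (cj t (x * x) 1) ^ r1 * (cj t (x * x) 2) ^ r2 = 1 := by
    have h0 := hmn 0
    have h1 := hmn 1
    have h2 := hmn 2
    simp only [Fin.val_zero, Fin.val_one, Fin.val_two, cj_zero] at h0 h1 h2
    rw [h1, h2, h0, hpz, hpz, hpz, hpm, hpm, hrm, hrn]; simp
  have hy1 : x * x ≠ 1 := by
    intro h
    exact hx1 (li_torsionFree hL x 2 (by rw [zpow_two, h]) (by norm_num))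
  have hyA := wb_mul hxA hxA
  by_cases hf : FreeSemi ((x * x) * t) t
  · exact ⟨_, wb_mono (by omega) (wb_mul hyA htb), _, wb_mono (by omega) htb, hf⟩
  · have h01 := hcom 0 1
    have h02 := hcom 0 2
    simp only [Fin.val_zero, Fin.val_one, Fin.val_two, cj_zero] at h01 h02
    have := core hL π hc t (x * x) ht (by simp [hπx]) hy1 h01 h02 r0 r1 r2 hr hrel hf
    have ht2 : t ^ 2 ∈ wordBall A 2 := by rw [pow_two]; exact wb_mul htb htb
    exact ⟨_, wb_mono (by omega) (wb_mul hyA ht2), _, wb_mono (by omega) ht2, this⟩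


theorem li_ext {G : Type} [Group G] (π : G →* Multiplicative ℤ) (hk : LocallyIndicable π.ker) :
    LocallyIndicable G := by
  intro E hE hne
  by_cases h : ∀ e ∈ E, π e = 1
  · have hle : E ≤ π.ker := h
    let eq := Subgroup.subgroupOfEquivOfLe hle
    have : Group.FG E := (Group.fg_iff_subgroup_fg E).2 hE
    have hfg : Group.FG (E.subgroupOf π.ker) :=
      Group.fg_of_surjective (f := eq.symm.toMonoidHom) eq.symm.surjective
    obtain ⟨f, hf⟩ := hk _ ((Group.fg_iff_subgroup_fg _).1 hfg) (by
      intro h0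
      apply hne
      rw [Subgroup.subgroupOf_eq_bot, disjoint_iff, inf_eq_left.2 hle] at h0
      exact h0)
    exact ⟨f.comp eq.symm.toMonoidHom, hf.comp eq.symm.surjective⟩
  · push Not at h
    obtain ⟨e, he, hπ⟩ := h
    let g := π.comp E.subtype
    have hcyc : IsCyclic g.range := inferInstance
    have hinf : Infinite g.range := by
      apply Infinite.of_injective (fun n : ℤ => (⟨g ⟨e, he⟩, ⟨_, rfl⟩⟩ : g.range) ^ n)
      intro m n hmn
      have h1 := congrArg (fun z : g.range => Multiplicative.toAdd (z : Multiplicative ℤ)) hmn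
      simp only [Subgroup.coe_zpow, toAdd_zpow] at h1
      have h3 : Multiplicative.toAdd (g ⟨e, he⟩) ≠ 0 := fun h => hπ (toAdd_eq_zero.1 h)
      simp only [smul_eq_mul] at h1
      exact mul_right_cancel₀ h3 h1
    have e1 := zmodCyclicMulEquiv hcyc
    rw [Nat.card_eq_zero_of_infinite] at e1
    let e2 : Multiplicative ℤ ≃* g.range := e1
    exact ⟨e2.symm.toMonoidHom.comp g.rangeRestrict,
      e2.symm.surjective.comp g.rangeRestrict_surjective⟩

def Lc : ℕ → ℕ
  | 0 => 40
  | n + 1 => 8 * Lc n + 20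

theorem hnn_step {G H : Type} [Group G] [Group H] (α : MulAut H)
    (hα : ¬ HasPeriodicConjugacyClass α) (e : G ≃* zSemidirect H α) (hL : LocallyIndicable H)
    {L : ℕ} (hQ : QProp L H) : LocallyIndicable G ∧ QProp (8 * L + 20) G := by
  let π : G →* Multiplicative ℤ := SemidirectProduct.rightHom.comp e.toMonoidHom
  have hπ : ∀ g, π g = (e g).right := fun g => rfl
  let f : H →* π.ker := (e.symm.toMonoidHom.comp SemidirectProduct.inl).codRestrict π.ker (by
    intro h
    rw [MonoidHom.mem_ker, hπ]
    simp)
  have hfv : ∀ h, ((f h : π.ker) : G) = e.symm (SemidirectProduct.inl h) := fun h => rfl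
  have hfi : Function.Injective f := by
    intro a b hab
    have := congrArg Subtype.val hab
    rw [hfv, hfv] at this
    exact SemidirectProduct.inl_injective (e.symm.injective this)
  have hfs : Function.Surjective f := by
    intro g
    refine ⟨(e g).left, ?_⟩
    apply Subtype.ext
    rw [hfv]
    apply e.injective
    rw [MulEquiv.apply_symm_apply]
    have : (e g).right = 1 := g.2
    ext
    · simp
    · simp [this]
  have hLk : LocallyIndicable π.ker := li_equiv (MulEquiv.ofBijective f ⟨hfi, hfs⟩) hL
  have hLG := li_ext π hLk
  refine ⟨hLG, q_step hLG π ?_ ?_⟩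
  · intro g hg h hh hgh
    by_contra hne
    apply hα
    have h1 := congrArg (fun z => (e z).left) hgh
    simp only [map_mul, SemidirectProduct.mul_left] at h1
    rw [hπ] at hg hh
    rw [hh] at h1
    refine ⟨(e h).left, Multiplicative.toAdd (e g).right, (e g).left⁻¹, ?_, ?_, ?_⟩
    · intro h0
      apply hne
      apply e.injective
      ext
      · simp [h0]
      · simp [hh]
    · intro h0
      exact hg (by simpa using h0)
    · have h2 : zAction α (e g).right (e h).left = (α ^ Multiplicative.toAdd (e g).right) (e h).left :=
        rfl
      rw [h2] at h1
      rw [map_one, MulAut.one_apply] at h1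
      rw [inv_inv, mul_assoc, ← h1]; group
  · intro A
    exact q_map f hfi hQ A (fun a _ => by rw [MonoidHom.range_eq_top.2 hfs]; trivial)

theorem hnn_all {K : Type} [Group K] (hK : IsCoherent K) (hL : LocallyIndicable K)
    (h2 : CohDimLE2 K) : ∀ n (G : Type) (gi : Group G), IsIteratedHNN K n G gi →
    @LocallyIndicable G gi ∧ @QProp (Lc n) G gi := by
  intro n
  induction n with
  | zero =>
    intro G gi h
    obtain ⟨e⟩ : Nonempty (K ≃* G) := h
    refine ⟨li_equiv e hL, ?_⟩
    intro A
    exact q_map e.toMonoidHom e.injective (base_case hK hL (van3_of_cohDim h2)) A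
      (fun a _ => ⟨e.symm a, by simp⟩)
  | succ n ih =>
    intro G gi h
    obtain ⟨H, hi, hH, α, hα, ⟨e⟩⟩ := h
    obtain ⟨h1, h2⟩ := ih H hi hH
    exact hnn_step α hα e h1 h2


open scoped Pointwise in
theorem wb_card {G : Type} [Group G] (A : Finset G) :
    ∃ c : ℕ, 1 ≤ c ∧ ∀ n, (wordBall A n).Finite ∧ (wordBall A n).ncard ≤ c ^ n := by
  classical
  let X : Finset G := insert 1 (A ∪ A⁻¹)
  have h1 : (1 : G) ∈ X := Finset.mem_insert_self _ _
  have hsub : ∀ n, wordBall A n ⊆ ((X ^ n : Finset G) : Set G) := by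
    rintro n _ ⟨l, hl, hA, rfl⟩
    have : l.prod ∈ X ^ l.length := by
      clear hl
      induction l with
      | nil => simp
      | cons x l ih =>
        rw [List.prod_cons, List.length_cons, pow_succ']
        apply Finset.mul_mem_mul
        · have := hA x List.mem_cons_self
          simp only [X, Finset.mem_insert, Finset.mem_union, Finset.mem_inv']
          exact Or.inr this
        · exact ih (fun y hy => hA y (List.mem_cons_of_mem _ hy))
    exact Finset.pow_subset_pow_right h1 hl this
  refine ⟨X.card, Finset.card_pos.2 ⟨1, h1⟩, ?_⟩
  intro n
  refine ⟨(Finset.finite_toSet _).subset (hsub n), ?_⟩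
  have h2 := Set.ncard_le_ncard (hsub n) (Finset.finite_toSet _)
  rw [Set.ncard_coe_finset] at h2
  exact h2.trans Finset.card_pow_le

theorem bprod_mem {G : Type} [Group G] {A : Finset G} {L : ℕ} {u v : G} (hu : u ∈ wordBall A L)
    (hv : v ∈ wordBall A L) (l : List Bool) : bprod u v l ∈ wordBall A (L * l.length) := by
  induction l with
  | nil => exact ⟨[], by simp, by simp, by simp [bprod_nil]⟩
  | cons b l ih =>
    rw [bprod_cons, List.length_cons, Nat.mul_succ, add_comm]
    apply wb_mul _ ih
    cases b
    · exact hv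
    · exact hu

theorem growth_lower {G : Type} [Group G] {A : Finset G} {L : ℕ} (hL : 0 < L) {u v : G}
    (hu : u ∈ wordBall A L) (hv : v ∈ wordBall A L) (hf : FreeSemi u v) :
    (2 : ℝ) ^ (1 / (L : ℝ)) ≤ growthRate A := by
  obtain ⟨c, hc, hball⟩ := wb_card A
  have hlow : ∀ m : ℕ, 2 ^ m ≤ (wordBall A (L * m)).ncard := by
    intro m
    have hinj : Function.Injective (fun b : Fin m → Bool => bprod u v (List.ofFn b)) :=
      hf.comp List.ofFn_injective
    have h1 : Set.range (fun b : Fin m → Bool => bprod u v (List.ofFn b)) ⊆ wordBall A (L * m) := by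
      rintro _ ⟨b, rfl⟩
      have := bprod_mem hu hv (List.ofFn b)
      rwa [List.length_ofFn] at this
    have h2 := Set.ncard_le_ncard h1 (hball _).1
    rw [Set.ncard_range_of_injective hinj] at h2
    simpa using h2
  unfold growthRate
  apply Filter.le_limsup_of_frequently_le
  · rw [Filter.frequently_atTop]
    intro N
    refine ⟨L * (N + 1), by nlinarith, ?_⟩
    have h1 : ((2 : ℝ) ^ (N + 1)) ≤ ((wordBall A (L * (N + 1))).ncard : ℝ) := by
      exact_mod_cast hlow (N + 1)
    have h2 : (2 : ℝ) ^ (1 / (L : ℝ)) =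
        ((2 : ℝ) ^ (N + 1)) ^ (1 / ((L * (N + 1) : ℕ) : ℝ)) := by
      rw [← Real.rpow_natCast, ← Real.rpow_mul (by norm_num)]
      congr 1
      have : (L : ℝ) ≠ 0 := by positivity
      push_cast
      have : (N : ℝ) + 1 ≠ 0 := by positivity
      field_simp
    rw [h2]
    exact Real.rpow_le_rpow (by positivity) h1 (by positivity)
  · refine Filter.isBoundedUnder_of ⟨(c : ℝ), ?_⟩
    intro n
    have hc' : (1 : ℝ) ≤ c := by exact_mod_cast hc
    rcases Nat.eq_zero_or_pos n with rfl | hn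
    · simpa using hc'
    · have h1 : ((wordBall A n).ncard : ℝ) ≤ (c : ℝ) ^ n := by exact_mod_cast (hball n).2
      calc ((wordBall A n).ncard : ℝ) ^ (1 / (n : ℝ)) ≤ ((c : ℝ) ^ n) ^ (1 / (n : ℝ)) :=
            Real.rpow_le_rpow (by positivity) h1 (by positivity)
        _ = c := by
            rw [← Real.rpow_natCast, ← Real.rpow_mul (by positivity)]
            have : (n : ℝ) ≠ 0 := by positivity
            rw [mul_one_div_cancel this, Real.rpow_one]

theorem iso_z2 {G : Type} [Group G] {a t : G} (h : t * a * t⁻¹ = a)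
    (hi : ∀ i j : ℤ, a ^ i * t ^ j = 1 → i = 0 ∧ j = 0) :
    Nonempty (Subgroup.closure ({a, t} : Set G) ≃* Multiplicative (Fin 2 → ℤ)) := by
  have hc : Commute a t := (mul_inv_eq_iff_eq_mul.1 h).symm
  have hF : ∀ i j k l : ℤ, (a ^ i * t ^ j) * (a ^ k * t ^ l) = a ^ (i + k) * t ^ (j + l) := by
    intro i j k l
    rw [zpow_add, zpow_add, mul_assoc, ← mul_assoc (t ^ j), (hc.zpow_zpow k j).symm.eq]
    simp only [mul_assoc]
  have ha : a ∈ Subgroup.closure ({a, t} : Set G) := Subgroup.subset_closure (by simp)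
  have ht : t ∈ Subgroup.closure ({a, t} : Set G) := Subgroup.subset_closure (by simp)
  let f : Multiplicative (Fin 2 → ℤ) →* Subgroup.closure ({a, t} : Set G) :=
    { toFun := fun v => ⟨a ^ (Multiplicative.toAdd v 0) * t ^ (Multiplicative.toAdd v 1),
        mul_mem (zpow_mem ha _) (zpow_mem ht _)⟩
      map_one' := by apply Subtype.ext; simp
      map_mul' := by
        intro v w
        apply Subtype.ext
        simp only [Subgroup.coe_mul, toAdd_mul, Pi.add_apply, hF] }
  refine ⟨(MulEquiv.ofBijective f ⟨?_, ?_⟩).symm⟩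
  · rw [injective_iff_map_eq_one]
    intro v hv
    have := congrArg Subtype.val hv
    obtain ⟨h0, h1⟩ := hi _ _ this
    apply Multiplicative.toAdd.injective
    funext i
    fin_cases i
    · exact h0
    · exact h1
  · rintro ⟨g, hg⟩
    obtain ⟨i, j, rfl⟩ := pair_nf (Or.inl h) g hg
    exact ⟨Multiplicative.ofAdd ![i, j], by apply Subtype.ext; simp [f]⟩

theorem iso_z1 {G : Type} [Group G] {t : G} (h : ∀ n : ℤ, t ^ n = 1 → n = 0) :
    Nonempty (Subgroup.zpowers t ≃* Multiplicative (Fin 1 → ℤ)) := by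
  let f : Multiplicative (Fin 1 → ℤ) →* Subgroup.zpowers t :=
    { toFun := fun v => ⟨t ^ (Multiplicative.toAdd v 0), _, rfl⟩
      map_one' := by apply Subtype.ext; simp
      map_mul' := by
        intro v w
        apply Subtype.ext
        simp only [Subgroup.coe_mul, toAdd_mul, Pi.add_apply, zpow_add] }
  refine ⟨(MulEquiv.ofBijective f ⟨?_, ?_⟩).symm⟩
  · rw [injective_iff_map_eq_one]
    intro v hv
    have := congrArg Subtype.val hv
    have h0 := h _ this
    apply Multiplicative.toAdd.injective
    funext i
    fin_cases i
    exact h0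
  · rintro ⟨_, i, rfl⟩
    exact ⟨Multiplicative.ofAdd ![i], by apply Subtype.ext; simp [f]⟩

theorem iso_z0 {G : Type} [Group G] :
    Nonempty ((⊥ : Subgroup G) ≃* Multiplicative (Fin 0 → ℤ)) := by
  refine ⟨MulEquiv.mk' (Equiv.ofUnique _ _) ?_⟩
  intro x y
  apply Subsingleton.elim

theorem iso_klein {G : Type} [Group G] {a t : G} (h : t * a * t⁻¹ = a⁻¹)
    (hi : ∀ i j : ℤ, a ^ i * t ^ j = 1 → i = 0 ∧ j = 0) :
    Nonempty (Subgroup.closure ({a, t} : Set G) ≃* KleinBottleGroup) := by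
  have ha : a ∈ Subgroup.closure ({a, t} : Set G) := Subgroup.subset_closure (by simp)
  have ht : t ∈ Subgroup.closure ({a, t} : Set G) := Subgroup.subset_closure (by simp)
  let g : Fin 2 → Subgroup.closure ({a, t} : Set G) := ![⟨a, ha⟩, ⟨t, ht⟩]
  have hg : ∀ r ∈ kleinBottleRels, FreeGroup.lift g r = 1 := by
    intro r hr
    rw [Set.mem_singleton_iff.1 hr]
    apply Subtype.ext
    simp [g, h]
  let f : KleinBottleGroup →* Subgroup.closure ({a, t} : Set G) := PresentedGroup.toGroup hg
  let A : KleinBottleGroup := PresentedGroup.of 0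
  let T : KleinBottleGroup := PresentedGroup.of 1
  have hfA : f A = ⟨a, ha⟩ := PresentedGroup.toGroup.of hg
  have hfT : f T = ⟨t, ht⟩ := PresentedGroup.toGroup.of hg
  have hAT : T * A * T⁻¹ = A⁻¹ := by
    rw [eq_inv_iff_mul_eq_one]
    exact PresentedGroup.one_of_mem (rels := kleinBottleRels) (Set.mem_singleton _)
  have htop : Subgroup.closure ({A, T} : Set KleinBottleGroup) = ⊤ := by
    rw [← PresentedGroup.closure_range_of kleinBottleRels]
    congr 1
    ext x
    constructor
    · rintro (rfl | rfl)
      · exact ⟨0, rfl⟩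
      · exact ⟨1, rfl⟩
    · rintro ⟨i, rfl⟩
      fin_cases i
      · left; rfl
      · right; rfl
  have hnf : ∀ x : KleinBottleGroup, ∃ i j : ℤ, x = A ^ i * T ^ j := fun x =>
    pair_nf (Or.inr hAT) x (by rw [htop]; trivial)
  refine ⟨(MulEquiv.ofBijective f ⟨?_, ?_⟩).symm⟩
  · rw [injective_iff_map_eq_one]
    intro x hx
    obtain ⟨i, j, rfl⟩ := hnf x
    rw [map_mul, map_zpow, map_zpow, hfA, hfT] at hx
    obtain ⟨rfl, rfl⟩ := hi i j (congrArg Subtype.val hx)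
    simp
  · rintro ⟨x, hx⟩
    obtain ⟨i, j, rfl⟩ := pair_nf (Or.inr h) x hx
    refine ⟨A ^ i * T ^ j, ?_⟩
    rw [map_mul, map_zpow, map_zpow, hfA, hfT]
    rfl

theorem small_iso {G : Type} [Group G] {S : Subgroup G} (hS : SmallG S) :
    (∃ m : ℕ, m ≤ 2 ∧ Nonempty (↥S ≃* Multiplicative (Fin m → ℤ))) ∨
        Nonempty (↥S ≃* KleinBottleGroup) := by
  rcases hS with rfl | ⟨t, rfl, h⟩ | ⟨a, t, rfl, h | h, hi⟩
  · exact Or.inl ⟨0, by norm_num, iso_z0⟩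
  · exact Or.inl ⟨1, by norm_num, iso_z1 h⟩
  · exact Or.inl ⟨2, le_rfl, iso_z2 h hi⟩
  · exact Or.inr (iso_klein h hi)

theorem Lc_pos : ∀ n, 0 < Lc n
  | 0 => by simp [Lc]
  | n + 1 => by simp [Lc]

theorem final {G : Type} [Group G] {L : ℕ} (hL : 0 < L) (hQ : QProp L G) (S : Subgroup G)
    (hS : S.FG) : (2 : ℝ) ^ (1 / (L : ℝ)) ≤ growthOmega ↥S ∨
        (∃ m : ℕ, m ≤ 2 ∧ Nonempty (↥S ≃* Multiplicative (Fin m → ℤ))) ∨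
        Nonempty (↥S ≃* KleinBottleGroup) := by
  classical
  by_cases hsm : SmallG S
  · exact Or.inr (small_iso hsm)
  left
  apply le_csInf
  · have := (Group.fg_iff_subgroup_fg S).2 hS
    obtain ⟨A, hA⟩ := Group.fg_def.1 this
    exact ⟨_, A, hA, rfl⟩
  · rintro _ ⟨A, hA, rfl⟩
    have hcl : Subgroup.closure ((A.image S.subtype : Finset G) : Set G) = S := by
      rw [Finset.coe_image, ← MonoidHom.map_closure, hA, ← MonoidHom.range_eq_map,
        Subgroup.range_subtype]
    rcases hQ (A.image S.subtype) with h | ⟨u, hu, v, hv, h⟩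
    · rw [hcl] at h
      exact absurd h hsm
    · have hlift : ∀ a ∈ A.image S.subtype, ∃ b ∈ A, S.subtype b = a := fun a ha =>
        Finset.mem_image.1 ha
      obtain ⟨u', hu', rfl⟩ := wb_lift S.subtype hlift hu
      obtain ⟨v', hv', rfl⟩ := wb_lift S.subtype hlift hv
      exact growth_lower hL hu' hv' ((freeSemi_map _ S.subtype_injective _ _).1 h)

/-- For every `n : ℕ` there is `k > 1` such that: if `K` is a finitely
generated coherent locally indicable group of cohomological dimension at most 2, and `G`
is obtained from `K` by an iterated sequence of `n` non-proper HNN extensions whose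
automorphisms all have no periodic conjugacy classes, then every finitely generated
subgroup `S` of `G` satisfies `ω(S) ≥ k`, or `S ≅ ℤᵐ` for some `m ≤ 2`, or `S` is the
Klein bottle group. -/
theorem statement16 (n : ℕ) :
    ∃ k : ℝ, 1 < k ∧
      ∀ (K : Type) [Group K], Group.FG K → IsCoherent K → LocallyIndicable K →
        CohDimLE2 K →
      ∀ (G : Type) [inst : Group G], IsIteratedHNN K n G inst →
      ∀ S : Subgroup G, S.FG →
        k ≤ growthOmega ↥S ∨
        (∃ m : ℕ, m ≤ 2 ∧ Nonempty (↥S ≃* Multiplicative (Fin m → ℤ))) ∨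
        Nonempty (↥S ≃* KleinBottleGroup) := by
  refine ⟨(2 : ℝ) ^ (1 / (Lc n : ℝ)), ?_, ?_⟩
  · have := Lc_pos n
    exact Real.one_lt_rpow (by norm_num) (by positivity)
  · intro K _ _ hK hL h2 G inst hG S hS
    exact final (Lc_pos n) (hnn_all hK hL h2 n G inst hG).2 S hS
end

section
/- Let n be an integer with n ≠ 0, 1, −1 and let B = BS(1,n) be the Baumslag–Solitar group with presentation ⟨a, t | t a t⁻¹ = aⁿ⟩. Then every finitely generated subgroup H of B is trivial, infinite cyclic, or satisfies ω(H) ≥ 2^{1/4}. -/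
open Filter

/-- The single relator `t aᵐ t⁻¹ a⁻ⁿ` of the Baumslag–Solitar group
`BS(m,n) = ⟨a, t | t aᵐ t⁻¹ = aⁿ⟩`, with generator `0` as `a` and `1` as `t`. -/
def bsRels (m n : ℤ) : Set (FreeGroup (Fin 2)) :=
  {FreeGroup.of 1 * (FreeGroup.of 0) ^ m * (FreeGroup.of 1)⁻¹ * ((FreeGroup.of 0) ^ n)⁻¹}

/-- The Baumslag–Solitar group `BS(m,n) = ⟨a, t | t aᵐ t⁻¹ = aⁿ⟩`. -/
abbrev BaumslagSolitar (m n : ℤ) : Type := PresentedGroup (bsRels m n)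

section Helpers

lemma bs_rel (n : ℤ) : (PresentedGroup.of 1 : BaumslagSolitar 1 n) * PresentedGroup.of 0 =
    (PresentedGroup.of 0) ^ n * PresentedGroup.of 1 := by
  have h : (PresentedGroup.mk (bsRels 1 n)) (FreeGroup.of 1 * (FreeGroup.of 0) ^ (1 : ℤ) *
      (FreeGroup.of 1)⁻¹ * ((FreeGroup.of 0) ^ n)⁻¹) = 1 :=
    (QuotientGroup.eq_one_iff _).2 (Subgroup.subset_normalClosure rfl)
  simp only [map_mul, map_inv, map_zpow, zpow_one] at h
  rw [mul_inv_eq_one, mul_inv_eq_iff_eq_mul] at h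
  exact h

lemma bs_rel_zpow {G : Type*} [Group G] (a t : G) (n : ℤ) (h : t * a = a ^ n * t) (m : ℤ) :
    t * a ^ m = a ^ (n * m) * t := by
  have h1 : t * a * t⁻¹ = a ^ n := by rw [h]; group
  have h2 : t * a ^ m * t⁻¹ = a ^ (n * m) := by
    rw [← conj_zpow, h1, zpow_mul]
  rw [← h2]; group

lemma bs_rel_pow {G : Type*} [Group G] (a t : G) (n : ℤ) (h : t * a = a ^ n * t) (i : ℕ) (m : ℤ) :
    t ^ i * a ^ m = a ^ (n ^ i * m) * t ^ i := by
  induction i generalizing m with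
  | zero => simp
  | succ i ih =>
    rw [pow_succ, mul_assoc, bs_rel_zpow a t n h, ← mul_assoc, ih, mul_assoc, ← mul_assoc (n ^ i), pow_succ n]

/-- Normal form. -/
lemma bs_normal (n : ℤ) (g : BaumslagSolitar 1 n) : ∃ (i j : ℕ) (m : ℤ),
    g = ((PresentedGroup.of 1) ^ i)⁻¹ * (PresentedGroup.of 0) ^ m * (PresentedGroup.of 1) ^ j := by
  have hr := bs_rel n
  set a : BaumslagSolitar 1 n := PresentedGroup.of 0 with ha
  set t : BaumslagSolitar 1 n := PresentedGroup.of 1 with ht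
  have key : ∀ x ∈ Subgroup.closure (Set.range
      (PresentedGroup.of : Fin 2 → BaumslagSolitar 1 n)), ∃ (i j : ℕ) (m : ℤ),
      x = (t ^ i)⁻¹ * a ^ m * t ^ j := by
    have hA : ∀ (e : ℤ) (i j : ℕ) (m : ℤ), a ^ e * ((t ^ i)⁻¹ * a ^ m * t ^ j) =
        (t ^ i)⁻¹ * a ^ (n ^ i * e + m) * t ^ j := by
      intro e i j m
      have := bs_rel_pow a t n hr i e
      rw [zpow_add, ← mul_inv_eq_iff_eq_mul.2 this]
      group
    intro x hx
    induction hx using Subgroup.closure_induction_left with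
    | one => exact ⟨0, 0, 0, by simp⟩
    | mul_left x hx y hy ih =>
      obtain ⟨k, rfl⟩ := hx
      obtain ⟨i, j, m, rfl⟩ := ih
      fin_cases k
      · exact ⟨i, j, n ^ i * 1 + m, by rw [← hA, zpow_one]; rfl⟩
      · cases i with
        | zero =>
          refine ⟨0, j + 1, n * m, ?_⟩
          have := bs_rel_zpow a t n hr m
          change t * _ = _
          simp only [pow_zero, inv_one, one_mul]
          rw [← mul_assoc, this, pow_succ', mul_assoc]
        | succ i =>
          refine ⟨i, j, m, ?_⟩
          change t * _ = _
          rw [pow_succ]; group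
    | inv_mul_cancel x hx y hy ih =>
      obtain ⟨k, rfl⟩ := hx
      obtain ⟨i, j, m, rfl⟩ := ih
      fin_cases k
      · exact ⟨i, j, n ^ i * (-1) + m, by rw [← hA, zpow_neg_one]; rfl⟩
      · refine ⟨i + 1, j, m, ?_⟩
        change t⁻¹ * _ = _
        rw [pow_succ]; group
  exact key g (by rw [PresentedGroup.closure_range_of]; trivial)

lemma bs_model (n : ℤ) (hn0 : n ≠ 0) : ∃ (τ : BaumslagSolitar 1 n → ℤ)
    (c : BaumslagSolitar 1 n → ℚ) (u : ℕ → BaumslagSolitar 1 n),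
    (∀ g h, τ (g * h) = τ g + τ h) ∧
    (∀ g h, c (g * h) = (n : ℚ) ^ (τ g) * c h + c g) ∧
    (∀ g, τ g = 0 → c g = 0 → g = 1) ∧
    (∀ i, u i ∈ Subgroup.zpowers (u (i + 1))) ∧
    (∀ g, τ g = 0 → ∃ i, g ∈ Subgroup.zpowers (u i)) := by
  have hn : (n : ℚ) ≠ 0 := by exact_mod_cast hn0
  let τ₀ : BaumslagSolitar 1 n →* Multiplicative ℤ :=
    PresentedGroup.toGroup (f := ![1, Multiplicative.ofAdd 1]) (by
      intro r hr
      rw [bsRels, Set.mem_singleton_iff] at hr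
      subst hr
      simp)
  let φ : BaumslagSolitar 1 n →* Equiv.Perm ℚ :=
    PresentedGroup.toGroup (f := ![Equiv.addRight 1, Equiv.mulLeft₀ (n : ℚ) hn]) (by
      intro r hr
      rw [bsRels, Set.mem_singleton_iff] at hr
      subst hr
      simp only [map_mul, map_inv, map_zpow, FreeGroup.lift_apply_of, zpow_one]
      rw [mul_inv_eq_one, mul_inv_eq_iff_eq_mul]
      ext x
      simp [Equiv.Perm.mul_apply]
      ring)
  have hφa : ∀ (m : ℤ) x, φ ((PresentedGroup.of 0) ^ m) x = x + m := by
    intro m x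
    simp [φ, map_zpow]
  have hφt : ∀ (m : ℕ) x, φ ((PresentedGroup.of 1) ^ m) x = (n : ℚ) ^ m * x := by
    intro m
    induction m with
    | zero => simp
    | succ m ih =>
      intro x
      rw [pow_succ', map_mul, Equiv.Perm.mul_apply, ih]
      simp [φ]
      ring
  have hφt' : ∀ (m : ℕ) x, φ ((PresentedGroup.of 1) ^ m)⁻¹ x = ((n : ℚ) ^ m)⁻¹ * x := by
    intro m x
    rw [map_inv, Equiv.Perm.inv_eq_iff_eq, hφt]
    field_simp
  have hτ : ∀ (i j : ℕ) (m : ℤ), (τ₀ (((PresentedGroup.of 1) ^ i)⁻¹ * (PresentedGroup.of 0) ^ m *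
      (PresentedGroup.of 1) ^ j)).toAdd = (j : ℤ) - i := by
    intro i j m
    simp [τ₀]
    ring
  have hφ : ∀ (i j : ℕ) (m : ℤ) (x : ℚ), φ (((PresentedGroup.of 1) ^ i)⁻¹ *
      (PresentedGroup.of 0) ^ m * (PresentedGroup.of 1) ^ j) x =
      ((n : ℚ) ^ i)⁻¹ * ((n : ℚ) ^ j * x + m) := by
    intro i j m x
    rw [map_mul, map_mul, Equiv.Perm.mul_apply, Equiv.Perm.mul_apply, hφt, hφa, hφt']
  refine ⟨fun g => (τ₀ g).toAdd, fun g => φ g 0,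
    fun i => (PresentedGroup.of 1 ^ i)⁻¹ * PresentedGroup.of 0 * PresentedGroup.of 1 ^ i,
    ?_, ?_, ?_, ?_, ?_⟩
  · intro g h; simp
  · intro g h
    obtain ⟨i, j, m, rfl⟩ := bs_normal n g
    dsimp only
    rw [hτ, map_mul, Equiv.Perm.mul_apply, hφ, hφ, zpow_sub₀ hn]
    simp only [zpow_natCast]
    field_simp
    ring
  · intro g h1 h2
    obtain ⟨i, j, m, rfl⟩ := bs_normal n g
    dsimp only at h1 h2
    rw [hτ] at h1
    rw [hφ] at h2
    have hij : j = i := by omega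
    have hm : m = 0 := by
      simpa [hn] using h2
    subst hij; subst hm
    simp
  · intro i
    refine ⟨n, ?_⟩
    have := bs_rel n
    have h3 : (PresentedGroup.of 0 : BaumslagSolitar 1 n) ^ n =
      PresentedGroup.of 1 * PresentedGroup.of 0 * (PresentedGroup.of 1)⁻¹ := by
        rw [this]; group
    have h4 := conj_zpow (i := n) (a := ((PresentedGroup.of 1 : BaumslagSolitar 1 n) ^ (i + 1))⁻¹)
      (b := PresentedGroup.of 0)
    rw [inv_inv] at h4
    dsimp only
    rw [h4, h3, pow_succ']
    group
  · intro g hg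
    obtain ⟨i, j, m, rfl⟩ := bs_normal n g
    dsimp only at hg
    rw [hτ] at hg
    have hij : j = i := by omega
    subst hij
    refine ⟨j, m, ?_⟩
    have h4 := conj_zpow (i := m) (a := ((PresentedGroup.of 1 : BaumslagSolitar 1 n) ^ j)⁻¹)
      (b := PresentedGroup.of 0)
    rw [inv_inv] at h4
    exact h4

open scoped Pointwise in
lemma wordBall_bound {G : Type*} [Group G] (S : Finset G) : ∃ C : ℕ, ∀ n,
    (wordBall S n).Finite ∧ (wordBall S n).ncard ≤ C ^ n := by
  classical
  let T : Finset G := insert 1 (S ∪ S⁻¹)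
  have hsub : ∀ n, wordBall S n ⊆ ((T ^ n : Finset G) : Set G) := by
    rintro n g ⟨l, hl, hS, rfl⟩
    refine Finset.pow_subset_pow_right (by simp [T]) hl ?_
    clear hl
    induction l with
    | nil => simp
    | cons x l ih =>
      rw [List.prod_cons, List.length_cons, pow_succ']
      refine Finset.mul_mem_mul ?_ (ih fun y hy => hS y (List.mem_cons_of_mem _ hy))
      have := hS x List.mem_cons_self
      simp only [T, Finset.mem_insert, Finset.mem_union, Finset.mem_inv']
      exact Or.inr this
  refine ⟨T.card, fun n => ⟨(Finset.finite_toSet _).subset (hsub n), ?_⟩⟩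
  calc (wordBall S n).ncard ≤ ((T ^ n : Finset G) : Set G).ncard :=
        Set.ncard_le_ncard (hsub n) (Finset.finite_toSet _)
    _ = (T ^ n).card := Set.ncard_coe_finset _
    _ ≤ _ := Finset.card_pow_le

lemma growth_of_free {G : Type*} [Group G] (S : Finset G) (f : Bool → G)
    (hf : ∀ b, f b ∈ wordBall S 3)
    (hinj : ∀ l l' : List Bool, l.length = l'.length → (l.map f).prod = (l'.map f).prod → l = l') :
    (2 : ℝ) ^ ((1 : ℝ) / 4) ≤ growthRate S := by
  obtain ⟨C, hC⟩ := wordBall_bound S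
  have hmem : ∀ l : List Bool, (l.map f).prod ∈ wordBall S (3 * l.length) := by
    intro l
    induction l with
    | nil => exact ⟨[], by simp⟩
    | cons b l ih =>
      obtain ⟨w, hw, hwS, hwp⟩ := ih
      obtain ⟨v, hv, hvS, hvp⟩ := hf b
      refine ⟨v ++ w, ?_, ?_, ?_⟩
      · simp; omega
      · intro x hx
        rcases List.mem_append.1 hx with h | h
        · exact hvS x h
        · exact hwS x h
      · simp [hvp, hwp]
  have hcount : ∀ N : ℕ, 2 ^ N ≤ (wordBall S (3 * N)).ncard := by
    intro N
    let F : List.Vector Bool N → G := fun v => (v.toList.map f).prod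
    have hF : Function.Injective F := by
      intro v w h
      exact List.Vector.toList_injective (hinj _ _ (by simp) h)
    have h1 : (Set.range F).ncard = 2 ^ N := by
      rw [← Set.image_univ, Set.ncard_image_of_injective _ hF, Set.ncard_univ]
      simp
    rw [← h1]
    refine Set.ncard_le_ncard ?_ (hC _).1
    rintro _ ⟨v, rfl⟩
    have := hmem v.toList
    rwa [List.Vector.toList_length] at this
  apply le_limsup_of_frequently_le
  · rw [frequently_atTop]
    intro N
    refine ⟨3 * (N + 1), by omega, ?_⟩
    have h1 : ((2 : ℝ) ^ (N + 1)) ≤ ((wordBall S (3 * (N + 1))).ncard : ℝ) := by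
      exact_mod_cast hcount (N + 1)
    calc (2 : ℝ) ^ ((1 : ℝ) / 4) ≤ 2 ^ ((1 : ℝ) / 3) :=
          Real.rpow_le_rpow_of_exponent_le (by norm_num) (by norm_num)
      _ = ((2 : ℝ) ^ (N + 1)) ^ (1 / ((3 * (N + 1) : ℕ) : ℝ)) := by
          rw [← Real.rpow_natCast, ← Real.rpow_mul (by norm_num)]
          congr 1
          push_cast
          field_simp
      _ ≤ _ := Real.rpow_le_rpow (by positivity) h1 (by positivity)
  · refine ⟨max 1 C, ?_⟩
    simp only [eventually_map]
    filter_upwards [eventually_ge_atTop 1] with k hk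
    have h1 : ((wordBall S k).ncard : ℝ) ≤ (C : ℝ) ^ k := by exact_mod_cast (hC k).2
    refine le_trans (Real.rpow_le_rpow (by positivity) h1 (by positivity)) ?_
    rw [one_div, Real.pow_rpow_inv_natCast (by positivity) (by omega)]
    exact le_max_right _ _

/-- Two affine maps with the same integer slope `μ`, `|μ| ≥ 2`, generate a free semigroup. -/
lemma free_of_affine {G : Type*} [Group G] (c : G → ℚ) (f : Bool → G) (μ : ℤ) (hμ : 2 ≤ |μ|)
    (hc : ∀ b h, c (f b * h) = μ * c h + c (f b)) (hne : c (f true) ≠ c (f false))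
    (l l' : List Bool) (hl : l.length = l'.length) (h : (l.map f).prod = (l'.map f).prod) :
    l = l' := by
  set d := c (f true) - c (f false) with hd
  have hd0 : d ≠ 0 := sub_ne_zero.2 hne
  have hb : ∀ b b', b ≠ b' → ∃ e : ℤ, (e = 1 ∨ e = -1) ∧ c (f b) - c (f b') = d * e := by
    intro b b' hbb
    cases b <;> cases b' <;> simp at hbb
    · exact ⟨-1, Or.inr rfl, by rw [hd]; push_cast; ring⟩
    · exact ⟨1, Or.inl rfl, by rw [hd]; push_cast; ring⟩
  have hint : ∀ l l' : List Bool, l.length = l'.length →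
      ∃ z : ℤ, c (l.map f).prod - c (l'.map f).prod = d * z := by
    intro l
    induction l with
    | nil =>
      intro l' hl
      have : l' = [] := List.length_eq_zero_iff.1 hl.symm
      subst this
      exact ⟨0, by simp⟩
    | cons b l ih =>
      intro l' hl
      cases l' with
      | nil => simp at hl
      | cons b' l' =>
        obtain ⟨z, hz⟩ := ih l' (by simpa using hl)
        simp only [List.map_cons, List.prod_cons, hc]
        by_cases hbb : b = b'
        · subst hbb
          exact ⟨μ * z, by push_cast; linear_combination (μ : ℚ) * hz⟩
        · obtain ⟨e, -, he⟩ := hb b b' hbb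
          exact ⟨μ * z + e, by push_cast; linear_combination (μ : ℚ) * hz + he⟩
  induction l generalizing l' with
  | nil => exact (List.length_eq_zero_iff.1 hl.symm).symm
  | cons b l ih =>
    cases l' with
    | nil => simp at hl
    | cons b' l' =>
      have hl2 : l.length = l'.length := by simpa using hl
      simp only [List.map_cons, List.prod_cons] at h
      by_cases hbb : b = b'
      · subst hbb
        rw [ih l' hl2 (mul_left_cancel h)]
      · exfalso
        obtain ⟨e, he1, he⟩ := hb b b' hbb
        obtain ⟨z, hz⟩ := hint l l' hl2
        have h2 := congrArg c h
        rw [hc, hc] at h2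
        have h3 : d * ((μ * z + e : ℤ) : ℚ) = 0 := by
          push_cast
          linear_combination h2 - (μ : ℚ) * hz - he
        have h4 : μ * z + e = 0 := by
          have := (mul_eq_zero.1 h3).resolve_left hd0
          exact_mod_cast this
        have h5 : μ ∣ 1 := by
          rcases he1 with rfl | rfl
          · exact ⟨-z, by linear_combination h4⟩
          · exact ⟨z, by linear_combination -h4⟩
        have h6 := Int.isUnit_iff.1 (isUnit_of_dvd_one h5)
        rcases h6 with rfl | rfl <;> norm_num at hμ

end Helpers

/-- For `n ≠ 0, 1, -1`, every finitely generated subgroup `H` of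
`B = BS(1,n)` is trivial, infinite cyclic, or satisfies `ω(H) ≥ 2^(1/4)`. -/
theorem statement18 (n : ℤ) (hn0 : n ≠ 0) (hn1 : n ≠ 1) (hn2 : n ≠ -1)
    (H : Subgroup (BaumslagSolitar 1 n)) (hH : H.FG) :
    Subsingleton ↥H ∨ Nonempty (↥H ≃* Multiplicative ℤ) ∨
    (2 : ℝ) ^ ((1 : ℝ) / 4) ≤ growthOmega ↥H := by
  obtain ⟨τ, c, u, hτ, hc, hker, hu, hloc⟩ := bs_model n hn0
  have hn : (n : ℚ) ≠ 0 := by exact_mod_cast hn0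
  have habs : 2 ≤ |n| := by
    rcases abs_cases n with ⟨h, _⟩ | ⟨h, _⟩ <;> omega
  have hτ1 : τ 1 = 0 := by
    have := hτ 1 1
    rw [mul_one] at this; omega
  have hc1 : c 1 = 0 := by
    have := hc 1 1
    rw [mul_one, hτ1] at this; simpa using this
  have hτi : ∀ g, τ g⁻¹ = - τ g := by
    intro g
    have := hτ g g⁻¹
    rw [mul_inv_cancel, hτ1] at this; omega
  have hinj : ∀ g h, τ g = τ h → c g = c h → g = h := by
    intro g h h1 h2
    rw [← mul_inv_eq_one]
    apply hker
    · rw [hτ, hτi]; omega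
    · have h3 := hc h h⁻¹
      rw [mul_inv_cancel, hc1] at h3
      rw [hc, h1, h2, ← h3]
  have hzp : ∀ k : ℤ, (n : ℚ) ^ k = 1 → k = 0 := by
    intro k hk
    by_contra hk0
    have h1 : (1 : ℚ) < |(n : ℚ)| := by
      rw [← Int.cast_abs]; exact_mod_cast habs
    have h2 : |(n : ℚ)| ^ k = |(n : ℚ)| ^ (0 : ℤ) := by
      rw [← abs_zpow, hk]; simp
    exact hk0 (zpow_right_injective₀ (by linarith) h1.ne' h2)
  by_cases hcomm : ∀ x y : H, x * y = y * x
  · -- the commutative case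
    have hcyc : IsCyclic H := by
      by_cases hall : ∀ x ∈ H, τ x = 0
      · obtain ⟨T, hT⟩ := hH
        have hmono : Monotone fun i => Subgroup.zpowers (u i) :=
          monotone_nat_of_le_succ fun i => Subgroup.zpowers_le.2 (hu i)
        have hTm : ∀ x ∈ T, ∃ i, x ∈ Subgroup.zpowers (u i) := fun x hx =>
          hloc x (hall x (hT ▸ Subgroup.subset_closure hx))
        have hbd : ∃ N, ∀ x ∈ T, x ∈ Subgroup.zpowers (u N) := by
          clear hT
          classical
          induction T using Finset.induction_on with
          | empty => exact ⟨0, by simp⟩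
          | insert x T _ ih =>
            obtain ⟨N, hN⟩ := ih fun y hy => hTm y (Finset.mem_insert_of_mem hy)
            obtain ⟨i, hi⟩ := hTm x (Finset.mem_insert_self _ _)
            refine ⟨max i N, fun y hy => ?_⟩
            rcases Finset.mem_insert.1 hy with rfl | hy
            · exact hmono (le_max_left _ _) hi
            · exact hmono (le_max_right _ _) (hN y hy)
        obtain ⟨N, hN⟩ := hbd
        have hle : H ≤ Subgroup.zpowers (u N) := by
          rw [← hT, Subgroup.closure_le]; exact hN
        exact isCyclic_of_injective (Subgroup.inclusion hle) (Subgroup.inclusion_injective hle)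
      · push Not at hall
        obtain ⟨s, hs, hs0⟩ := hall
        let f : H →* Multiplicative ℤ := MonoidHom.mk' (fun x => Multiplicative.ofAdd (τ x))
          (fun x y => by simp [hτ])
        refine isCyclic_of_injective f ?_
        rw [injective_iff_map_eq_one]
        intro x hx
        have hx0 : τ x = 0 := hx
        have h1 := congrArg (fun y : H => c y) (hcomm ⟨s, hs⟩ x)
        simp only [Subgroup.coe_mul] at h1
        rw [hc, hc, hx0, zpow_zero, one_mul] at h1
        have h2 : ((n : ℚ) ^ (τ s) - 1) * c x = 0 := by linear_combination h1
        rcases mul_eq_zero.1 h2 with h3 | h3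
        · exact absurd (hzp _ (by linarith)) hs0
        · exact Subtype.ext (hker _ hx0 h3)
    by_cases hsub : Subsingleton H
    · exact Or.inl hsub
    · right; left
      have : Infinite H := by
        by_contra hfin
        rw [not_infinite_iff_finite] at hfin
        apply hsub
        refine subsingleton_of_forall_eq 1 fun x => ?_
        have hx : x ^ Nat.card H = 1 := pow_card_eq_one'
        have hpos : Nat.card H ≠ 0 := Nat.card_pos.ne'
        have hx' : (x : BaumslagSolitar 1 n) ^ Nat.card H = 1 := by
          exact_mod_cast congrArg Subtype.val hx
        have hτp : ∀ k : ℕ, τ ((x : BaumslagSolitar 1 n) ^ k) = k * τ x := by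
          intro k
          induction k with
          | zero => simp [hτ1]
          | succ k ih => rw [pow_succ, hτ, ih]; push_cast; ring
        have hx0 : τ x = 0 := by
          have := hτp (Nat.card H)
          rw [hx', hτ1] at this
          have := mul_eq_zero.1 this.symm
          exact this.resolve_left (by exact_mod_cast hpos)
        have hcp : ∀ k : ℕ, c ((x : BaumslagSolitar 1 n) ^ k) = k * c x := by
          intro k
          induction k with
          | zero => simp [hc1]
          | succ k ih => rw [pow_succ', hc, ih, hx0]; push_cast; simp; ring
        have hcx : c x = 0 := by
          have := hcp (Nat.card H)
          rw [hx', hc1] at this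
          have := mul_eq_zero.1 this.symm
          exact this.resolve_left (by exact_mod_cast hpos)
        exact Subtype.ext (hker _ hx0 hcx)
      exact ⟨(intCyclicMulEquiv (G := H)).symm⟩
  · -- the noncommutative case
    right; right
    apply le_csInf
    · have : Group.FG H := (Group.fg_iff_subgroup_fg H).2 hH
      obtain ⟨S, hS⟩ := Group.fg_def.1 this
      exact ⟨_, S, hS, rfl⟩
    rintro r ⟨S, hS, rfl⟩
    have hnc : ∃ x ∈ S, ∃ y ∈ S, x * y ≠ y * x := by
      by_contra hcon
      push Not at hcon
      apply hcomm
      have h1 : S ≤ (Subgroup.centralizer (S : Set H) : Set H) := by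
        intro y hy
        exact Subgroup.mem_centralizer_iff.2 fun x hx => hcon x hx y hy
      have h2 : (⊤ : Subgroup H) ≤ Subgroup.centralizer (S : Set H) := by
        rw [← hS, Subgroup.closure_le]; exact h1
      have h3 : (⊤ : Subgroup H) ≤ Subgroup.center H := by
        rw [← hS, Subgroup.closure_le]
        intro x hx
        exact Subgroup.mem_center_iff.2 fun y =>
          (Subgroup.mem_centralizer_iff.1 (h2 (Subgroup.mem_top y)) x hx).symm
      intro x y
      exact (Subgroup.mem_center_iff.1 (h3 (Subgroup.mem_top y)) x)
    have hgood : ∃ x y : H, (x ∈ S ∨ x⁻¹ ∈ S) ∧ y ∈ S ∧ 0 < τ x ∧ x * y ≠ y * x := by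
      have aux : ∀ x ∈ S, ∀ y ∈ S, x * y ≠ y * x → τ x ≠ 0 →
          ∃ x y : H, (x ∈ S ∨ x⁻¹ ∈ S) ∧ y ∈ S ∧ 0 < τ x ∧ x * y ≠ y * x := by
        intro x hx y hy hxy hx0
        rcases lt_or_gt_of_ne hx0 with h | h
        · refine ⟨x⁻¹, y, Or.inr (by simpa using hx), hy, ?_, ?_⟩
          · rw [Subgroup.coe_inv, hτi]; omega
          · intro h2
            have h3 : Commute x⁻¹ y := h2
            exact hxy (Commute.inv_left_iff.1 h3)
        · exact ⟨x, y, Or.inl hx, hy, h, hxy⟩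
      obtain ⟨x, hx, y, hy, hxy⟩ := hnc
      by_cases hx0 : τ x = 0
      · by_cases hy0 : τ y = 0
        · exfalso
          apply hxy
          apply Subtype.ext
          apply hinj
          · simp only [Subgroup.coe_mul]; rw [hτ, hτ]; omega
          · simp only [Subgroup.coe_mul]; rw [hc, hc, hx0, hy0]; simp; ring
        · exact aux y hy x hx hxy.symm hy0
      · exact aux x hx y hy hxy hx0
    obtain ⟨x, y, hx, hy, hpos, hxy⟩ := hgood
    obtain ⟨k, hk⟩ := Int.eq_ofNat_of_zero_le hpos.le
    have hk0 : k ≠ 0 := by rintro rfl; simp [hk] at hpos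
    let f : Bool → H := fun b => if b then x else y * x * y⁻¹
    have hτf : ∀ b, τ (f b) = k := by
      intro b
      cases b
      · simp only [f, Bool.false_eq_true, if_false, Subgroup.coe_mul, Subgroup.coe_inv]
        rw [hτ, hτ, hτi]; omega
      · simpa [f] using hk
    apply growth_of_free S f
    · intro b
      cases b
      · refine ⟨[y, x, y⁻¹], by simp, ?_, by simp [f, mul_assoc]⟩
        intro z hz
        simp only [List.mem_cons, List.not_mem_nil, or_false] at hz
        rcases hz with rfl | rfl | rfl
        · exact Or.inl hy
        · exact hx
        · exact Or.inr (by simpa using hy)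
      · exact ⟨[x], by simp, by simpa using hx, by simp [f]⟩
    · refine free_of_affine (fun g : H => c g) f (n ^ k) ?_ ?_ ?_
      · rw [abs_pow]
        exact habs.trans (le_self_pow₀ (by omega) hk0)
      · intro b h
        simp only [Subgroup.coe_mul]
        rw [hc, hτf]
        push_cast
        rw [zpow_natCast]
      · intro h
        have h1 : f true = f false :=
          Subtype.ext (hinj _ _ ((hτf true).trans (hτf false).symm) h)
        simp only [f, if_true, Bool.false_eq_true, if_false] at h1
        exact hxy (eq_mul_inv_iff_mul_eq.1 h1)
end
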